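/- arXiv:0904.2756 — 3 statements merged into one kernel-verified Lean document; each statement's English description precedes it below -/
import Mathlib

section
/- Let n ≥ 5 and let K be a real number with K > max_{0≤t≤ω} |P_0(t)|. Suppose that for all t ∈ [0,ω]: (a) P_{n−2}(t) ≤ 0; (b) |P_i(t)| ≤ (K − K^{(n−2)/n}·P_{n−2}(t) − |P_0(t)|)·sin(π/(n−2)) / ((n−4)·K^{i/n}) for every index i with i ≠ 0, 1, n−2; and (c) |P_1(t)| ≥ (K + |P_0(t)| − K^{(n−2)/n}·P_{n−2}(t) + ((n−3)/(n−4))·(K − K^{(n−2)/n}·P_{n−2}(t) − |P_0(t)|)·sin(π/(n−2))) / K^{1/n}. Then equation (1.1) has exactly n complex periodic solutions counted with multiplicity. -/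
open Set Real Filter

noncomputable section

/-- Right-hand side of equation (1.1):
`z^n + P_{n-1}(t) z^{n-1} + ⋯ + P_1(t) z + P_0(t)`. -/
def rhsC (n : ℕ) (P : Fin n → ℝ → ℝ) (t : ℝ) (z : ℂ) : ℂ :=
  z ^ n + ∑ i : Fin n, (P i t : ℂ) * z ^ (i : ℕ)

/-- `z` is a (complex-valued) solution of (1.1) on all of `[0, ω]`. -/
def IsSolC (n : ℕ) (ω : ℝ) (P : Fin n → ℝ → ℝ) (z : ℝ → ℂ) : Prop :=
  ∀ t ∈ Icc (0:ℝ) ω, HasDerivWithinAt z (rhsC n P t (z t)) (Icc (0:ℝ) ω) t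

/-- `q` has a zero of order exactly `k` at `c`. -/
def HasZeroOfOrder (q : ℂ → ℂ) (c : ℂ) (k : ℕ) : Prop :=
  ∃ g : ℂ → ℂ, AnalyticAt ℂ g c ∧ g c ≠ 0 ∧ ∀ᶠ w in nhds c, q w = (w - c) ^ k * g w

lemma exists_eq_pow_mul_of_analyticOrderAt {U : Set ℂ} {f : ℂ → ℂ} (hf : AnalyticOnNhd ℂ f U)
    {a : ℂ} (ha : a ∈ U) (h : analyticOrderAt f a ≠ ⊤) :
    ∃ g : ℂ → ℂ, AnalyticOnNhd ℂ g U ∧ g a ≠ 0 ∧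
      f = fun z => (z - a) ^ analyticOrderNatAt f a * g z := by
  obtain ⟨g₀, hg₀, hga, hfg⟩ := ((hf a ha).analyticOrderAt_ne_top).1 h
  set m := analyticOrderNatAt f a
  classical
  let g : ℂ → ℂ := fun z => if z = a then g₀ a else f z / (z - a) ^ m
  have hgdef : ∀ z, z ≠ a → g z = f z / (z - a) ^ m := fun z hz => if_neg hz
  have hgaa : g a = g₀ a := if_pos rfl
  refine ⟨g, ?_, by rwa [hgaa], ?_⟩
  · intro z hz
    by_cases hza : z = a
    · subst hza
      refine hg₀.congr ?_
      filter_upwards [hfg] with w hw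
      by_cases hwz : w = z
      · rw [hwz, hgaa]
      · rw [hgdef w hwz, hw, smul_eq_mul, mul_div_cancel_left₀]
        exact pow_ne_zero _ (sub_ne_zero.2 hwz)
    · have : AnalyticAt ℂ (fun w => f w / (w - a) ^ m) z :=
        (hf z hz).div (by fun_prop) (pow_ne_zero _ (sub_ne_zero.2 hza))
      refine this.congr ?_
      filter_upwards [isOpen_ne.mem_nhds hza] with w hw
      exact (hgdef w hw).symm
  · funext z
    by_cases hza : z = a
    · rw [hza, hgaa, hfg.self_of_nhds]
      simp only [smul_eq_mul]
    · rw [hgdef z hza, mul_div_cancel₀]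
      exact pow_ne_zero _ (sub_ne_zero.2 hza)

/-- The argument principle on a disc. -/
lemma circleIntegral_logDeriv_eq_sum {c : ℂ} {R : ℝ} (hR : 0 < R) (S : Finset ℂ) :
    ∀ f : ℂ → ℂ, AnalyticOnNhd ℂ f (Metric.closedBall c R) → (S : Set ℂ) ⊆ Metric.ball c R →
      (∀ z ∈ Metric.closedBall c R, f z = 0 ↔ z ∈ S) →
      (∀ z ∈ S, analyticOrderAt f z ≠ ⊤) →
      (∮ z in C(c, R), logDeriv f z) =
        2 * π * Complex.I * ((∑ a ∈ S, analyticOrderNatAt f a : ℕ) : ℂ) := by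
  classical
  induction S using Finset.induction_on with
  | empty =>
    intro f hf _ hz _
    have h0 : ∀ z ∈ Metric.closedBall c R, f z ≠ 0 := fun z hz' h => by
      simpa using (hz z hz').1 h
    simp only [Finset.sum_empty, Nat.cast_zero, mul_zero]
    apply Complex.circleIntegral_eq_zero_of_differentiable_on_off_countable hR.le
      Set.countable_empty
    · intro z hz
      exact ((hf z hz).deriv.div (hf z hz) (h0 z hz)).continuousAt.continuousWithinAt
    · intro z hz
      have hz' := Metric.ball_subset_closedBall hz.1
      exact ((hf z hz').deriv.div (hf z hz') (h0 z hz')).differentiableAt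
  | insert a S haS ih =>
    intro f hf hS hz hord
    have haB : a ∈ Metric.ball c R := hS (by simp)
    have haC := Metric.ball_subset_closedBall haB
    obtain ⟨g, hg, hga, hfg⟩ := exists_eq_pow_mul_of_analyticOrderAt hf haC (hord a (by simp))
    set m := analyticOrderNatAt f a
    have hg0 : ∀ z ∈ Metric.closedBall c R, g z = 0 ↔ z ∈ S := by
      intro z hzC
      by_cases hza : z = a
      · subst hza; simp [hga, haS]
      · have := hz z hzC
        rw [hfg] at this
        simpa [sub_ne_zero.2 hza, hza] using this
    have hordeq : ∀ z ∈ S, analyticOrderAt f z = analyticOrderAt g z := by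
      intro z hzS
      have hza : z ≠ a := fun h => haS (h ▸ hzS)
      have hzC := Metric.ball_subset_closedBall (hS (Finset.mem_coe.2 (Finset.mem_insert_of_mem hzS)))
      have h1 : AnalyticAt ℂ (fun w : ℂ => (w - a) ^ m) z := by fun_prop
      have h2 : analyticOrderAt (fun w : ℂ => (w - a) ^ m) z = 0 :=
        h1.analyticOrderAt_eq_zero.2 (pow_ne_zero _ (sub_ne_zero.2 hza))
      have h3 := analyticOrderAt_mul h1 (hg z hzC)
      rw [h2, zero_add] at h3
      rw [← h3, hfg]; rfl
    have ihg := ih g hg (fun z hzS => hS (by simp at hzS ⊢; exact Or.inr hzS)) hg0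
      (fun z hzS => by rw [← hordeq z hzS]; exact hord z (by simp [hzS]))
    have hsum : ∑ b ∈ S, analyticOrderNatAt f b = ∑ b ∈ S, analyticOrderNatAt g b :=
      Finset.sum_congr rfl fun b hb => by rw [analyticOrderNatAt, analyticOrderNatAt, hordeq b hb]
    have hsph : ∀ z ∈ Metric.sphere c R, z - a ≠ 0 ∧ g z ≠ 0 := by
      intro z hzs
      have hzb : z ∉ Metric.ball c R := by
        simp only [Metric.mem_sphere] at hzs; simp [hzs]
      refine ⟨sub_ne_zero.2 fun h => hzb (h ▸ haB), fun h => hzb (hS ?_)⟩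
      have := (hg0 z (Metric.sphere_subset_closedBall hzs)).1 h
      simp [this]
    have hlog : ∀ z ∈ Metric.sphere c R, logDeriv f z = (m : ℂ) * (z - a)⁻¹ + logDeriv g z := by
      intro z hzs
      obtain ⟨h1, h2⟩ := hsph z hzs
      have hzC := Metric.sphere_subset_closedBall hzs
      rw [hfg, logDeriv_mul (f := fun z => (z - a) ^ m) z (pow_ne_zero _ h1) h2
        (by fun_prop) (hg z hzC).differentiableAt]
      congr 1
      rw [logDeriv_fun_pow (by fun_prop)]
      simp [logDeriv_apply]
    have hi1 : CircleIntegrable (fun z => (m : ℂ) * (z - a)⁻¹) c R := by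
      apply ContinuousOn.circleIntegrable hR.le
      exact continuousOn_const.mul ((continuousOn_id.sub continuousOn_const).inv₀
        fun z hzs => (hsph z hzs).1)
    have hi2 : CircleIntegrable (logDeriv g) c R := by
      apply ContinuousOn.circleIntegrable hR.le
      intro z hzs
      have hzC := Metric.sphere_subset_closedBall hzs
      exact ((hg z hzC).deriv.div (hg z hzC) (hsph z hzs).2).continuousAt.continuousWithinAt
    rw [circleIntegral.integral_congr hR.le hlog, circleIntegral.integral_add hi1 hi2,
      circleIntegral.integral_const_mul, circleIntegral.integral_sub_inv_of_mem_ball haB, ihg,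
      Finset.sum_insert haS, hsum]
    push_cast
    ring

lemma circleIntegral_logDeriv_eq_of_norm_sub_lt {c : ℂ} {R : ℝ} (hR : 0 < R) {f g : ℂ → ℂ}
    (hf : AnalyticOnNhd ℂ f (Metric.closedBall c R))
    (hg : AnalyticOnNhd ℂ g (Metric.closedBall c R))
    (h : ∀ z ∈ Metric.sphere c R, ‖f z - g z‖ < ‖f z‖) :
    (∮ z in C(c, R), logDeriv f z) = ∮ z in C(c, R), logDeriv g z := by
  have hf0 : ∀ z ∈ Metric.sphere c R, f z ≠ 0 := fun z hz h0 => by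
    have := h z hz
    rw [h0, norm_zero] at this
    exact absurd (norm_nonneg _) this.not_ge
  have hg0 : ∀ z ∈ Metric.sphere c R, g z ≠ 0 := fun z hz h0 => by
    have := h z hz
    rw [h0, sub_zero] at this
    exact this.false
  have hint : ∀ k : ℂ → ℂ, AnalyticOnNhd ℂ k (Metric.closedBall c R) →
      (∀ z ∈ Metric.sphere c R, k z ≠ 0) → CircleIntegrable (logDeriv k) c R := by
    intro k hk hk0
    apply ContinuousOn.circleIntegrable hR.le
    intro z hzs
    have hzC := Metric.sphere_subset_closedBall hzs
    exact ((hk z hzC).deriv.div (hk z hzC) (hk0 z hzs)).continuousAt.continuousWithinAt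
  rw [← sub_eq_zero, ← circleIntegral.integral_sub (hint f hf hf0) (hint g hg hg0), ← neg_eq_zero,
    ← neg_one_mul, ← circleIntegral.integral_const_mul]
  apply circleIntegral.integral_eq_zero_of_hasDerivWithinAt (f := fun z => Complex.log (g z / f z))
    hR.le
  intro z hz
  have hzC := Metric.sphere_subset_closedBall hz
  have hslit : g z / f z ∈ Complex.slitPlane := by
    have h1 : ‖g z / f z - 1‖ < 1 := by
      rw [div_sub_one (hf0 z hz), norm_div, norm_sub_rev, div_lt_one (norm_pos_iff.2 (hf0 z hz))]
      exact h z hz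
    have := Complex.mem_slitPlane_of_norm_lt_one h1
    simpa using this
  have hd := ((hg z hzC).differentiableAt.hasDerivAt.div (hf z hzC).differentiableAt.hasDerivAt
    (hf0 z hz)).clog hslit
  refine (hd.congr_deriv ?_).hasDerivWithinAt
  have := hf0 z hz
  have := hg0 z hz
  simp only [logDeriv_apply, Pi.div_apply]
  field_simp
  ring

/-- Rouché's theorem on a disc, with zeros counted by their analytic order. -/
lemma finsum_analyticOrderNatAt_eq_of_norm_sub_lt {c : ℂ} {R : ℝ} (hR : 0 < R) {f g : ℂ → ℂ}
    (hf : AnalyticOnNhd ℂ f (Metric.closedBall c R))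
    (hg : AnalyticOnNhd ℂ g (Metric.closedBall c R))
    (h : ∀ z ∈ Metric.sphere c R, ‖f z - g z‖ < ‖f z‖) :
    ∑ᶠ a ∈ Metric.ball c R, analyticOrderNatAt f a =
      ∑ᶠ a ∈ Metric.ball c R, analyticOrderNatAt g a := by
  have hf0 : ∀ z ∈ Metric.sphere c R, f z ≠ 0 := fun z hz h0 => by
    have := h z hz
    rw [h0, norm_zero] at this
    exact absurd (norm_nonneg _) this.not_ge
  have hg0 : ∀ z ∈ Metric.sphere c R, g z ≠ 0 := fun z hz h0 => by
    have := h z hz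
    rw [h0, sub_zero] at this
    exact this.false
  have key : ∀ k : ℂ → ℂ, AnalyticOnNhd ℂ k (Metric.closedBall c R) →
      (∀ z ∈ Metric.sphere c R, k z ≠ 0) →
      (∮ z in C(c, R), logDeriv k z) =
        2 * π * Complex.I * ((∑ᶠ a ∈ Metric.ball c R, analyticOrderNatAt k a : ℕ) : ℂ) := by
    intro k hk hk0
    obtain ⟨w, hw⟩ := (NormedSpace.sphere_nonempty (x := c) (r := R)).2 hR.le
    have hconn : IsPreconnected (Metric.closedBall c R) :=
      (convex_closedBall c R).isPreconnected
    have htop : ∀ z ∈ Metric.closedBall c R, analyticOrderAt k z ≠ ⊤ := by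
      intro z hz
      refine hk.analyticOrderAt_ne_top_of_isPreconnected hconn
        (Metric.sphere_subset_closedBall hw) hz ?_
      rw [(hk w (Metric.sphere_subset_closedBall hw)).analyticOrderAt_eq_zero.2 (hk0 w hw)]
      simp
    have hfin : (Metric.closedBall c R ∩ k ⁻¹' {0}).Finite := by
      by_contra hinf
      obtain ⟨x, hx, hacc⟩ := Set.Infinite.exists_accPt_of_subset_isCompact hinf
        (isCompact_closedBall c R) inter_subset_left
      rcases (hk x hx).eventually_eq_zero_or_eventually_ne_zero with h0 | h0
      · exact htop x hx (analyticOrderAt_eq_top.2 h0)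
      · rw [accPt_iff_frequently_nhdsNE] at hacc
        exact hacc (h0.mono fun y hy hy' => hy hy'.2)
    have hzero : ∀ z ∈ Metric.closedBall c R, k z = 0 ↔ z ∈ hfin.toFinset := by
      intro z hz; simp; exact fun _ => by simpa using hz
    have hsub : (hfin.toFinset : Set ℂ) ⊆ Metric.ball c R := by
      intro z hz
      simp only [Finite.coe_toFinset, mem_inter_iff, mem_preimage, mem_singleton_iff] at hz
      rw [← Metric.ball_union_sphere] at hz
      exact hz.1.resolve_right fun hs => hk0 z hs hz.2
    rw [circleIntegral_logDeriv_eq_sum hR hfin.toFinset k hk hsub hzero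
      fun z hz => htop z (Metric.ball_subset_closedBall (hsub hz))]
    congr 2
    symm
    apply finsum_mem_eq_sum_of_inter_support_eq
    ext z
    simp only [mem_inter_iff, Function.mem_support]
    constructor
    · rintro ⟨hz, hne⟩
      refine ⟨(hzero z (Metric.ball_subset_closedBall hz)).1 ?_, hne⟩
      by_contra h0
      apply hne
      rw [analyticOrderNatAt,
        (hk z (Metric.ball_subset_closedBall hz)).analyticOrderAt_eq_zero.2 h0]
      rfl
    · rintro ⟨hz, hne⟩
      exact ⟨hsub hz, hne⟩
  have h1 := circleIntegral_logDeriv_eq_of_norm_sub_lt hR hf hg h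
  rw [key f hf hf0, key g hg hg0] at h1
  have h2 := mul_left_cancel₀ Complex.two_pi_I_ne_zero h1
  exact_mod_cast h2

lemma finite_zeros_of_isCompact {V : Set ℂ} (hV : IsOpen V) {q : ℂ → ℂ}
    (hq : AnalyticOnNhd ℂ q V) (hZ : IsCompact {c | c ∈ V ∧ q c = 0}) :
    {c | c ∈ V ∧ q c = 0}.Finite ∧ ∀ c ∈ V, q c = 0 → analyticOrderAt q c ≠ ⊤ := by
  set Z := {c | c ∈ V ∧ q c = 0} with hZdef
  have hord : ∀ c ∈ V, q c = 0 → analyticOrderAt q c ≠ ⊤ := by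
    set T := {c | c ∈ V ∧ ∀ᶠ w in nhds c, q w = 0} with hT
    have hTZ : T ⊆ Z := fun c hc => ⟨hc.1, hc.2.self_of_nhds⟩
    have hTo : IsOpen T := by
      rw [isOpen_iff_mem_nhds]
      intro c hc
      filter_upwards [hV.mem_nhds hc.1, eventually_eventually_nhds.2 hc.2] with w h1 h2
      exact ⟨h1, h2⟩
    have hTc : IsClosed T := by
      apply isClosed_of_closure_subset
      intro c hc
      have hcZ : c ∈ Z := hZ.isClosed.closure_subset_iff.2 hTZ hc
      refine ⟨hcZ.1, ?_⟩
      rcases (hq c hcZ.1).eventually_eq_zero_or_eventually_ne_zero with h0 | h0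
      · exact h0
      · rw [eventually_nhdsWithin_iff] at h0
        obtain ⟨w, hwT, hw⟩ := ((mem_closure_iff_frequently.1 hc).and_eventually h0).exists
        by_cases hwc : w = c
        · rw [← hwc]; exact hwT.2
        · exact absurd (hTZ hwT).2 (hw hwc)
    have hTe : T = ∅ := by
      rcases isClopen_iff.1 ⟨hTc, hTo⟩ with h | h
      · exact h
      · exfalso
        have : IsCompact (univ : Set ℂ) := by
          rw [← h]; exact hZ.of_isClosed_subset hTc hTZ
        exact noncompact_univ ℂ this
    intro c hc h0 htop
    have : c ∈ T := ⟨hc, analyticOrderAt_eq_top.1 htop⟩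
    simp [hTe] at this
  refine ⟨?_, hord⟩
  by_contra hinf
  obtain ⟨x, hx, hacc⟩ := Set.Infinite.exists_accPt_of_subset_isCompact hinf hZ Subset.rfl
  rcases (hq x hx.1).eventually_eq_zero_or_eventually_ne_zero with h0 | h0
  · exact hord x hx.1 hx.2 (analyticOrderAt_eq_top.2 h0)
  · rw [accPt_iff_frequently_nhdsNE] at hacc
    exact hacc (h0.mono fun y hy hy' => hy hy'.2)

lemma finsum_zeros_eq_sum_balls {V : Set ℂ} {q : ℂ → ℂ}
    (hq : AnalyticOnNhd ℂ q V) (hfin : {c | c ∈ V ∧ q c = 0}.Finite)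
    {F : Set ℂ} (hF : F.Finite) {δ : ℝ} (hFV : ∀ c ∈ F, Metric.closedBall c δ ⊆ V)
    (hdisj : ∀ c ∈ F, ∀ c' ∈ F, c ≠ c' → 2 * δ < dist c c')
    (hcov : ∀ c ∈ V, q c = 0 → ∃ c₀ ∈ F, c ∈ Metric.ball c₀ δ) :
    ∑ᶠ a ∈ {c | c ∈ V ∧ q c = 0}, analyticOrderNatAt q a =
      ∑ᶠ c₀ ∈ F, ∑ᶠ a ∈ Metric.ball c₀ δ, analyticOrderNatAt q a := by
  set Z := {c | c ∈ V ∧ q c = 0} with hZdef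
  have h1 : Z = ⋃ c₀ ∈ F, (Metric.ball c₀ δ ∩ Z) := by
    ext c
    simp only [mem_iUnion, mem_inter_iff, exists_prop]
    constructor
    · intro hc
      obtain ⟨c₀, h, h'⟩ := hcov c hc.1 hc.2
      exact ⟨c₀, h, h', hc⟩
    · rintro ⟨_, _, _, h⟩; exact h
  rw [h1, finsum_mem_biUnion _ hF (fun c _ => hfin.subset inter_subset_right)]
  · apply finsum_mem_congr rfl
    intro c₀ hc₀
    apply finsum_mem_inter_support_eq
    ext a
    simp only [mem_inter_iff, Function.mem_support]
    constructor
    · rintro ⟨⟨h, -⟩, h'⟩; exact ⟨h, h'⟩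
    · rintro ⟨h, h'⟩
      have hV := hFV c₀ hc₀ (Metric.ball_subset_closedBall h)
      refine ⟨⟨h, hV, ?_⟩, h'⟩
      by_contra h0
      apply h'
      rw [analyticOrderNatAt, (hq a hV).analyticOrderAt_eq_zero.2 h0]
      rfl
  · intro c hc c' hc' hne
    refine Disjoint.mono inter_subset_left inter_subset_left (Metric.ball_disjoint_ball ?_)
    have := hdisj c hc c' hc' hne
    linarith

/-- Homotopy invariance of the number of zeros, when the zeros stay in a compact set. -/
lemma finsum_zeros_eq_of_homotopy {V : ℝ → Set ℂ} {q : ℝ → ℂ → ℂ} {A : ℝ}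
    (hV : ∀ s₀ ∈ Icc (0 : ℝ) 1, ∀ c₀ ∈ V s₀, ∃ δ > 0, ∀ s ∈ Icc (0 : ℝ) 1, |s - s₀| < δ →
      ∀ c, dist c c₀ ≤ δ → c ∈ V s)
    (hq : ∀ s ∈ Icc (0 : ℝ) 1, AnalyticOnNhd ℂ (q s) (V s))
    (hlip : ∀ s ∈ Icc (0 : ℝ) 1, ∀ s' ∈ Icc (0 : ℝ) 1, ∀ c, ‖q s c - q s' c‖ ≤ A * |s - s'|)
    (hZ : IsCompact {x : ℝ × ℂ | x.1 ∈ Icc (0 : ℝ) 1 ∧ x.2 ∈ V x.1 ∧ q x.1 x.2 = 0}) :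
    (∀ s ∈ Icc (0 : ℝ) 1, {c | c ∈ V s ∧ q s c = 0}.Finite ∧
      ∀ c ∈ V s, q s c = 0 → analyticOrderAt (q s) c ≠ ⊤) ∧
    ∑ᶠ a ∈ {c | c ∈ V 0 ∧ q 0 c = 0}, analyticOrderNatAt (q 0) a =
      ∑ᶠ a ∈ {c | c ∈ V 1 ∧ q 1 c = 0}, analyticOrderNatAt (q 1) a := by
  have hVo : ∀ s ∈ Icc (0 : ℝ) 1, IsOpen (V s) := by
    intro s hs
    rw [Metric.isOpen_iff]
    intro c hc
    obtain ⟨δ, hδ, h⟩ := hV s hs c hc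
    exact ⟨δ, hδ, fun w hw => h s hs (by simpa using hδ) w (Metric.mem_ball.1 hw).le⟩
  have hfin : ∀ s ∈ Icc (0 : ℝ) 1, {c | c ∈ V s ∧ q s c = 0}.Finite ∧
      ∀ c ∈ V s, q s c = 0 → analyticOrderAt (q s) c ≠ ⊤ := by
    intro s hs
    apply finite_zeros_of_isCompact (hVo s hs) (hq s hs)
    have h1 := (hZ.inter_right (isClosed_singleton.preimage continuous_fst :
      IsClosed (Prod.fst ⁻¹' {s} : Set (ℝ × ℂ)))).image continuous_snd
    convert h1 using 1
    ext c
    constructor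
    · rintro ⟨h, h'⟩; exact ⟨(s, c), ⟨⟨hs, h, h'⟩, rfl⟩, rfl⟩
    · rintro ⟨⟨s', c'⟩, ⟨⟨_, h, h'⟩, hs'⟩, rfl⟩
      obtain rfl : s' = s := hs'
      exact ⟨h, h'⟩
  refine ⟨hfin, ?_⟩
  refine isPreconnected_Icc.constant
    (f := fun s => ∑ᶠ a ∈ {c | c ∈ V s ∧ q s c = 0}, analyticOrderNatAt (q s) a)
    ?_ (left_mem_Icc.2 zero_le_one) (right_mem_Icc.2 zero_le_one)
  intro s₀ hs₀
  set F := {c | c ∈ V s₀ ∧ q s₀ c = 0} with hFdef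
  have hF : F.Finite := (hfin s₀ hs₀).1
  -- a common radius
  have e1 : ∀ᶠ δ in nhdsWithin (0 : ℝ) (Ioi 0), ∀ c ∈ F, ∀ s ∈ Icc (0 : ℝ) 1, |s - s₀| < δ →
      Metric.closedBall c δ ⊆ V s := by
    rw [eventually_all_finite hF]
    intro c hc
    obtain ⟨δ, hδ, h⟩ := hV s₀ hs₀ c hc.1
    filter_upwards [Ioo_mem_nhdsGT hδ] with η hη s hs hss w hw
    exact h s hs (hss.trans hη.2) w ((Metric.mem_closedBall.1 hw).trans hη.2.le)
  have e2 : ∀ᶠ δ in nhdsWithin (0 : ℝ) (Ioi 0), ∀ c ∈ F, ∀ c' ∈ F, c ≠ c' →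
      2 * δ < dist c c' := by
    rw [eventually_all_finite hF]
    intro c hc
    rw [eventually_all_finite hF]
    intro c' hc'
    by_cases hne : c = c'
    · simp [hne]
    · have : 0 < dist c c' / 2 := half_pos (dist_pos.2 hne)
      filter_upwards [Ioo_mem_nhdsGT this] with η hη _
      linarith [hη.2]
  obtain ⟨δ, ⟨h1, h2⟩, hδ⟩ := ((e1.and e2).and (self_mem_nhdsWithin)).exists
  replace hδ : 0 < δ := hδ
  have hself : ∀ c ∈ F, Metric.closedBall c δ ⊆ V s₀ := fun c hc =>
    h1 c hc s₀ hs₀ (by simpa using hδ)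
  have hsph : ∀ c ∈ F, ∀ z ∈ Metric.sphere c δ, q s₀ z ≠ 0 := by
    intro c hc z hz h0
    have hzF : z ∈ F := ⟨hself c hc (Metric.sphere_subset_closedBall hz), h0⟩
    have hzc : z ≠ c := by
      rintro rfl
      simp at hz; linarith
    have := h2 z hzF c hc hzc
    rw [Metric.mem_sphere] at hz
    linarith
  have e3 : ∀ᶠ ε in nhdsWithin (0 : ℝ) (Ioi 0), ∀ c ∈ F, ∀ z ∈ Metric.sphere c δ,
      ε < ‖q s₀ z‖ := by
    rw [eventually_all_finite hF]
    intro c hc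
    have hcont : ContinuousOn (fun z => ‖q s₀ z‖) (Metric.sphere c δ) := fun z hz =>
      (hq s₀ hs₀ z (hself c hc (Metric.sphere_subset_closedBall hz))
        ).continuousAt.norm.continuousWithinAt
    obtain ⟨z₀, hz₀, hmin⟩ := (isCompact_sphere c δ).exists_isMinOn
      ((NormedSpace.sphere_nonempty (x := c) (r := δ)).2 hδ.le) hcont
    filter_upwards [Ioo_mem_nhdsGT (norm_pos_iff.2 (hsph c hc z₀ hz₀))] with ε hε z hz
    exact hε.2.trans_le (hmin hz)
  obtain ⟨ε, h3, hε⟩ := (e3.and self_mem_nhdsWithin).exists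
  replace hε : 0 < ε := hε
  -- no zeros away from the discs
  have e4 : ∀ᶠ s in nhds s₀, ∀ c ∈ V s, s ∈ Icc (0 : ℝ) 1 → q s c = 0 →
      ∃ c₀ ∈ F, c ∈ Metric.ball c₀ δ := by
    have hW : IsCompact (Prod.fst '' ({x : ℝ × ℂ | x.1 ∈ Icc (0 : ℝ) 1 ∧ x.2 ∈ V x.1 ∧
        q x.1 x.2 = 0} ∩ Prod.snd ⁻¹' (⋃ c₀ ∈ F, Metric.ball c₀ δ)ᶜ)) := by
      apply (hZ.inter_right _).image continuous_fst
      apply IsClosed.preimage continuous_snd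
      exact (isOpen_biUnion fun _ _ => Metric.isOpen_ball).isClosed_compl
    have hs₀W : s₀ ∉ (Prod.fst '' ({x : ℝ × ℂ | x.1 ∈ Icc (0 : ℝ) 1 ∧ x.2 ∈ V x.1 ∧
        q x.1 x.2 = 0} ∩ Prod.snd ⁻¹' (⋃ c₀ ∈ F, Metric.ball c₀ δ)ᶜ)) := by
      rintro ⟨⟨s, c⟩, ⟨⟨_, hc1, hc2⟩, hc3⟩, rfl⟩
      apply hc3
      simp only [mem_iUnion]
      exact ⟨c, ⟨hc1, hc2⟩, Metric.mem_ball_self hδ⟩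
    filter_upwards [hW.isClosed.isOpen_compl.mem_nhds hs₀W] with s hs c hc hsI h0
    by_contra hcon
    apply hs
    refine ⟨(s, c), ⟨⟨hsI, hc, h0⟩, ?_⟩, rfl⟩
    simp only [mem_preimage, mem_compl_iff, mem_iUnion, not_exists]
    exact fun c₀ hc₀ hb => hcon ⟨c₀, hc₀, hb⟩
  have e5 : ∀ᶠ s in nhds s₀, |s - s₀| < δ ∧ A * |s - s₀| < ε := by
    apply Filter.Eventually.and
    · have : Tendsto (fun s : ℝ => |s - s₀|) (nhds s₀) (nhds 0) := by
        have : ContinuousAt (fun s : ℝ => |s - s₀|) s₀ := by fun_prop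
        simpa [ContinuousAt] using this
      exact this.eventually_lt_const hδ
    · have : Tendsto (fun s : ℝ => A * |s - s₀|) (nhds s₀) (nhds 0) := by
        have : ContinuousAt (fun s : ℝ => A * |s - s₀|) s₀ := by fun_prop
        simpa [ContinuousAt] using this
      exact this.eventually_lt_const hε
  refine tendsto_const_nhds.congr' ?_
  filter_upwards [nhdsWithin_le_nhds e4, nhdsWithin_le_nhds e5, self_mem_nhdsWithin]
    with s h4 h5 hs
  have hss : |s₀ - s| = |s - s₀| := abs_sub_comm _ _
  refine (finsum_zeros_eq_sum_balls (hq s₀ hs₀) hF hF hself h2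
      (fun c hc h0 => ⟨c, ⟨hc, h0⟩, Metric.mem_ball_self hδ⟩)).trans (Eq.trans ?_
    (finsum_zeros_eq_sum_balls (hq s hs) (hfin s hs).1 hF (fun c hc => h1 c hc s hs h5.1) h2
      (fun c hc h0 => h4 c hc hs h0)).symm)
  apply finsum_mem_congr rfl
  intro c hc
  apply finsum_analyticOrderNatAt_eq_of_norm_sub_lt hδ
    (fun z hz => hq s₀ hs₀ z (hself c hc hz)) (fun z hz => hq s hs z (h1 c hc s hs h5.1 hz))
  intro z hz
  calc ‖q s₀ z - q s z‖ ≤ A * |s₀ - s| := hlip s₀ hs₀ s hs z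
    _ < ε := by rw [hss]; exact h5.2
    _ < _ := h3 c hc z hz

lemma le_of_deriv_right_ge_neg_mul {v v' : ℝ → ℝ} {a b C δ : ℝ} (hδ : 0 < δ)
    (hv : ContinuousOn v (Icc a b))
    (hv' : ∀ t ∈ Ico a b, HasDerivWithinAt v (v' t) (Ici t) t)
    (ha : δ ≤ v a) (hC : 0 ≤ C)
    (h : ∀ t ∈ Ico a b, 0 < v t → v t ≤ δ → -C * v t ≤ v' t) :
    ∀ t ∈ Icc a b, δ * exp (-(C + 1) * (t - a)) ≤ v t := by
  intro t ht
  have hB : ∀ x, HasDerivAt (fun x => -(δ * exp (-(C + 1) * (x - a))))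
      ((C + 1) * (δ * exp (-(C + 1) * (x - a)))) x := by
    intro x
    have := ((((hasDerivAt_id' x).sub_const a).const_mul (-(C + 1))).exp.const_mul δ).neg
    exact this.congr_deriv (by ring)
  have := image_le_of_deriv_right_lt_deriv_boundary' (f := fun t => - v t) (f' := fun t => - v' t)
    (a := a) (b := b) (B := fun x => -(δ * exp (-(C + 1) * (x - a))))
    (B' := fun x => (C + 1) * (δ * exp (-(C + 1) * (x - a)))) hv.neg
    (fun t ht => (hv' t ht).neg) (by simpa using ha)
    (fun x _ => (hB x).continuousAt.continuousWithinAt)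
    (fun x _ => (hB x).hasDerivWithinAt) ?_ ht
  · simpa using this
  · intro x hx hxe
    have hvx : v x = δ * exp (-(C + 1) * (x - a)) := by simpa using hxe
    have hpos : 0 < v x := by rw [hvx]; positivity
    have hle : v x ≤ δ := by
      rw [hvx]
      refine mul_le_of_le_one_right hδ.le (exp_le_one_iff.2 ?_)
      nlinarith [hx.1]
    have := h x hx hpos hle
    rw [← hvx]
    linarith

lemma le_of_deriv_right_le_mul {v v' : ℝ → ℝ} {a b C ε : ℝ} (hε : 0 < ε)
    (hv : ContinuousOn v (Icc a b))
    (hv' : ∀ t ∈ Ico a b, HasDerivWithinAt v (v' t) (Ici t) t)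
    (ha : v a ≤ ε) (hC : 0 ≤ C)
    (h : ∀ t ∈ Ico a b, 0 < v t → v t ≤ ε * exp ((C + 1) * (b - a)) → v' t ≤ C * v t) :
    ∀ t ∈ Icc a b, v t ≤ ε * exp ((C + 1) * (t - a)) := by
  intro t ht
  have hB : ∀ x, HasDerivAt (fun x => ε * exp ((C + 1) * (x - a)))
      ((C + 1) * (ε * exp ((C + 1) * (x - a)))) x := by
    intro x
    have := ((((hasDerivAt_id' x).sub_const a).const_mul (C + 1)).exp.const_mul ε)
    exact this.congr_deriv (by ring)
  refine image_le_of_deriv_right_lt_deriv_boundary' (f := v) (f' := v')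
    (a := a) (b := b) (B := fun x => ε * exp ((C + 1) * (x - a)))
    (B' := fun x => (C + 1) * (ε * exp ((C + 1) * (x - a)))) hv
    hv' (by simpa using ha)
    (fun x _ => (hB x).continuousAt.continuousWithinAt)
    (fun x _ => (hB x).hasDerivWithinAt) ?_ ht
  intro x hx hxe
  have hpos : 0 < v x := by rw [hxe]; positivity
  have hle : v x ≤ ε * exp ((C + 1) * (b - a)) := by
    rw [hxe]
    have : x ≤ b := hx.2.le
    gcongr
  have := h x hx hpos hle
  rw [← hxe]
  linarith

/-- A periodic function which cannot decay to zero and is positive once is always positive. -/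
lemma pos_of_deriv_right_ge_neg_mul {v v' : ℝ → ℝ} {ω C : ℝ}
    (hv : ContinuousOn v (Icc 0 ω))
    (hv' : ∀ t ∈ Ico 0 ω, HasDerivWithinAt v (v' t) (Ici t) t)
    (hper : v 0 = v ω) (hC : 0 ≤ C)
    (h : ∀ t ∈ Ico 0 ω, 0 < v t → -C * v t ≤ v' t) {a : ℝ} (ha : a ∈ Icc 0 ω) (hva : 0 < v a) :
    ∀ t ∈ Icc 0 ω, 0 < v t := by
  have key : ∀ a ∈ Icc 0 ω, 0 < v a → ∀ t ∈ Icc a ω, 0 < v t := by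
    intro a ha hva t ht
    have := le_of_deriv_right_ge_neg_mul hva (hv.mono (Icc_subset_Icc_left ha.1))
      (fun t ht => hv' t ⟨ha.1.trans ht.1, ht.2⟩) le_rfl hC
      (fun t ht h0 _ => h t ⟨ha.1.trans ht.1, ht.2⟩ h0) t ht
    exact lt_of_lt_of_le (by positivity) this
  have hω : 0 < v ω := key a ha hva ω ⟨ha.2, le_rfl⟩
  exact key 0 ⟨le_rfl, ha.1.trans ha.2⟩ (hper ▸ hω)

/-- A periodic function with at most exponential growth which is nonpositive once is always
nonpositive. -/
lemma nonpos_of_deriv_right_le_mul {v v' : ℝ → ℝ} {ω C : ℝ}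
    (hv : ContinuousOn v (Icc 0 ω))
    (hv' : ∀ t ∈ Ico 0 ω, HasDerivWithinAt v (v' t) (Ici t) t)
    (hper : v 0 = v ω) (hC : 0 ≤ C)
    (h : ∀ t ∈ Ico 0 ω, 0 < v t → v' t ≤ C * v t) {a : ℝ} (ha : a ∈ Icc 0 ω) (hva : v a ≤ 0) :
    ∀ t ∈ Icc 0 ω, v t ≤ 0 := by
  have key : ∀ a ∈ Icc 0 ω, v a ≤ 0 → ∀ t ∈ Icc a ω, v t ≤ 0 := by
    intro a ha hva t ht
    by_contra! hpos
    set E := exp ((C + 1) * (t - a))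
    have hE : 0 < E := exp_pos _
    have := le_of_deriv_right_le_mul (ε := v t / (2 * E)) (by positivity)
      (hv.mono (Icc_subset_Icc_left ha.1))
      (fun t ht => hv' t ⟨ha.1.trans ht.1, ht.2⟩) (hva.trans (by positivity)) hC
      (fun t ht h0 _ => h t ⟨ha.1.trans ht.1, ht.2⟩ h0) t ht
    have h2 : v t / (2 * E) * E = v t / 2 := by field_simp
    linarith
  have hω : v ω ≤ 0 := key a ha hva ω ⟨ha.2, le_rfl⟩
  exact key 0 ⟨le_rfl, ha.1.trans ha.2⟩ (hper ▸ hω)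

/-- A periodic function with positive derivative at each of its zeros has a constant sign. -/
lemma constant_sign_of_deriv_pos {g g' : ℝ → ℝ} {ω : ℝ} (hω : 0 < ω)
    (hg : ∀ t ∈ Icc 0 ω, HasDerivWithinAt g (g' t) (Icc 0 ω) t)
    (hper : g 0 = g ω) (h : ∀ t ∈ Icc 0 ω, g t = 0 → 0 < g' t) :
    (∀ t ∈ Icc 0 ω, 0 < g t) ∨ (∀ t ∈ Icc 0 ω, g t < 0) := by
  have hc : ContinuousOn g (Icc 0 ω) := fun t ht => (hg t ht).continuousWithinAt
  have hne : ∀ t ∈ Icc 0 ω, g t ≠ 0 := by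
    have hr : ∀ t ∈ Ico 0 ω, HasDerivWithinAt g (g' t) (Ici t) t := fun t ht =>
      ((hg t ⟨ht.1, ht.2.le⟩).mono (Icc_subset_Icc_left ht.1)).mono_of_mem_nhdsWithin
        (Icc_mem_nhdsGE ht.2)
    have key : ∀ a ∈ Icc 0 ω, 0 ≤ g a → ∀ t ∈ Icc a ω, 0 ≤ g t := by
      intro a ha hva t ht
      have := image_le_of_deriv_right_lt_deriv_boundary' (f := fun t => - g t)
        (f' := fun t => - g' t) (a := a) (b := ω) (B := fun _ => 0) (B' := fun _ => 0)
        (hc.mono (Icc_subset_Icc_left ha.1)).neg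
        (fun t ht => (hr t ⟨ha.1.trans ht.1, ht.2⟩).neg) (by simpa using hva)
        continuousOn_const (fun x _ => hasDerivWithinAt_const _ _ _)
        (fun x hx hx0 => by
          have := h x ⟨ha.1.trans hx.1, hx.2.le⟩ (by simpa using hx0)
          simpa using this) ht
      simpa using this
    have key2 : ∀ a ∈ Icc 0 ω, 0 ≤ g a → ∀ t ∈ Icc 0 ω, 0 ≤ g t := fun a ha hga =>
      key 0 ⟨le_rfl, hω.le⟩ (hper ▸ key a ha hga ω ⟨ha.2, le_rfl⟩)
    have key3 : ∀ t ∈ Ioc 0 ω, g t ≠ 0 := by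
      intro t ht h0
      have hnn := key2 t ⟨ht.1.le, ht.2⟩ h0.ge
      have hp := h t ⟨ht.1.le, ht.2⟩ h0
      have hl : HasDerivWithinAt g (g' t) (Iio t) t :=
        ((hg t ⟨ht.1.le, ht.2⟩).mono (Icc_subset_Icc_right ht.2)).mono_of_mem_nhdsWithin
          (mem_of_superset (Ioo_mem_nhdsLT ht.1) Ioo_subset_Icc_self)
      have hs := hasDerivWithinAt_iff_tendsto_slope.1 hl
      have hset : Iio t \ {t} = Iio t := by simp
      rw [hset] at hs
      obtain ⟨x, hx, hx2⟩ := ((hs.eventually_const_lt hp).and (Ioo_mem_nhdsLT ht.1)).exists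
      rw [slope_def_field, h0] at hx
      have := hnn x ⟨hx2.1.le, hx2.2.le.trans ht.2⟩
      have h3 : (g x - 0) / (x - t) ≤ 0 :=
        div_nonpos_of_nonneg_of_nonpos (by linarith) (by linarith [hx2.2])
      linarith
    intro t ht
    rcases ht.1.eq_or_lt with h0 | h0
    · rw [← h0, hper]; exact key3 ω ⟨hω, le_rfl⟩
    · exact key3 t ⟨h0, ht.2⟩
  by_contra! hcon
  obtain ⟨⟨t₁, ht₁, h1⟩, ⟨t₂, ht₂, h2⟩⟩ := hcon
  obtain ⟨t, ht, h0⟩ := isPreconnected_Icc.intermediate_value ht₁ ht₂ hc ⟨h1, h2⟩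
  exact hne t ht h0

/-- The polynomial `z^n + ∑ i < n, p i * z^i`. -/
def polyField (n : ℕ) (p : ℕ → ℝ) (z : ℂ) : ℂ :=
  z ^ n + ∑ i ∈ Finset.range n, (p i : ℂ) * z ^ i

/-- The conditions on the coefficients at a fixed time, with `r ^ n = K`; the sign of the linear
coefficient is `e`. -/
structure Admissible (n : ℕ) (r B e : ℝ) (p : ℕ → ℝ) : Prop where
  bound : ∀ i < n, |p i| ≤ B
  zero_lt : |p 0| < r ^ n
  nonpos : p (n - 2) ≤ 0
  middle : ∑ i ∈ Finset.Ico 2 (n - 2), |p i| * r ^ i ≤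
    (r ^ n - p (n - 2) * r ^ (n - 2) - |p 0|) * sin (π / ((n : ℝ) - 2))
  linear : r ^ n + ∑ i ∈ (Finset.range n).erase 1, |p i| * r ^ i ≤ e * p 1 * r

/-- A Lipschitz constant on `[0, M]` for `x ^ n + ∑ i < n, B * x ^ i`. -/
def lipConst (n : ℕ) (B M : ℝ) : ℝ :=
  n * M ^ (n - 1) + ∑ i ∈ Finset.range n, B * (i * M ^ (i - 1))

lemma lipConst_nonneg {n : ℕ} {B M : ℝ} (hB : 0 ≤ B) (hM : 0 ≤ M) : 0 ≤ lipConst n B M := by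
  unfold lipConst
  have : ∀ i ∈ Finset.range n, 0 ≤ B * (i * M ^ (i - 1)) := fun i _ => by positivity
  have := Finset.sum_nonneg this
  positivity

lemma abs_im_pow_le (z : ℂ) (i : ℕ) : |(z ^ i).im| ≤ i * ‖z‖ ^ (i - 1) * |z.im| := by
  induction i with
  | zero => simp
  | succ i ih =>
    rw [pow_succ, Complex.mul_im]
    have h1 : |(z ^ i).re| ≤ ‖z‖ ^ i := (Complex.abs_re_le_norm _).trans (norm_pow z i).le
    have h2 : |z.re| ≤ ‖z‖ := Complex.abs_re_le_norm z
    calc |(z ^ i).re * z.im + (z ^ i).im * z.re|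
        ≤ |(z ^ i).re| * |z.im| + |(z ^ i).im| * |z.re| := by
          rw [← abs_mul, ← abs_mul]; exact abs_add_le _ _
      _ ≤ ‖z‖ ^ i * |z.im| + (i * ‖z‖ ^ (i - 1) * |z.im|) * ‖z‖ := by gcongr
      _ = ((i : ℕ) + 1 : ℝ) * ‖z‖ ^ i * |z.im| := by
          rcases i with _ | i
          · simp
          · simp only [Nat.add_sub_cancel, pow_succ]; ring
      _ = _ := by push_cast; simp

lemma abs_im_polyField_le {n : ℕ} {B M : ℝ} {p : ℕ → ℝ} (hp : ∀ i < n, |p i| ≤ B) {z : ℂ}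
    (hz : ‖z‖ ≤ M) : |(polyField n p z).im| ≤ lipConst n B M * |z.im| := by
  unfold polyField lipConst
  rw [Complex.add_im, Complex.im_sum, add_mul, Finset.sum_mul]
  refine (abs_add_le _ _).trans (add_le_add ?_ ((Finset.abs_sum_le_sum_abs _ _).trans
    (Finset.sum_le_sum fun i hi => ?_)))
  · exact (abs_im_pow_le z n).trans (by gcongr)
  · rw [Complex.im_ofReal_mul, abs_mul, mul_assoc]
    have := hp i (Finset.mem_range.1 hi)
    have hB : 0 ≤ B := (abs_nonneg _).trans this
    refine mul_le_mul this ((abs_im_pow_le z i).trans (by gcongr)) (abs_nonneg _) hB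

lemma pow_sub_pow_le_mul {ρ r M : ℝ} (hr : 0 ≤ r) (h1 : r ≤ ρ) (h2 : ρ ≤ M) (i : ℕ) :
    ρ ^ i - r ^ i ≤ i * M ^ (i - 1) * (ρ - r) := by
  have := abs_pow_sub_pow_le ρ r i
  rw [abs_of_nonneg (sub_nonneg.2 (pow_le_pow_left₀ hr h1 i)), abs_of_nonneg (sub_nonneg.2 h1),
    abs_of_nonneg (hr.trans h1), abs_of_nonneg hr, max_eq_left h1] at this
  have h3 : ρ ^ (i - 1) ≤ M ^ (i - 1) := pow_le_pow_left₀ (hr.trans h1) h2 _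
  calc _ ≤ _ := this
    _ = (i * ρ ^ (i - 1)) * (ρ - r) := by ring
    _ ≤ _ := by
      have := sub_nonneg.2 h1
      gcongr

lemma Admissible.radial {n : ℕ} (hn : 5 ≤ n) {r B e M : ℝ} (hr : 0 < r) (he : |e| = 1) {p : ℕ → ℝ}
    (hp : Admissible n r B e p) {z : ℂ} (h1 : r < ‖z‖) (h2 : ‖z‖ ≤ M) :
    -lipConst n B M * (‖z‖ ^ 2 - r ^ 2) ≤ e * (starRingEnd ℂ z * polyField n p z).re := by
  set ρ := ‖z‖ with hρ
  have hB : 0 ≤ B := (abs_nonneg _).trans (hp.bound 0 (by omega))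
  have hM : 0 ≤ M := (hr.le.trans h1.le).trans h2
  have hρ0 : 0 < ρ := hr.trans h1
  have key : ∀ (a : ℝ) (i : ℕ), -(|a| * (ρ * ρ ^ i)) ≤ e * (a * (starRingEnd ℂ z * z ^ i).re) := by
    intro a i
    have h : |(starRingEnd ℂ z * z ^ i).re| ≤ ρ * ρ ^ i := by
      refine (Complex.abs_re_le_norm _).trans (le_of_eq ?_)
      rw [norm_mul, RCLike.norm_conj, norm_pow]
    refine neg_le_of_neg_le ?_
    have := neg_le_abs (e * (a * (starRingEnd ℂ z * z ^ i).re))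
    rw [abs_mul, he, one_mul, abs_mul] at this
    exact this.trans (by gcongr)
  have hexp : e * (starRingEnd ℂ z * polyField n p z).re =
      e * (1 * (starRingEnd ℂ z * z ^ n).re) + e * p 1 * ρ * ρ +
      ∑ i ∈ (Finset.range n).erase 1, e * (p i * (starRingEnd ℂ z * z ^ i).re) := by
    have h1n : 1 ∈ Finset.range n := Finset.mem_range.2 (by omega)
    unfold polyField
    rw [← Finset.add_sum_erase _ _ h1n, mul_add, mul_add, Complex.add_re, Complex.add_re,
      Finset.mul_sum, Complex.re_sum, mul_add, mul_add, Finset.mul_sum, one_mul, ← add_assoc]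
    refine congrArg₂ (· + ·) (congrArg₂ (· + ·) rfl ?_) (Finset.sum_congr rfl fun i _ => ?_)
    · have : starRingEnd ℂ z * ((p 1 : ℂ) * z ^ 1) = ((p 1 * (ρ * ρ) : ℝ) : ℂ) := by
        rw [mul_left_comm, pow_one, mul_comm (starRingEnd ℂ z), Complex.mul_conj,
          Complex.normSq_eq_norm_sq, ← hρ]
        push_cast; ring
      rw [this, Complex.ofReal_re]; ring
    · rw [mul_left_comm, Complex.re_ofReal_mul]
  have hlin : e * p 1 * r ≤ e * p 1 * ρ := by
    have h0 : 0 ≤ e * p 1 * r := by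
      refine le_trans ?_ hp.linear
      have : 0 ≤ ∑ i ∈ (Finset.range n).erase 1, |p i| * r ^ i :=
        Finset.sum_nonneg fun i _ => by positivity
      positivity
    have : 0 ≤ e * p 1 := nonneg_of_mul_nonneg_left h0 hr
    gcongr
  have hsum1 : -∑ i ∈ (Finset.range n).erase 1, |p i| * (ρ * ρ ^ i) ≤
      ∑ i ∈ (Finset.range n).erase 1, e * (p i * (starRingEnd ℂ z * z ^ i).re) := by
    rw [← Finset.sum_neg_distrib]
    exact Finset.sum_le_sum fun i _ => key (p i) i
  have hsum2 : ∑ i ∈ (Finset.range n).erase 1, |p i| * ρ ^ i ≤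
      ∑ i ∈ (Finset.range n).erase 1, |p i| * r ^ i +
        (∑ i ∈ Finset.range n, B * (i * M ^ (i - 1))) * (ρ - r) := by
    rw [Finset.sum_mul]
    refine le_trans ?_ (add_le_add_right (Finset.sum_le_sum_of_subset_of_nonneg
      (Finset.erase_subset 1 _) ?_) _)
    · rw [← Finset.sum_add_distrib]
      refine Finset.sum_le_sum fun i hi => ?_
      have hb := hp.bound i (Finset.mem_range.1 (Finset.mem_of_mem_erase hi))
      have hpw := pow_sub_pow_le_mul hr.le h1.le h2 i
      have hnn : 0 ≤ ρ ^ i - r ^ i := sub_nonneg.2 (pow_le_pow_left₀ hr.le h1.le i)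
      have := mul_le_mul hb hpw hnn hB
      linarith
    · intro i _ _
      have := sub_nonneg.2 h1.le
      positivity
  have hn' := pow_sub_pow_le_mul hr.le h1.le h2 n
  have hk := key 1 n
  rw [abs_one, one_mul] at hk
  have hS : ∑ i ∈ (Finset.range n).erase 1, |p i| * (ρ * ρ ^ i) =
      ρ * ∑ i ∈ (Finset.range n).erase 1, |p i| * ρ ^ i := by
    rw [Finset.mul_sum]; exact Finset.sum_congr rfl fun i _ => by ring
  rw [hS] at hsum1
  have hL := hp.linear
  have hinner : -(lipConst n B M * (ρ - r)) ≤
      e * p 1 * ρ - ρ ^ n - ∑ i ∈ (Finset.range n).erase 1, |p i| * ρ ^ i := by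
    unfold lipConst; rw [add_mul]; linarith
  have hfin : ρ * -(lipConst n B M * (ρ - r)) ≥ -lipConst n B M * (ρ ^ 2 - r ^ 2) := by
    have h3 : 0 ≤ lipConst n B M * (ρ - r) * r :=
      mul_nonneg (mul_nonneg (lipConst_nonneg hB hM) (sub_nonneg.2 h1.le)) hr.le
    nlinarith
  have := mul_le_mul_of_nonneg_left hinner hρ0.le
  rw [hexp]
  linarith

lemma im_pow_eq (z : ℂ) (k : ℕ) : (z ^ k).im = ‖z‖ ^ k * sin (k * z.arg) := by
  conv_lhs => rw [← Complex.norm_mul_exp_arg_mul_I z]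
  rw [mul_pow, ← Complex.exp_nat_mul, ← Complex.ofReal_pow, Complex.im_ofReal_mul,
    show (k : ℂ) * (z.arg * Complex.I) = ((k * z.arg : ℝ) : ℂ) * Complex.I by push_cast; ring,
    Complex.exp_ofReal_mul_I_im]

lemma re_pow_eq (z : ℂ) (k : ℕ) : (z ^ k).re = ‖z‖ ^ k * cos (k * z.arg) := by
  conv_lhs => rw [← Complex.norm_mul_exp_arg_mul_I z]
  rw [mul_pow, ← Complex.exp_nat_mul, ← Complex.ofReal_pow, Complex.re_ofReal_mul,
    show (k : ℂ) * (z.arg * Complex.I) = ((k * z.arg : ℝ) : ℂ) * Complex.I by push_cast; ring,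
    Complex.exp_ofReal_mul_I_re]

lemma arg_mem_Ioo_of_im_pos {z : ℂ} (hz : 0 < z.im) : z.arg ∈ Ioo 0 π := by
  refine ⟨lt_of_le_of_ne (Complex.arg_nonneg_iff.2 hz.le) fun h => ?_,
    Complex.arg_lt_pi_iff.2 (Or.inr hz.ne')⟩
  have := (Complex.arg_eq_zero_iff.1 h.symm).2
  exact hz.ne' this

lemma sin_pi_div_le_sin {k : ℕ} (hk : 2 ≤ k) {θ : ℝ} (hθ : θ ∈ Ioo 0 π)
    (h : sin (k * θ) = 0) : sin (π / k) ≤ sin θ := by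
  have hk0 : (0 : ℝ) < k := by positivity
  have hpk : π / k ≤ π / 2 := by
    have : (2 : ℝ) ≤ k := by exact_mod_cast hk
    have := pi_pos
    gcongr
  have aux : ∀ φ ∈ Ioo 0 π, sin (k * φ) = 0 → π / k ≤ φ := by
    intro φ hφ h0
    by_contra! hlt
    have h1 : 0 < k * φ := mul_pos hk0 hφ.1
    have h2 : k * φ < π := by rw [lt_div_iff₀ hk0] at hlt; linarith
    exact (sin_pos_of_pos_of_lt_pi h1 h2).ne' h0
  have h1 := aux θ hθ h
  have h2 : π / k ≤ π - θ := by
    refine aux (π - θ) ⟨by linarith [hθ.2], by linarith [hθ.1]⟩ ?_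
    rw [mul_sub, sin_nat_mul_pi_sub, h]; simp
  rcases le_total θ (π / 2) with h3 | h3
  · exact sin_le_sin_of_le_of_le_pi_div_two (by linarith [pi_pos, div_pos pi_pos hk0]) h3 h1
  · rw [← sin_pi_sub θ]
    exact sin_le_sin_of_le_of_le_pi_div_two (by linarith [pi_pos, div_pos pi_pos hk0])
      (by linarith) h2

lemma Admissible.im_pos {n : ℕ} (hn : 5 ≤ n) {r B e : ℝ} (hr : 0 < r) {p : ℕ → ℝ}
    (hp : Admissible n r B e p) {z : ℂ} (hy : 0 < z.im) (h1 : r < ‖z‖)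
    (h0 : (z ^ (n - 2)).im = 0) : 0 < (z ^ (n - 3) * polyField n p z).im := by
  obtain ⟨m, rfl⟩ : ∃ m, n = m + 5 := ⟨n - 5, by omega⟩
  rw [show m + 5 - 2 = m + 3 by omega] at *
  rw [show m + 5 - 3 = m + 2 by omega]
  set ρ := ‖z‖ with hρ
  have hρ0 : 0 < ρ := hr.trans h1
  have hz0 : z ≠ 0 := norm_pos_iff.1 hρ0
  obtain ⟨E, hE⟩ : ∃ E : ℝ, z ^ (m + 3) = E := ⟨(z ^ (m + 3)).re, by
    apply Complex.ext <;> simp [h0]⟩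
  have hEabs : |E| = ρ ^ (m + 3) := by
    rw [hρ, ← norm_pow, hE, Complex.norm_real, Real.norm_eq_abs]
  have hE2 : E * E = ρ ^ (m + 3) * ρ ^ (m + 3) := by rw [← abs_mul_abs_self E, hEabs]
  set S := sin (π / (((m + 5 : ℕ) : ℝ) - 2)) with hS
  have hSeq : S = sin (π / ((m + 3 : ℕ) : ℝ)) := by
    rw [hS]; congr 2; push_cast; ring
  have hS0 : 0 < S := by
    rw [hSeq]
    refine sin_pos_of_pos_of_lt_pi (by positivity) ?_
    rw [div_lt_iff₀ (by positivity)]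
    have := pi_pos
    push_cast
    nlinarith [(Nat.cast_nonneg m : (0 : ℝ) ≤ m)]
  have hyS : ρ * S ≤ z.im := by
    have hθ := arg_mem_Ioo_of_im_pos hy
    have hs : sin (((m + 3 : ℕ) : ℝ) * z.arg) = 0 := by
      have := im_pow_eq z (m + 3)
      rw [h0] at this
      have h2 : ρ ^ (m + 3) ≠ 0 := by positivity
      exact (mul_eq_zero.1 this.symm).resolve_left h2
    have h3 := sin_pi_div_le_sin (by omega) hθ hs
    rw [← hSeq] at h3
    have h4 := im_pow_eq z 1
    simp only [pow_one, Nat.cast_one, one_mul] at h4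
    rw [h4]
    gcongr
  -- the individual terms
  have hinv : (z⁻¹).im = -z.im / ρ ^ 2 := by
    rw [Complex.inv_im, Complex.normSq_eq_norm_sq]
  have tn : (z ^ (m + 2) * z ^ (m + 5)).im = E * E * z.im := by
    rw [show z ^ (m + 2) * z ^ (m + 5) = z ^ (m + 3) * z ^ (m + 3) * z by ring, hE,
      ← Complex.ofReal_mul, Complex.im_ofReal_mul]
  have t0 : (z ^ (m + 2) * ((p 0 : ℂ) * z ^ 0)).im = -(p 0 * E * z.im / ρ ^ 2) := by
    rw [show z ^ (m + 2) * ((p 0 : ℂ) * z ^ 0) = p 0 * z ^ (m + 3) * z⁻¹ by field_simp; ring, hE,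
      ← Complex.ofReal_mul, Complex.im_ofReal_mul, hinv]
    ring
  have t1 : (z ^ (m + 2) * ((p 1 : ℂ) * z ^ 1)).im = 0 := by
    rw [show z ^ (m + 2) * ((p 1 : ℂ) * z ^ 1) = p 1 * z ^ (m + 3) by ring, hE,
      ← Complex.ofReal_mul, Complex.ofReal_im]
  have t3 : (z ^ (m + 2) * ((p (m + 3) : ℂ) * z ^ (m + 3))).im =
      -(p (m + 3) * (E * E) * z.im / ρ ^ 2) := by
    rw [show z ^ (m + 2) * ((p (m + 3) : ℂ) * z ^ (m + 3)) =
        p (m + 3) * (z ^ (m + 3) * z ^ (m + 3)) * z⁻¹ by field_simp; ring, hE,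
      ← Complex.ofReal_mul, ← Complex.ofReal_mul, Complex.im_ofReal_mul, hinv]
    ring
  have t4 : (z ^ (m + 2) * ((p (m + 4) : ℂ) * z ^ (m + 4))).im = 0 := by
    rw [show z ^ (m + 2) * ((p (m + 4) : ℂ) * z ^ (m + 4)) =
        p (m + 4) * (z ^ (m + 3) * z ^ (m + 3)) by ring, hE,
      ← Complex.ofReal_mul, ← Complex.ofReal_mul, Complex.ofReal_im]
  have tmid : ∀ i ∈ Finset.Ico 2 (m + 3), -(|p i| * (ρ ^ (m + 3) * ρ ^ (i - 1))) ≤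
      (z ^ (m + 2) * ((p i : ℂ) * z ^ i)).im := by
    intro i hi
    have hi2 := (Finset.mem_Ico.1 hi).1
    obtain ⟨j, rfl⟩ : ∃ j, i = j + 1 := ⟨i - 1, by omega⟩
    rw [show z ^ (m + 2) * ((p (j + 1) : ℂ) * z ^ (j + 1)) =
        p (j + 1) * z ^ (m + 3) * z ^ j by ring, hE, ← Complex.ofReal_mul, Complex.im_ofReal_mul]
    refine neg_le_of_neg_le ?_
    have h2 : |(z ^ j).im| ≤ ρ ^ j := (Complex.abs_im_le_norm _).trans (norm_pow z j).le
    refine (neg_le_abs _).trans ?_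
    rw [abs_mul, abs_mul, hEabs, Nat.add_sub_cancel, mul_assoc]
    gcongr
  have hexp : (z ^ (m + 2) * polyField (m + 5) p z).im = E * E * z.im - p 0 * E * z.im / ρ ^ 2
      - p (m + 3) * (E * E) * z.im / ρ ^ 2
      + ∑ i ∈ Finset.Ico 2 (m + 3), (z ^ (m + 2) * ((p i : ℂ) * z ^ i)).im := by
    unfold polyField
    rw [Finset.sum_range_succ, Finset.sum_range_succ,
      ← Finset.sum_range_add_sum_Ico _ (show 2 ≤ m + 3 by omega)]
    simp only [Finset.sum_range_succ, Finset.sum_range_zero, zero_add, mul_add, Complex.add_im,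
      Finset.mul_sum, Complex.im_sum, tn, t0, t1, t3, t4]
    ring
  have hsum : -(ρ ^ (m + 2) * ∑ i ∈ Finset.Ico 2 (m + 3), |p i| * ρ ^ i) ≤
      ∑ i ∈ Finset.Ico 2 (m + 3), (z ^ (m + 2) * ((p i : ℂ) * z ^ i)).im := by
    rw [Finset.mul_sum, ← Finset.sum_neg_distrib]
    refine Finset.sum_le_sum fun i hi => le_trans (le_of_eq ?_) (tmid i hi)
    have hi2 := (Finset.mem_Ico.1 hi).1
    obtain ⟨j, rfl⟩ : ∃ j, i = j + 1 := ⟨i - 1, by omega⟩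
    rw [Nat.add_sub_cancel]; ring
  -- scaling
  obtain ⟨x, hx1, hx⟩ : ∃ x, 1 < x ∧ ρ = x * r := ⟨ρ / r, by rwa [one_lt_div hr], by field_simp⟩
  have hx0 : 0 < x := zero_lt_one.trans hx1
  have hmid := hp.middle
  have hz' := hp.zero_lt
  have hnp := hp.nonpos
  rw [show m + 5 - 2 = m + 3 by omega] at hmid hnp
  have hsc1 : ∑ i ∈ Finset.Ico 2 (m + 3), |p i| * ρ ^ i ≤
      x ^ (m + 2) * ((r ^ (m + 5) - p (m + 3) * r ^ (m + 3) - |p 0|) * S) := by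
    refine le_trans ?_ (mul_le_mul_of_nonneg_left hmid (by positivity))
    rw [Finset.mul_sum]
    refine Finset.sum_le_sum fun i hi => ?_
    have hi2 := (Finset.mem_Ico.1 hi).2
    have hxi : x ^ i ≤ x ^ (m + 2) := pow_le_pow_right₀ hx1.le (by omega)
    have hri : 0 ≤ |p i| * r ^ i := by positivity
    calc _ = x ^ i * (|p i| * r ^ i) := by rw [hx, mul_pow]; ring
      _ ≤ _ := by gcongr
  have hsc2 : x ^ (m + 2) * (r ^ (m + 5) - p (m + 3) * r ^ (m + 3) - |p 0|) <
      ρ ^ (m + 5) - p (m + 3) * ρ ^ (m + 3) - |p 0| := by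
    have e1 : x ^ (m + 2) * r ^ (m + 5) < x ^ (m + 5) * r ^ (m + 5) := by
      have : x ^ (m + 2) < x ^ (m + 5) := pow_lt_pow_right₀ hx1 (by omega)
      gcongr
    have e2 : x ^ (m + 2) * (-p (m + 3) * r ^ (m + 3)) ≤ x ^ (m + 3) * (-p (m + 3) * r ^ (m + 3)) := by
      have h1 : x ^ (m + 2) ≤ x ^ (m + 3) := pow_le_pow_right₀ hx1.le (by omega)
      have h2 : 0 ≤ -p (m + 3) := neg_nonneg.2 hnp
      gcongr
    have e3 : |p 0| ≤ x ^ (m + 2) * |p 0| :=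
      le_mul_of_one_le_left (abs_nonneg _) (one_le_pow₀ hx1.le)
    rw [hx, mul_pow, mul_pow]
    linarith
  set D := ρ ^ (m + 5) - p (m + 3) * ρ ^ (m + 3) - |p 0| with hD
  have hD0 : 0 < D := by
    refine lt_trans ?_ hsc2
    have : 0 ≤ -p (m + 3) * r ^ (m + 3) := mul_nonneg (neg_nonneg.2 hnp) (by positivity)
    have : 0 < r ^ (m + 5) - p (m + 3) * r ^ (m + 3) - |p 0| := by linarith
    positivity
  have hfirst : ρ ^ (m + 1) * D * z.im ≤ E * E * z.im - p 0 * E * z.im / ρ ^ 2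
      - p (m + 3) * (E * E) * z.im / ρ ^ 2 := by
    have hpE : p 0 * E ≤ |p 0| * ρ ^ (m + 3) := by
      rw [← hEabs, ← abs_mul]; exact le_abs_self _
    have : p 0 * E * z.im / ρ ^ 2 ≤ |p 0| * ρ ^ (m + 3) * z.im / ρ ^ 2 := by gcongr
    refine le_trans (le_of_eq ?_) (sub_le_sub_right (sub_le_sub_left this _) _)
    rw [hE2, hD]
    field_simp
    ring
  rw [hexp]
  have hlow : ρ ^ (m + 1) * D * (ρ * S) ≤ ρ ^ (m + 1) * D * z.im := by gcongr
  have hstrict : ρ ^ (m + 2) * ∑ i ∈ Finset.Ico 2 (m + 3), |p i| * ρ ^ i < ρ ^ (m + 2) * (D * S) := by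
    have : ∑ i ∈ Finset.Ico 2 (m + 3), |p i| * ρ ^ i < D * S := by
      refine hsc1.trans_lt ?_
      rw [← mul_assoc]
      gcongr
    gcongr
  have : ρ ^ (m + 1) * D * (ρ * S) = ρ ^ (m + 2) * (D * S) := by ring
  linarith

lemma sin_cos_near_zero {n : ℕ} (hn : 5 ≤ n) {φ : ℝ} (h0 : 0 < φ) (h1 : φ < π / (2 * n)) :
    0 < sin ((n - 2 : ℕ) * φ) ∧ 0 < cos ((n - 1 : ℕ) * φ) ∧
      1 / 2 * sin φ ≤ cos φ * sin ((n - 1 : ℕ) * φ) := by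
  have hn0 : (5 : ℝ) ≤ n := by exact_mod_cast hn
  have hpi := pi_pos
  rw [lt_div_iff₀ (by positivity)] at h1
  rw [Nat.cast_sub (by omega), Nat.cast_sub (by omega)]
  push_cast
  have h2 : (n - 1 : ℝ) * φ < π / 2 := by nlinarith
  have h3 : φ ≤ (n - 1 : ℝ) * φ := by nlinarith
  have h4 : φ ≤ π / 3 := by nlinarith
  refine ⟨sin_pos_of_pos_of_lt_pi (by nlinarith) (by nlinarith),
    cos_pos_of_mem_Ioo ⟨by linarith, h2⟩, ?_⟩
  have h5 : 1 / 2 ≤ cos φ := by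
    rw [← cos_pi_div_three]
    exact cos_le_cos_of_nonneg_of_le_pi h0.le (by linarith) h4
  have h6 : sin φ ≤ sin ((n - 1 : ℝ) * φ) :=
    sin_le_sin_of_le_of_le_pi_div_two (by linarith) h2.le h3
  have h7 : 0 ≤ sin φ := (sin_pos_of_pos_of_lt_pi h0 (by linarith)).le
  gcongr

lemma sin_cos_near_axis {n : ℕ} (hn : 5 ≤ n) {θ e : ℝ} (hθ : θ ∈ Ioo 0 π) (he : e = 1 ∨ e = -1)
    (hG : 0 < e * sin ((n - 2 : ℕ) * θ)) (hs : sin θ < sin (π / (2 * n))) :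
    0 < e * cos ((n - 1 : ℕ) * θ) ∧ 1 / 2 * sin θ ≤ e * (cos θ * sin ((n - 1 : ℕ) * θ)) := by
  have hn0 : (5 : ℝ) ≤ n := by exact_mod_cast hn
  have hpi := pi_pos
  have hle : π / (2 * n) ≤ π / 2 := by gcongr; linarith
  rcases le_total θ (π / 2) with h | h
  · have hθ' : θ < π / (2 * n) := by
      by_contra! hc
      exact absurd (sin_le_sin_of_le_of_le_pi_div_two
        (by linarith [div_pos hpi (show (0 : ℝ) < 2 * n by positivity)]) h hc) (not_le.2 hs)
    obtain ⟨h1, h2, h3⟩ := sin_cos_near_zero hn hθ.1 hθ'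
    have : e = 1 := by
      rcases he with rfl | rfl
      · rfl
      · linarith
    subst this
    simpa using ⟨h2, by simpa using h3⟩
  · obtain ⟨φ, rfl⟩ : ∃ φ, θ = π - φ := ⟨π - θ, by ring⟩
    rw [sin_pi_sub] at hs
    have hθ' : φ < π / (2 * n) := by
      by_contra! hc
      exact absurd (sin_le_sin_of_le_of_le_pi_div_two
        (by linarith [div_pos hpi (show (0 : ℝ) < 2 * n by positivity)]) (by linarith) hc)
        (not_le.2 hs)
    obtain ⟨h1, h2, h3⟩ := sin_cos_near_zero hn (φ := φ) (by linarith [hθ.2]) hθ'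
    rw [mul_sub, sin_nat_mul_pi_sub] at hG
    rw [mul_sub, sin_nat_mul_pi_sub, cos_nat_mul_pi_sub, sin_pi_sub, cos_pi_sub]
    have hpow : (-1 : ℝ) ^ (n - 1) = -(-1) ^ (n - 2) := by
      rw [show n - 1 = n - 2 + 1 by omega, pow_succ]; ring
    have hes : e * (-1) ^ (n - 1) = 1 := by
      rcases neg_one_pow_eq_or ℝ (n - 2) with h' | h' <;> rw [h'] at hG <;> rw [hpow, h'] <;>
        rcases he with rfl | rfl <;> first | (exfalso; linarith) | norm_num
    constructor
    · rwa [← mul_assoc, hes, one_mul]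
    · have : e * (-cos φ * -((-1) ^ (n - 1) * sin ((n - 1 : ℕ) * φ))) =
          (e * (-1) ^ (n - 1)) * (cos φ * sin ((n - 1 : ℕ) * φ)) := by ring
      rw [this, hes, one_mul]
      exact h3

lemma exists_poly_bound (m : ℕ) {A : ℝ} (hA : 0 ≤ A) :
    ∃ C ≥ 0, ∀ ρ : ℝ, 0 ≤ ρ → A * (1 + ρ ^ m) ≤ 1 / 2 * ρ ^ (m + 1) + C := by
  refine ⟨A + A * (2 * A) ^ m, by positivity, fun ρ hρ => ?_⟩
  rcases le_total (2 * A) ρ with h | h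
  · have h1 : (2 * A) * ρ ^ m ≤ ρ * ρ ^ m := by gcongr
    have h2 : 0 ≤ A * (2 * A) ^ m := by positivity
    rw [pow_succ]
    linarith
  · have h1 : A * ρ ^ m ≤ A * (2 * A) ^ m := by gcongr
    have : 0 ≤ ρ ^ (m + 1) := by positivity
    linarith

lemma exists_angular_bound {n : ℕ} (hn : 5 ≤ n) {r B : ℝ} (hr : 0 < r) (hB : 0 ≤ B) :
    ∃ C ≥ 0, ∀ (e : ℝ) (p : ℕ → ℝ) (z : ℂ), |e| = 1 → (∀ i < n, |p i| ≤ B) → r < ‖z‖ → 0 < z.im →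
      1 / 2 * z.im * ‖z‖ ^ (n - 1) ≤ e * (z.re * (z ^ (n - 1)).im) →
      -C * z.im ≤ e * (z.re * (polyField n p z / z).im) := by
  obtain ⟨m, rfl⟩ : ∃ m, n = m + 2 := ⟨n - 2, by omega⟩
  rw [show m + 2 - 1 = m + 1 by omega]
  obtain ⟨C, hC, hCb⟩ := exists_poly_bound m (A := ∑ j ∈ Finset.range (m + 1), B * j)
    (Finset.sum_nonneg fun j _ => by positivity)
  refine ⟨C + B / r, by positivity, fun e p z he hp h1 hy hdom => ?_⟩
  set ρ := ‖z‖ with hρ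
  have hρ0 : 0 < ρ := hr.trans h1
  have hz0 : z ≠ 0 := norm_pos_iff.1 hρ0
  have hx : |z.re| ≤ ρ := Complex.abs_re_le_norm z
  have hquot : (polyField (m + 2) p z / z).im = (z ^ (m + 1)).im +
      ∑ j ∈ Finset.range (m + 1), p (j + 1) * (z ^ j).im - p 0 * z.im / ρ ^ 2 := by
    have : polyField (m + 2) p z / z = z ^ (m + 1) +
        ∑ j ∈ Finset.range (m + 1), (p (j + 1) : ℂ) * z ^ j + p 0 * z⁻¹ := by
      unfold polyField
      rw [show m + 2 = (m + 1) + 1 by omega, Finset.sum_range_succ', div_eq_iff hz0, add_mul,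
        add_mul, Finset.sum_mul]
      simp only [pow_zero, mul_one]
      rw [mul_assoc, inv_mul_cancel₀ hz0, mul_one, ← add_assoc]
      refine congrArg₂ (· + ·) (congrArg₂ (· + ·) (by ring)
        (Finset.sum_congr rfl fun j _ => by ring)) rfl
    rw [this, Complex.add_im, Complex.add_im, Complex.im_sum, Complex.im_ofReal_mul,
      Complex.inv_im, Complex.normSq_eq_norm_sq, ← hρ]
    simp only [Complex.im_ofReal_mul]
    ring
  have hterm0 : -(B / r * z.im) ≤ e * (z.re * -(p 0 * z.im / ρ ^ 2)) := by
    refine neg_le_of_neg_le ((neg_le_abs _).trans ?_)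
    rw [abs_mul, he, one_mul, abs_mul, abs_neg, abs_div, abs_mul, abs_of_pos hy,
      abs_of_pos (pow_pos hρ0 2)]
    have hb := hp 0 (by omega)
    calc |z.re| * (|p 0| * z.im / ρ ^ 2) ≤ ρ * (B * z.im / ρ ^ 2) := by gcongr
      _ = B / ρ * z.im := by field_simp
      _ ≤ _ := by gcongr
  have hterms : -((∑ j ∈ Finset.range (m + 1), B * j) * (1 + ρ ^ m) * z.im) ≤
      e * (z.re * ∑ j ∈ Finset.range (m + 1), p (j + 1) * (z ^ j).im) := by
    rw [Finset.mul_sum, Finset.mul_sum, Finset.sum_mul, Finset.sum_mul, ← Finset.sum_neg_distrib]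
    refine Finset.sum_le_sum fun j hj => ?_
    refine neg_le_of_neg_le ((neg_le_abs _).trans ?_)
    have hj' := Finset.mem_range.1 hj
    have hb := hp (j + 1) (by omega)
    have him := abs_im_pow_le z j
    rw [abs_of_pos hy, ← hρ] at him
    rw [abs_mul, he, one_mul, abs_mul, abs_mul]
    have hpow : ρ * (j * ρ ^ (j - 1)) ≤ j * (1 + ρ ^ m) := by
      rcases j with _ | j
      · simp
      · rw [Nat.add_sub_cancel]
        have h2 : ρ ^ (j + 1) ≤ 1 + ρ ^ m := by
          rcases le_total ρ 1 with h | h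
          · have := pow_le_one₀ hρ0.le h (n := j + 1)
            have : 0 ≤ ρ ^ m := by positivity
            linarith
          · have := pow_le_pow_right₀ h (show j + 1 ≤ m by omega)
            linarith
        calc ρ * (((j + 1 : ℕ) : ℝ) * ρ ^ j) = ((j + 1 : ℕ) : ℝ) * ρ ^ (j + 1) := by ring
          _ ≤ _ := by gcongr
    calc |z.re| * (|p (j + 1)| * |(z ^ j).im|) ≤ ρ * (B * (j * ρ ^ (j - 1) * z.im)) := by gcongr
      _ = B * (ρ * (j * ρ ^ (j - 1))) * z.im := by ring
      _ ≤ B * (j * (1 + ρ ^ m)) * z.im := by gcongr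
      _ = _ := by ring
  have hC' := mul_le_mul_of_nonneg_right (hCb ρ hρ0.le) hy.le
  rw [hquot]
  calc -(C + B / r) * z.im ≤ 1 / 2 * z.im * ρ ^ (m + 1) -
        (∑ j ∈ Finset.range (m + 1), B * j) * (1 + ρ ^ m) * z.im - B / r * z.im := by linarith
    _ ≤ e * (z.re * (z ^ (m + 1)).im) +
        e * (z.re * ∑ j ∈ Finset.range (m + 1), p (j + 1) * (z ^ j).im) +
        e * (z.re * -(p 0 * z.im / ρ ^ 2)) := by linarith
    _ = _ := by ring

/-- A continuous function on `[0, ω]` whose right derivative is given by the polynomial field. -/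
structure IsRightSol (n : ℕ) (ω : ℝ) (P : ℝ → ℕ → ℝ) (z : ℝ → ℂ) : Prop where
  cont : ContinuousOn z (Icc 0 ω)
  deriv : ∀ t ∈ Ico 0 ω, HasDerivWithinAt z (polyField n (P t) (z t)) (Ici t) t

/-- A periodic solution may be started at any of its values. -/
lemma IsRightSol.exists_rotate {n : ℕ} {ω : ℝ} {P : ℝ → ℕ → ℝ} {z : ℝ → ℂ}
    (h : IsRightSol n ω P z) (hper : z 0 = z ω) {a : ℝ} (ha : a ∈ Icc 0 ω) :
    ∃ (P' : ℝ → ℕ → ℝ) (z' : ℝ → ℂ), IsRightSol n ω P' z' ∧ z' 0 = z a ∧ z' ω = z a ∧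
      (∀ t ∈ Icc 0 ω, ∃ t' ∈ Icc 0 ω, z' t = z t') ∧
      (∀ t ∈ Ico 0 ω, ∃ t' ∈ Icc 0 ω, P' t = P t') := by
  obtain ⟨ha0, haω⟩ := ha
  set z' : ℝ → ℂ := fun t => if t ≤ ω - a then z (t + a) else z (t + a - ω) with hz'
  set P' : ℝ → ℕ → ℝ := fun t => if t < ω - a then P (t + a) else P (t + a - ω) with hP'
  have hz1 : ∀ t ≤ ω - a, z' t = z (t + a) := fun t ht => if_pos ht
  have hz2 : ∀ t ≥ ω - a, z' t = z (t + a - ω) := by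
    intro t ht
    rcases ht.eq_or_lt with h0 | h0
    · rw [hz1 t h0.ge, ← h0]
      rw [show ω - a + a = ω by ring, sub_self, hper]
    · exact if_neg (not_le.2 h0)
  refine ⟨P', z', ⟨?_, ?_⟩, ?_, ?_, ?_, ?_⟩
  · rw [← Icc_union_Icc_eq_Icc (show 0 ≤ ω - a by linarith) (show ω - a ≤ ω by linarith)]
    refine ContinuousOn.union_of_isClosed ?_ ?_ isClosed_Icc isClosed_Icc
    · refine ContinuousOn.congr (h.cont.comp (f := fun t => t + a) (by fun_prop) ?_)
        fun t ht => hz1 t ht.2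
      intro t ht
      exact ⟨by linarith [ht.1], by linarith [ht.2]⟩
    · refine ContinuousOn.congr (h.cont.comp (f := fun t => t + a - ω) (by fun_prop) ?_)
        fun t ht => hz2 t ht.1
      intro t ht
      exact ⟨by linarith [ht.1], by linarith [ht.2]⟩
  · intro t ht
    by_cases hlt : t < ω - a
    · have hd := h.deriv (t + a) ⟨by linarith [ht.1], by linarith⟩
      have h1 : P' t = P (t + a) := if_pos hlt
      rw [h1, hz1 t hlt.le]
      have h2 : HasDerivWithinAt (fun t => t + a) 1 (Ici t) t :=
        ((hasDerivAt_id' t).add_const a).hasDerivWithinAt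
      have h3 := hd.scomp t h2 (fun s hs => by simpa using hs)
      rw [one_smul] at h3
      refine h3.congr_of_eventuallyEq ?_ (hz1 t hlt.le)
      filter_upwards [mem_nhdsWithin_of_mem_nhds (Iio_mem_nhds hlt)] with s hs
      exact hz1 s (le_of_lt hs)
    · push Not at hlt
      have hd := h.deriv (t + a - ω) ⟨by linarith, by linarith [ht.2]⟩
      have h1 : P' t = P (t + a - ω) := if_neg (not_lt.2 hlt)
      rw [h1, hz2 t hlt]
      have h2 : HasDerivWithinAt (fun t => t + a - ω) 1 (Ici t) t :=
        (((hasDerivAt_id' t).add_const a).sub_const ω).hasDerivWithinAt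
      have h3 := hd.scomp t h2 (fun s hs => by simpa using hs)
      rw [one_smul] at h3
      exact h3.congr (fun s hs => hz2 s (hlt.trans hs)) (hz2 t hlt)
  · rw [hz1 0 (by linarith), zero_add]
  · rw [hz2 ω (by linarith)]; congr 1; ring
  · intro t ht
    rcases le_total t (ω - a) with h1 | h1
    · exact ⟨t + a, ⟨by linarith [ht.1], by linarith⟩, hz1 t h1⟩
    · exact ⟨t + a - ω, ⟨by linarith, by linarith [ht.2]⟩, hz2 t h1⟩
  · intro t ht
    by_cases h1 : t < ω - a
    · exact ⟨t + a, ⟨by linarith [ht.1], by linarith⟩, if_pos h1⟩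
    · exact ⟨t + a - ω, ⟨by linarith, by linarith [ht.2]⟩, if_neg h1⟩

lemma norm_polyField_div_sub_one_le {n : ℕ} {B : ℝ} {p : ℕ → ℝ} (hp : ∀ i < n, |p i| ≤ B) {z : ℂ}
    (hz : z ≠ 0) : ‖polyField n p z / z ^ n - 1‖ ≤ ∑ i ∈ Finset.range n, B * ‖z‖⁻¹ ^ (n - i) := by
  have : polyField n p z / z ^ n - 1 = ∑ i ∈ Finset.range n, (p i : ℂ) * z⁻¹ ^ (n - i) := by
    unfold polyField
    rw [add_div, div_self (pow_ne_zero n hz), add_sub_cancel_left, Finset.sum_div]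
    refine Finset.sum_congr rfl fun i hi => ?_
    have hi' := Finset.mem_range.1 hi
    rw [mul_div_assoc]
    congr 1
    rw [inv_pow, div_eq_iff (pow_ne_zero n hz), eq_inv_mul_iff_mul_eq₀ (pow_ne_zero _ hz),
      ← pow_add]
    congr 1; omega
  rw [this]
  refine (norm_sum_le _ _).trans (Finset.sum_le_sum fun i hi => ?_)
  rw [norm_mul, norm_pow, norm_inv, Complex.norm_real, Real.norm_eq_abs]
  have := hp i (Finset.mem_range.1 hi)
  gcongr

/-- Solutions that are very large at the ends of a period behave like solutions of
`z' = z ^ n` there. -/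
lemma exists_near_infinity {n : ℕ} (hn : 2 ≤ n) {r B ω δ : ℝ} (hr : 0 < r) (hB : 0 ≤ B)
    (hω : 0 < ω) (hδ : 0 < δ) :
    ∃ τ R : ℝ, 0 < τ ∧ τ ≤ ω / 2 ∧ ∀ (P : ℝ → ℕ → ℝ) (z : ℝ → ℂ), IsRightSol n ω P z →
      (∀ t ∈ Ico 0 ω, ∀ i < n, |P t i| ≤ B) → (∀ t ∈ Icc 0 ω, r < ‖z t‖) → z 0 = z ω →
      R ≤ ‖z 0‖ → ‖(z τ ^ (n - 1))⁻¹ + (((n - 1 : ℕ) * τ : ℝ) : ℂ)‖ ≤ δ * τ ∧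
        ‖(z (ω - τ) ^ (n - 1))⁻¹ - (((n - 1 : ℕ) * τ : ℝ) : ℂ)‖ ≤ δ * τ := by
  set m := n - 1 with hm
  have hm1 : 1 ≤ m := by omega
  have hmn : n = m + 1 := by omega
  set Λ : ℝ := m * (1 + ∑ i ∈ Finset.range n, B * r⁻¹ ^ (n - i)) with hΛ
  have hΛ0 : 0 < Λ := by
    have : 0 ≤ ∑ i ∈ Finset.range n, B * r⁻¹ ^ (n - i) := Finset.sum_nonneg fun i _ => by positivity
    have : (0 : ℝ) < m := by exact_mod_cast hm1
    positivity
  set η : ℝ := min 1 (δ / 2 / (m * (n * B) + 1)) with hη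
  have hη0 : 0 < η := by positivity
  have hηδ : m * (n * (B * η)) ≤ δ / 2 := by
    have h1 : η * (m * (n * B) + 1) ≤ δ / 2 := by
      rw [← le_div_iff₀ (by positivity)]; exact min_le_right _ _
    nlinarith
  set τ : ℝ := min (ω / 2) (η ^ m / (2 * Λ)) with hτ
  have hτ0 : 0 < τ := by positivity
  have hτω : τ ≤ ω / 2 := min_le_left _ _
  have hτη : Λ * τ + Λ * τ ≤ η ^ m := by
    have : τ * (2 * Λ) ≤ η ^ m := by
      rw [← le_div_iff₀ (by positivity)]; exact min_le_right _ _
    linarith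
  set κ : ℝ := min (Λ * τ) (δ / 2 * τ) with hκ
  have hκ0 : 0 < κ := by positivity
  refine ⟨τ, max 1 κ⁻¹, hτ0, hτω, fun P z h hP hz hper hR => ?_⟩
  have hzne : ∀ t ∈ Icc 0 ω, z t ≠ 0 := fun t ht => norm_pos_iff.1 (hr.trans (hz t ht))
  set w : ℝ → ℂ := fun t => (z t ^ m)⁻¹ with hw
  have hw0 : ‖w 0‖ ≤ κ := by
    have h1 : κ⁻¹ ≤ ‖z 0‖ ^ m := by
      refine (le_max_right 1 _).trans (hR.trans ?_)
      exact le_self_pow₀ ((le_max_left 1 _).trans hR) (by omega)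
    rw [hw]
    simp only [norm_inv, norm_pow]
    exact inv_le_of_inv_le₀ hκ0 h1
  have hwω : ‖w ω‖ ≤ κ := by
    have : w ω = w 0 := by simp only [hw, hper]
    rwa [this]
  have hwc : ContinuousOn w (Icc 0 ω) :=
    (h.cont.pow m).inv₀ fun t ht => pow_ne_zero m (hzne t ht)
  have hwd : ∀ t ∈ Ico 0 ω, HasDerivWithinAt w (-(m * (polyField n (P t) (z t) / z t ^ n)))
      (Ici t) t := by
    intro t ht
    have hne := hzne t ⟨ht.1, ht.2.le⟩
    have h1 : HasDerivAt (fun x : ℂ => (x ^ m)⁻¹) (-(m * z t ^ (m - 1)) / (z t ^ m) ^ 2) (z t) := by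
      have := (hasDerivAt_pow m (z t)).fun_inv (pow_ne_zero m hne)
      exact this
    have h2 := h1.comp_hasDerivWithinAt t (h.deriv t ht)
    refine h2.congr_deriv ?_
    generalize polyField n (P t) (z t) = F
    rw [div_mul_eq_mul_div, neg_mul, neg_div, mul_assoc, mul_div_assoc]
    have e1 : (z t ^ m) ^ 2 = z t ^ (m - 1) * z t ^ n := by
      rw [← pow_mul, ← pow_add]; congr 1; omega
    rw [e1, mul_div_mul_left _ _ (pow_ne_zero _ hne)]
  have hbase : ∀ a b, 0 ≤ a → a ≤ b → b ≤ ω → ‖w b - w a‖ ≤ Λ * (b - a) := by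
    intro a b ha hab hb
    refine norm_image_sub_le_of_norm_deriv_right_le_segment
      (hwc.mono (Icc_subset_Icc ha hb))
      (fun t ht => hwd t ⟨ha.trans ht.1, ht.2.trans_le hb⟩) ?_ b ⟨hab, le_rfl⟩
    intro t ht
    have ht' : t ∈ Ico 0 ω := ⟨ha.trans ht.1, ht.2.trans_le hb⟩
    rw [norm_neg, norm_mul, Complex.norm_natCast, hΛ]
    refine mul_le_mul_of_nonneg_left ?_ (Nat.cast_nonneg m)
    have h1 := norm_polyField_div_sub_one_le (hP t ht') (hzne t ⟨ht'.1, ht'.2.le⟩)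
    have h2 : ∑ i ∈ Finset.range n, B * ‖z t‖⁻¹ ^ (n - i) ≤
        ∑ i ∈ Finset.range n, B * r⁻¹ ^ (n - i) := by
      refine Finset.sum_le_sum fun i _ => ?_
      have := (hz t ⟨ht'.1, ht'.2.le⟩).le
      gcongr
    have h3 := norm_le_norm_add_norm_sub' (polyField n (P t) (z t) / z t ^ n) 1
    rw [norm_one] at h3
    linarith
  have hfine : ∀ a b, 0 ≤ a → a ≤ b → b ≤ ω → (∀ t ∈ Icc a b, ‖w t‖ ≤ η ^ m) →
      ‖w b + ((m * b : ℝ) : ℂ) - (w a + ((m * a : ℝ) : ℂ))‖ ≤ δ / 2 * (b - a) := by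
    intro a b ha hab hb hsmall
    refine norm_image_sub_le_of_norm_deriv_right_le_segment
      (f := fun t => w t + ((m * t : ℝ) : ℂ))
      (f' := fun t => -(m * (polyField n (P t) (z t) / z t ^ n)) + ((m * 1 : ℝ) : ℂ))
      ((hwc.mono (Icc_subset_Icc ha hb)).add (by fun_prop))
      (fun t ht => (hwd t ⟨ha.trans ht.1, ht.2.trans_le hb⟩).add
        (((hasDerivAt_id' t).const_mul (m : ℝ)).ofReal_comp.hasDerivWithinAt)) ?_ b ⟨hab, le_rfl⟩
    intro t ht
    have ht' : t ∈ Ico 0 ω := ⟨ha.trans ht.1, ht.2.trans_le hb⟩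
    have h1 := norm_polyField_div_sub_one_le (hP t ht') (hzne t ⟨ht'.1, ht'.2.le⟩)
    have h4 : ‖z t‖⁻¹ ≤ η := by
      have := hsmall t ⟨ht.1, ht.2.le⟩
      simp only [hw, norm_inv, norm_pow, ← inv_pow] at this
      exact (pow_le_pow_iff_left₀ (by positivity) hη0.le (by omega)).1 this
    have h2 : ∑ i ∈ Finset.range n, B * ‖z t‖⁻¹ ^ (n - i) ≤ n * (B * η) := by
      have : ∀ i ∈ Finset.range n, B * ‖z t‖⁻¹ ^ (n - i) ≤ B * η := by
        intro i hi
        have hi' := Finset.mem_range.1 hi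
        have h5 : ‖z t‖⁻¹ ^ (n - i) ≤ ‖z t‖⁻¹ :=
          pow_le_of_le_one (by positivity) (h4.trans (min_le_left _ _)) (by omega)
        exact mul_le_mul_of_nonneg_left (h5.trans h4) hB
      simpa using Finset.sum_le_sum this
    have h3 : -(m * (polyField n (P t) (z t) / z t ^ n)) + ((m * 1 : ℝ) : ℂ) =
        -(m * (polyField n (P t) (z t) / z t ^ n - 1)) := by push_cast; ring
    rw [h3, norm_neg, norm_mul, Complex.norm_natCast]
    exact (mul_le_mul_of_nonneg_left (h1.trans h2) (Nat.cast_nonneg m)).trans hηδ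
  have hκ1 : κ ≤ Λ * τ := min_le_left _ _
  have hκ2 : κ ≤ δ / 2 * τ := min_le_right _ _
  constructor
  · have hs : ∀ t ∈ Icc 0 τ, ‖w t‖ ≤ η ^ m := by
      intro t ht
      have h1 := hbase 0 t le_rfl ht.1 (by linarith [ht.2])
      have h2 : Λ * (t - 0) ≤ Λ * τ := by rw [sub_zero]; gcongr; exact ht.2
      have h3 := norm_le_norm_add_norm_sub' (w t) (w 0)
      linarith
    have h1 := hfine 0 τ le_rfl hτ0.le (by linarith) hs
    have h2 := norm_le_norm_add_norm_sub' (w τ + ((m * τ : ℝ) : ℂ)) (w 0 + ((m * 0 : ℝ) : ℂ))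
    simp only [mul_zero, Complex.ofReal_zero, add_zero, sub_zero] at h1 h2
    change ‖w τ + ((m * τ : ℝ) : ℂ)‖ ≤ _
    linarith
  · have hs : ∀ t ∈ Icc (ω - τ) ω, ‖w t‖ ≤ η ^ m := by
      intro t ht
      have h1 := hbase t ω (by linarith [ht.1]) ht.2 le_rfl
      have h2 : Λ * (ω - t) ≤ Λ * τ := by gcongr; linarith [ht.1]
      have h3 := norm_le_norm_add_norm_sub (w ω) (w t)
      linarith
    have h1 := hfine (ω - τ) ω (by linarith) (by linarith) le_rfl hs
    have h2 := norm_le_norm_add_norm_sub (w ω + ((m * ω : ℝ) : ℂ)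
      - ((m * (ω - τ) : ℝ) : ℂ) - ((m * τ : ℝ) : ℂ)) (w (ω - τ) - ((m * τ : ℝ) : ℂ))
    have e1 : w ω + ((m * ω : ℝ) : ℂ) - ((m * (ω - τ) : ℝ) : ℂ) - ((m * τ : ℝ) : ℂ) = w ω := by
      push_cast; ring
    rw [e1] at h2
    have e2 : w ω - (w (ω - τ) - ((m * τ : ℝ) : ℂ)) =
        w ω + ((m * ω : ℝ) : ℂ) - (w (ω - τ) + ((m * (ω - τ) : ℝ) : ℂ)) := by
      push_cast; ring
    rw [e2] at h2
    change ‖w (ω - τ) - ((m * τ : ℝ) : ℂ)‖ ≤ _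
    have e3 : ω - (ω - τ) = τ := by ring
    rw [e3] at h1
    linarith

lemma cos_sin_of_inv_pow_near {m : ℕ} (hm : 1 ≤ m) {z : ℂ} (hz : z ≠ 0) {s τ δ : ℝ} (hτ : 0 < τ)
    (hδ : δ ≤ 1 / 3) (hs : s = 1 ∨ s = -1)
    (h : ‖(z ^ m)⁻¹ - ((s * (m * τ) : ℝ) : ℂ)‖ ≤ δ * τ) :
    1 / 2 ≤ s * cos (m * z.arg) ∧ |sin (m * z.arg)| ≤ 2 * δ := by
  have hN : 0 < ‖z‖ ^ m := by have := norm_pos_iff.2 hz; positivity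
  have hm' : (1 : ℝ) ≤ m := by exact_mod_cast hm
  have hre : ((z ^ m)⁻¹).re = (‖z‖ ^ m)⁻¹ * cos (m * z.arg) := by
    rw [Complex.inv_re, Complex.normSq_eq_norm_sq, norm_pow, re_pow_eq]; field_simp
  have him : ((z ^ m)⁻¹).im = -((‖z‖ ^ m)⁻¹ * sin (m * z.arg)) := by
    rw [Complex.inv_im, Complex.normSq_eq_norm_sq, norm_pow, im_pow_eq]; field_simp
  have h1 := (Complex.abs_re_le_norm _).trans h
  have h2 := (Complex.abs_im_le_norm _).trans h
  rw [Complex.sub_re, Complex.ofReal_re, hre] at h1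
  rw [Complex.sub_im, Complex.ofReal_im, him, sub_zero, abs_neg, abs_mul,
    abs_of_pos (inv_pos.2 hN)] at h2
  have h3 : (‖z‖ ^ m)⁻¹ ≤ m * τ + δ * τ := by
    have h4 := norm_le_norm_add_norm_sub' (z ^ m)⁻¹ ((s * (m * τ) : ℝ) : ℂ)
    have h5 : ‖((s * (m * τ) : ℝ) : ℂ)‖ = m * τ := by
      rw [Complex.norm_real, Real.norm_eq_abs, abs_mul, abs_of_pos (show 0 < m * τ by positivity)]
      rcases hs with rfl | rfl <;> simp
    rw [norm_inv, norm_pow, h5] at h4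
    linarith
  set u := (‖z‖ ^ m)⁻¹ with hu
  have hu0 : 0 < u := inv_pos.2 hN
  have h4 : m * τ - δ * τ ≤ u * (s * cos (m * z.arg)) := by
    have := abs_le.1 h1
    rcases hs with rfl | rfl <;> [linarith [this.1]; linarith [this.2]]
  have h6 : τ ≤ m * τ := by nlinarith
  have h7 : δ * τ ≤ 1 / 3 * τ := by gcongr
  have h8 : 1 / 2 * τ ≤ u := by
    have : s * cos (m * z.arg) ≤ 1 := by
      rcases hs with rfl | rfl
      · linarith [cos_le_one (m * z.arg)]
      · linarith [neg_one_le_cos (m * z.arg)]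
    nlinarith
  constructor
  · by_contra! hc
    nlinarith
  · have hpos : 0 ≤ |sin (m * z.arg)| := abs_nonneg _
    by_contra! hc
    nlinarith

set_option maxHeartbeats 1000000 in
/-- A priori bound for periodic solutions in the upper half plane. -/
lemma exists_bound_of_im_pos {n : ℕ} (hn : 5 ≤ n) {r B ω : ℝ} (hr : 0 < r) (hB : 0 ≤ B)
    (hω : 0 < ω) :
    ∃ R : ℝ, ∀ (e : ℝ) (P : ℝ → ℕ → ℝ) (z : ℝ → ℂ), (e = 1 ∨ e = -1) → IsRightSol n ω P z →
      (∀ t ∈ Ico 0 ω, ∀ i < n, |P t i| ≤ B) → (∀ t ∈ Icc 0 ω, r < ‖z t‖) →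
      (∀ t ∈ Icc 0 ω, 0 < (z t).im) → (∀ t ∈ Icc 0 ω, 0 < e * (z t ^ (n - 2)).im) →
      z 0 = z ω → ‖z 0‖ < R := by
  obtain ⟨C, hC, hang⟩ := exists_angular_bound hn hr hB
  have hn0 : (5 : ℝ) ≤ n := by exact_mod_cast hn
  set σ := sin (π / (2 * n)) with hσ
  have hσ0 : 0 < σ := sin_pos_of_pos_of_lt_pi (by have := pi_pos; positivity)
    (by rw [div_lt_iff₀ (by positivity)]; nlinarith [pi_pos])
  set D := exp (-((2 * C + 1) * ω)) with hD
  have hD0 : 0 < D := exp_pos _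
  have hD1 : D ≤ 1 := exp_le_one_iff.2 (by have : 0 ≤ (2 * C + 1) * ω := by positivity
                                           linarith)
  set δ := min (1 / 3) (σ * D / 8) with hδ
  have hδ0 : 0 < δ := by positivity
  have hδ1 : δ ≤ 1 / 3 := min_le_left _ _
  have hδ2 : 16 * δ ^ 2 ≤ σ ^ 2 * D / 4 * D := by
    have : δ ≤ σ * D / 8 := min_le_right _ _
    have : δ ^ 2 ≤ (σ * D / 8) ^ 2 := by gcongr
    nlinarith
  obtain ⟨τ, R, hτ, hτω, hnear⟩ := exists_near_infinity (by omega : 2 ≤ n) hr hB hω hδ0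
  refine ⟨R, fun e P z he h hP hz hy hG hper => ?_⟩
  by_contra! hR
  obtain ⟨hin, hout⟩ := hnear P z h hP hz hper hR
  have hzne : ∀ t ∈ Icc 0 ω, z t ≠ 0 := fun t ht => norm_pos_iff.1 (hr.trans (hz t ht))
  have hm1 : 1 ≤ n - 1 := by omega
  have memτ : τ ∈ Icc 0 ω := ⟨hτ.le, by linarith⟩
  have memτ' : ω - τ ∈ Icc 0 ω := ⟨by linarith, by linarith⟩
  have h1 := cos_sin_of_inv_pow_near hm1 (hzne τ memτ) (s := -1) hτ hδ1 (Or.inr rfl)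
    (by convert hin using 2; push_cast; ring)
  have h2 := cos_sin_of_inv_pow_near hm1 (hzne _ memτ') (s := 1) hτ hδ1 (Or.inl rfl)
    (by convert hout using 2; push_cast; ring)
  have hG' : ∀ t ∈ Icc 0 ω, 0 < e * sin ((n - 2 : ℕ) * (z t).arg) := by
    intro t ht
    have h3 := hG t ht
    rw [im_pow_eq, mul_left_comm] at h3
    exact pos_of_mul_pos_right h3 (by positivity)
  have hθ : ∀ t ∈ Icc 0 ω, (z t).arg ∈ Ioo 0 π := fun t ht => arg_mem_Ioo_of_im_pos (hy t ht)
  have hsin0 : ∀ t ∈ Icc 0 ω, 0 < sin (z t).arg := fun t ht =>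
    sin_pos_of_pos_of_lt_pi (hθ t ht).1 (hθ t ht).2
  have hcast : ((n - 1 : ℕ) : ℝ) = ((n - 2 : ℕ) : ℝ) + 1 := by
    rw [Nat.cast_sub (by omega), Nat.cast_sub (by omega)]; push_cast; ring
  have hIn : ∀ t ∈ Icc 0 ω, e * cos ((n - 1 : ℕ) * (z t).arg) < 0 → σ ≤ sin (z t).arg := by
    intro t ht hneg
    by_contra! hc
    exact lt_asymm hneg (sin_cos_near_axis hn (hθ t ht) he (hG' t ht) hc).1
  have hOut : ∀ t ∈ Icc 0 ω, 1 / 2 ≤ e * cos ((n - 1 : ℕ) * (z t).arg) →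
      |sin ((n - 1 : ℕ) * (z t).arg)| ≤ 2 * δ → sin (z t).arg < 4 * δ := by
    intro t ht hc hs
    have h3 := hG' t ht
    have h4 : sin ((n - 2 : ℕ) * (z t).arg) = sin ((n - 1 : ℕ) * (z t).arg) * cos (z t).arg -
        cos ((n - 1 : ℕ) * (z t).arg) * sin (z t).arg := by
      rw [← sin_sub, hcast]; congr 1; ring
    rw [h4] at h3
    have h5 : e * (sin ((n - 1 : ℕ) * (z t).arg) * cos (z t).arg) ≤ 2 * δ := by
      refine (le_abs_self _).trans ?_
      rw [abs_mul, abs_mul, show |e| = 1 by rcases he with rfl | rfl <;> simp, one_mul]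
      calc _ ≤ |sin ((n - 1 : ℕ) * (z t).arg)| * 1 := by gcongr; exact abs_cos_le_one _
        _ ≤ _ := by linarith
    have h6 := hsin0 t ht
    nlinarith
  set p : ℝ → ℝ := fun t => (z t).im ^ 2 / Complex.normSq (z t) with hp
  have hps : ∀ t ∈ Icc 0 ω, p t = sin (z t).arg ^ 2 := by
    intro t ht
    rw [hp, Complex.sin_arg, div_pow]
    simp only [Complex.normSq_eq_norm_sq]
  set p' : ℝ → ℝ := fun t => 2 * (z t).im / Complex.normSq (z t) *
    ((z t).re * (polyField n (P t) (z t) / z t).im) with hp'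
  have hNpos : ∀ t ∈ Icc 0 ω, 0 < Complex.normSq (z t) := fun t ht =>
    Complex.normSq_pos.2 (hzne t ht)
  have hpc : ContinuousOn p (Icc 0 ω) :=
    ((Complex.continuous_im.comp_continuousOn h.cont).pow 2).div
      (Complex.continuous_normSq.comp_continuousOn h.cont) fun t ht => (hNpos t ht).ne'
  have hpd : ∀ t ∈ Ico 0 ω, HasDerivWithinAt p (p' t) (Ici t) t := by
    intro t ht
    have hd := h.deriv t ht
    have hre := Complex.reCLM.hasFDerivAt.comp_hasDerivWithinAt t hd
    have him := Complex.imCLM.hasFDerivAt.comp_hasDerivWithinAt t hd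
    simp only [Complex.reCLM_apply, Complex.imCLM_apply] at hre him
    have hN := hNpos t ⟨ht.1, ht.2.le⟩
    have h3 := (him.mul him).div ((hre.mul hre).add (him.mul him))
      (by have := hN.ne'; rwa [Complex.normSq_apply] at this)
    have h4 : p = ((⇑Complex.imCLM ∘ z) * (⇑Complex.imCLM ∘ z)) /
        ((⇑Complex.reCLM ∘ z) * (⇑Complex.reCLM ∘ z) + (⇑Complex.imCLM ∘ z) * (⇑Complex.imCLM ∘ z)) := by
      ext s
      simp [hp, Complex.normSq_apply, sq]
    rw [h4]
    refine h3.congr_deriv ?_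
    simp only [hp', Pi.add_apply, Pi.mul_apply, Function.comp, Complex.reCLM_apply,
      Complex.imCLM_apply]
    rw [Complex.div_im]
    rw [Complex.normSq_apply] at hN ⊢
    field_simp
    ring
  have hslow : ∀ t ∈ Ico 0 ω, p t < σ ^ 2 → -(2 * C) * p t ≤ e * p' t := by
    intro t ht' hlt
    have ht : t ∈ Icc 0 ω := ⟨ht'.1, ht'.2.le⟩
    rw [hps t ht] at hlt
    have h3 := lt_of_pow_lt_pow_left₀ 2 hσ0.le hlt
    obtain ⟨-, h4⟩ := sin_cos_near_axis hn (hθ t ht) he (hG' t ht) h3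
    have h5 : 1 / 2 * (z t).im * ‖z t‖ ^ (n - 1) ≤ e * ((z t).re * (z t ^ (n - 1)).im) := by
      rw [im_pow_eq, show (z t).im = ‖z t‖ * sin (z t).arg from (Complex.norm_mul_sin_arg _).symm,
        show (z t).re = ‖z t‖ * cos (z t).arg from (Complex.norm_mul_cos_arg _).symm]
      have := mul_le_mul_of_nonneg_left h4 (show 0 ≤ ‖z t‖ * ‖z t‖ ^ (n - 1) by positivity)
      linarith
    have h6 := hang e (P t) (z t) (by rcases he with rfl | rfl <;> simp) (hP t ht') (hz t ht)
      (hy t ht) h5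
    have h7 : 0 ≤ 2 * (z t).im / Complex.normSq (z t) := by
      have := hy t ht
      have := hNpos t ht
      positivity
    have h8 := mul_le_mul_of_nonneg_left h6 h7
    calc -(2 * C) * p t = 2 * (z t).im / Complex.normSq (z t) * (-C * (z t).im) := by
          simp only [hp]; ring
      _ ≤ _ := h8
      _ = e * p' t := by simp only [hp']; ring
  have hfin : ∀ t ∈ Icc 0 ω, σ ≤ sin (z t).arg → σ ^ 2 ≤ p t := by
    intro t ht h3
    rw [hps t ht]; gcongr
  have hfin' : ∀ t ∈ Icc 0 ω, sin (z t).arg < 4 * δ → p t ≤ 16 * δ ^ 2 := by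
    intro t ht h3
    rw [hps t ht]
    have := (hsin0 t ht).le
    nlinarith
  have hsub : Icc τ (ω - τ) ⊆ Icc 0 ω := Icc_subset_Icc hτ.le (by linarith)
  have hDle : ∀ x, x ≤ ω → D ≤ exp (-(2 * C + 1) * x) := by
    intro x hx
    refine exp_le_exp.2 ?_
    have : (2 * C + 1) * x ≤ (2 * C + 1) * ω := by gcongr
    linarith
  have hσD : σ ^ 2 * D / 4 * D ≤ σ ^ 2 * D / 4 := mul_le_of_le_one_right (by positivity) hD1
  have hσD0 : 0 < σ ^ 2 * D := by positivity
  have hsubo : ∀ t ∈ Ico τ (ω - τ), t ∈ Ico 0 ω := fun t ht =>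
    ⟨hτ.le.trans ht.1, by linarith [ht.2]⟩
  rcases he with rfl | rfl
  · have h3 := hfin τ memτ (hIn τ memτ (by linarith [h1.1]))
    have h4 := hfin' _ memτ' (hOut _ memτ' h2.1 h2.2)
    have h5 := le_of_deriv_right_ge_neg_mul (δ := σ ^ 2 / 2) (C := 2 * C) (by positivity)
      (hpc.mono hsub) (fun t ht => hpd t (hsubo t ht)) (by linarith [sq_nonneg σ]) (by positivity)
      (fun t ht h6 h7 => by
        have := hslow t (hsubo t ht) (by nlinarith)
        linarith) (ω - τ) ⟨by linarith, le_rfl⟩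
    have h6 := hDle (ω - τ - τ) (by linarith)
    have h7 : σ ^ 2 / 2 * D ≤ σ ^ 2 / 2 * exp (-(2 * C + 1) * (ω - τ - τ)) := by gcongr
    linarith
  · have h3 := hfin' τ memτ (hOut τ memτ (by linarith [h1.1]) h1.2)
    have h4 := hfin _ memτ' (hIn _ memτ' (by linarith [h2.1]))
    have hle : 16 * δ ^ 2 * exp ((2 * C + 1) * (ω - τ - τ)) ≤ σ ^ 2 / 4 := by
      have h6 := hDle (ω - τ - τ) (by linarith)
      have h7 : D * exp ((2 * C + 1) * (ω - τ - τ)) ≤ 1 := by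
        calc _ ≤ exp (-(2 * C + 1) * (ω - τ - τ)) * exp ((2 * C + 1) * (ω - τ - τ)) := by gcongr
          _ = 1 := by rw [← exp_add, neg_mul, neg_add_cancel, exp_zero]
      calc 16 * δ ^ 2 * exp ((2 * C + 1) * (ω - τ - τ))
          ≤ σ ^ 2 * D / 4 * D * exp ((2 * C + 1) * (ω - τ - τ)) := by gcongr
        _ = σ ^ 2 / 4 * D * (D * exp ((2 * C + 1) * (ω - τ - τ))) := by ring
        _ ≤ σ ^ 2 / 4 * 1 * 1 := by gcongr
        _ = _ := by ring
    have h5 := le_of_deriv_right_le_mul (ε := 16 * δ ^ 2) (C := 2 * C) (by positivity)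
      (hpc.mono hsub) (fun t ht => hpd t (hsubo t ht)) h3 (by positivity)
      (fun t ht h6 h7 => by
        have := hslow t (hsubo t ht) (by nlinarith)
        linarith) (ω - τ) ⟨by linarith, le_rfl⟩
    nlinarith

lemma exists_bound_of_im_eq_zero {n : ℕ} (hn : 2 ≤ n) {r B ω : ℝ} (hr : 0 < r) (hB : 0 ≤ B)
    (hω : 0 < ω) :
    ∃ R : ℝ, ∀ (P : ℝ → ℕ → ℝ) (z : ℝ → ℂ), IsRightSol n ω P z →
      (∀ t ∈ Ico 0 ω, ∀ i < n, |P t i| ≤ B) → (∀ t ∈ Icc 0 ω, r < ‖z t‖) →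
      (∀ t ∈ Icc 0 ω, (z t).im = 0) → z 0 = z ω → ‖z 0‖ < R := by
  obtain ⟨τ, R, hτ, hτω, hnear⟩ := exists_near_infinity hn hr hB hω (δ := 1 / 2) (by norm_num)
  refine ⟨R, fun P z h hP hz hy hper => ?_⟩
  by_contra! hR
  obtain ⟨hin, hout⟩ := hnear P z h hP hz hper hR
  have hzne : ∀ t ∈ Icc 0 ω, z t ≠ 0 := fun t ht => norm_pos_iff.1 (hr.trans (hz t ht))
  have hm1 : (1 : ℝ) ≤ (n - 1 : ℕ) := by exact_mod_cast (by omega : 1 ≤ n - 1)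
  have h1 := abs_le.1 ((Complex.abs_re_le_norm _).trans hin)
  have h2 := abs_le.1 ((Complex.abs_re_le_norm _).trans hout)
  rw [Complex.add_re, Complex.ofReal_re] at h1
  rw [Complex.sub_re, Complex.ofReal_re] at h2
  have hsub : Icc τ (ω - τ) ⊆ Icc 0 ω := Icc_subset_Icc hτ.le (by linarith)
  have hwc : ContinuousOn (fun t => ((z t ^ (n - 1))⁻¹).re) (Icc τ (ω - τ)) :=
    Complex.continuous_re.comp_continuousOn
      (((h.cont.mono hsub).pow _).inv₀ fun t ht => pow_ne_zero _ (hzne t (hsub ht)))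
  have hmτ : τ ≤ (n - 1 : ℕ) * τ := by nlinarith
  obtain ⟨t, ht, ht0⟩ := intermediate_value_Icc (by linarith : τ ≤ ω - τ) hwc
    (show (0 : ℝ) ∈ Icc _ _ from ⟨by linarith [h1.2], by linarith [h2.1]⟩)
  have hre : z t = ((z t).re : ℂ) := Complex.ext rfl (by simp [hy t (hsub ht)])
  have h3 := pow_ne_zero (n - 1) (hzne t (hsub ht))
  dsimp only at ht0
  rw [hre, ← Complex.ofReal_pow, ← Complex.ofReal_inv, Complex.ofReal_re] at ht0
  rw [hre, ← Complex.ofReal_pow] at h3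
  exact h3 (by rw [inv_eq_zero.1 ht0, Complex.ofReal_zero])

lemma polyField_conj (n : ℕ) (p : ℕ → ℝ) (z : ℂ) :
    polyField n p (starRingEnd ℂ z) = starRingEnd ℂ (polyField n p z) := by
  simp [polyField]

lemma IsRightSol.conj {n : ℕ} {ω : ℝ} {P : ℝ → ℕ → ℝ} {z : ℝ → ℂ} (h : IsRightSol n ω P z) :
    IsRightSol n ω P fun t => starRingEnd ℂ (z t) := by
  refine ⟨Complex.continuous_conj.comp_continuousOn h.cont, fun t ht => ?_⟩
  rw [polyField_conj]
  exact Complex.conjCLE.toContinuousLinearMap.hasFDerivAt.comp_hasDerivWithinAt t (h.deriv t ht)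

lemma isRightSol_of_hasDerivWithinAt {n : ℕ} {ω : ℝ} {P : ℝ → ℕ → ℝ} {z : ℝ → ℂ}
    (h : ∀ t ∈ Icc 0 ω, HasDerivWithinAt z (polyField n (P t) (z t)) (Icc 0 ω) t) :
    IsRightSol n ω P z :=
  ⟨fun t ht => (h t ht).continuousWithinAt, fun t ht =>
    ((h t ⟨ht.1, ht.2.le⟩).mono (Icc_subset_Icc_left ht.1)).mono_of_mem_nhdsWithin
      (Icc_mem_nhdsGE ht.2)⟩

/-- The imaginary part of a periodic solution never changes sign. -/
lemma IsRightSol.im_pos_of_im_pos {n : ℕ} {ω B : ℝ} {P : ℝ → ℕ → ℝ} {z : ℝ → ℂ}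
    (h : IsRightSol n ω P z) (hB : 0 ≤ B) (hP : ∀ t ∈ Ico 0 ω, ∀ i < n, |P t i| ≤ B)
    (hper : z 0 = z ω) {a : ℝ} (ha : a ∈ Icc 0 ω) (hva : 0 < (z a).im) :
    ∀ t ∈ Icc 0 ω, 0 < (z t).im := by
  obtain ⟨M, hM⟩ := isCompact_Icc.exists_bound_of_continuousOn h.cont
  have hM0 : 0 ≤ M := (norm_nonneg _).trans (hM a ha)
  refine pos_of_deriv_right_ge_neg_mul (v' := fun t => (polyField n (P t) (z t)).im)
    (Complex.continuous_im.comp_continuousOn h.cont)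
    (fun t ht => Complex.imCLM.hasFDerivAt.comp_hasDerivWithinAt t (h.deriv t ht)) (by rw [hper])
    (lipConst_nonneg (n := n) hB hM0) (fun t ht hpos => ?_) ha hva
  have h1 := abs_im_polyField_le (hP t ht) (hM t ⟨ht.1, ht.2.le⟩)
  rw [abs_of_pos hpos] at h1
  have := (abs_le.1 h1).1
  linarith

/-- The set `‖z‖ ≤ r` cannot be both entered and left by a periodic solution. -/
lemma IsRightSol.norm_le_of_norm_le {n : ℕ} (hn : 5 ≤ n) {ω r B e : ℝ} {P : ℝ → ℕ → ℝ}
    {z : ℝ → ℂ} (h : IsRightSol n ω P z) (hr : 0 < r) (he : e = 1 ∨ e = -1)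
    (hP : ∀ t ∈ Ico 0 ω, Admissible n r B e (P t)) (hB : 0 ≤ B)
    (hper : z 0 = z ω) {a : ℝ} (ha : a ∈ Icc 0 ω) (hva : ‖z a‖ ≤ r) :
    ∀ t ∈ Icc 0 ω, ‖z t‖ ≤ r := by
  obtain ⟨M, hM⟩ := isCompact_Icc.exists_bound_of_continuousOn h.cont
  have hM0 : 0 ≤ M := (norm_nonneg _).trans (hM a ha)
  have hiff : ∀ t, ‖z t‖ ≤ r ↔ ‖z t‖ ^ 2 - r ^ 2 ≤ 0 := fun t => by
    rw [sub_nonpos, pow_le_pow_iff_left₀ (norm_nonneg _) hr.le two_ne_zero]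
  have hvc : ContinuousOn (fun t => ‖z t‖ ^ 2 - r ^ 2) (Icc 0 ω) :=
    (h.cont.norm.pow 2).sub continuousOn_const
  have hvd : ∀ t ∈ Ico 0 ω, HasDerivWithinAt (fun t => ‖z t‖ ^ 2 - r ^ 2)
      (2 * (starRingEnd ℂ (z t) * polyField n (P t) (z t)).re) (Ici t) t := by
    intro t ht
    have := ((h.deriv t ht).norm_sq).sub_const (r ^ 2)
    refine this.congr_deriv ?_
    rw [Complex.inner, mul_comm (starRingEnd ℂ (z t))]
  have hrad : ∀ t ∈ Ico 0 ω, 0 < ‖z t‖ ^ 2 - r ^ 2 → -lipConst n B M * (‖z t‖ ^ 2 - r ^ 2) ≤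
      e * (starRingEnd ℂ (z t) * polyField n (P t) (z t)).re := by
    intro t ht hpos
    refine (hP t ht).radial hn hr (by rcases he with rfl | rfl <;> simp) ?_ (hM t ⟨ht.1, ht.2.le⟩)
    by_contra! hc
    exact not_le.2 hpos ((hiff t).1 hc)
  have hL := lipConst_nonneg (n := n) hB hM0
  have hper' : ‖z 0‖ ^ 2 - r ^ 2 = ‖z ω‖ ^ 2 - r ^ 2 := by rw [hper]
  intro t ht
  rw [hiff] at hva ⊢
  rcases he with rfl | rfl
  · by_contra! hpos
    refine not_lt.2 hva (pos_of_deriv_right_ge_neg_mul (C := 2 * lipConst n B M) hvc hvd hper'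
      (by positivity) (fun s hs hs0 => ?_) ht hpos a ha)
    have := hrad s hs hs0
    linarith
  · refine nonpos_of_deriv_right_le_mul (C := 2 * lipConst n B M) hvc hvd hper'
      (by positivity) (fun s hs hs0 => ?_) ha hva t ht
    have := hrad s hs hs0
    linarith

/-- Periodic solutions outside the disc of radius `r`, in the upper half plane, stay in one of the
two families of sectors cut out by `Im z ^ (n - 2) = 0`. -/
lemma exists_sign_of_im_pos {n : ℕ} (hn : 5 ≤ n) {ω r B e : ℝ} {P : ℝ → ℕ → ℝ} {z : ℝ → ℂ}
    (hω : 0 < ω) (hr : 0 < r) (hP : ∀ t ∈ Icc 0 ω, Admissible n r B e (P t))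
    (h : ∀ t ∈ Icc 0 ω, HasDerivWithinAt z (polyField n (P t) (z t)) (Icc 0 ω) t)
    (hper : z 0 = z ω) (hz : ∀ t ∈ Icc 0 ω, r < ‖z t‖) (hy : ∀ t ∈ Icc 0 ω, 0 < (z t).im) :
    ∃ s : ℝ, (s = 1 ∨ s = -1) ∧ ∀ t ∈ Icc 0 ω, 0 < s * (z t ^ (n - 2)).im := by
  have key := constant_sign_of_deriv_pos (g := fun t => (z t ^ (n - 2)).im)
    (g' := fun t => (((n - 2 : ℕ) : ℂ) * (z t ^ (n - 3) * polyField n (P t) (z t))).im) hω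
    (fun t ht => ?_) (by rw [hper]) (fun t ht h0 => ?_)
  · rcases key with h1 | h1
    · exact ⟨1, Or.inl rfl, fun t ht => by linarith [h1 t ht]⟩
    · exact ⟨-1, Or.inr rfl, fun t ht => by linarith [h1 t ht]⟩
  · have h1 := (hasDerivAt_pow (n - 2) (z t)).comp_hasDerivWithinAt t (h t ht)
    have h2 := Complex.imCLM.hasFDerivAt.comp_hasDerivWithinAt t h1
    refine h2.congr_deriv ?_
    rw [Complex.imCLM_apply, show n - 2 - 1 = n - 3 by omega, mul_assoc]
  · have h1 := (hP t ht).im_pos hn hr (hy t ht) (hz t ht) h0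
    rw [← Complex.ofReal_natCast, Complex.im_ofReal_mul]
    have : (0 : ℝ) < (n - 2 : ℕ) := by exact_mod_cast (by omega : 0 < n - 2)
    positivity

/-- A priori bound for periodic solutions. -/
theorem exists_apriori_bound {n : ℕ} (hn : 5 ≤ n) {r B ω : ℝ} (hr : 0 < r) (hB : 0 ≤ B)
    (hω : 0 < ω) :
    ∃ R : ℝ, r ≤ R ∧ ∀ (e : ℝ) (P : ℝ → ℕ → ℝ) (z : ℝ → ℂ), (e = 1 ∨ e = -1) →
      (∀ t ∈ Icc 0 ω, Admissible n r B e (P t)) →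
      (∀ t ∈ Icc 0 ω, HasDerivWithinAt z (polyField n (P t) (z t)) (Icc 0 ω) t) →
      z 0 = z ω → ∀ t ∈ Icc 0 ω, ‖z t‖ ≤ R := by
  obtain ⟨R₁, hR₁⟩ := exists_bound_of_im_eq_zero (by omega : 2 ≤ n) hr hB hω
  obtain ⟨R₂, hR₂⟩ := exists_bound_of_im_pos hn hr hB hω
  refine ⟨max r (max R₁ R₂), le_max_left _ _, fun e P z he hP h hper a ha => ?_⟩
  have hs := isRightSol_of_hasDerivWithinAt h
  have hPb : ∀ t ∈ Ico 0 ω, ∀ i < n, |P t i| ≤ B := fun t ht => (hP t ⟨ht.1, ht.2.le⟩).bound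
  by_cases hin : ∃ b ∈ Icc 0 ω, ‖z b‖ ≤ r
  · obtain ⟨b, hb, hbr⟩ := hin
    exact (hs.norm_le_of_norm_le hn hr he (fun t ht => hP t ⟨ht.1, ht.2.le⟩) hB hper hb hbr a
      ha).trans (le_max_left _ _)
  push Not at hin
  have hupper : ∀ z : ℝ → ℂ,
      (∀ t ∈ Icc 0 ω, HasDerivWithinAt z (polyField n (P t) (z t)) (Icc 0 ω) t) →
      z 0 = z ω → (∀ t ∈ Icc 0 ω, r < ‖z t‖) → (∀ t ∈ Icc 0 ω, 0 < (z t).im) → ‖z a‖ < R₂ := by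
    intro z h hper hz hy
    obtain ⟨s, hs1, hsg⟩ := exists_sign_of_im_pos hn hω hr hP h hper hz hy
    obtain ⟨P', z', hz', h0, h1, hval, hPval⟩ :=
      (isRightSol_of_hasDerivWithinAt h).exists_rotate hper ha
    rw [← h0]
    refine hR₂ s P' z' hs1 hz' ?_ ?_ ?_ ?_ (h0.trans h1.symm)
    · intro t ht
      obtain ⟨t', ht', hEq⟩ := hPval t ht
      rw [hEq]; exact (hP t' ht').bound
    all_goals
      intro t ht
      obtain ⟨t', ht', hEq⟩ := hval t ht
      rw [hEq]
    exacts [hz t' ht', hy t' ht', hsg t' ht']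
  rcases lt_trichotomy (z a).im 0 with hneg | hzero | hpos
  · have hc := hs.conj
    have h1 := hc.im_pos_of_im_pos hB hPb (by rw [hper]) ha
      (by rw [Complex.conj_im]; linarith)
    have h2 := hupper (fun t => starRingEnd ℂ (z t)) (fun t ht => by
      rw [polyField_conj]
      exact Complex.conjCLE.toContinuousLinearMap.hasFDerivAt.comp_hasDerivWithinAt t (h t ht))
      (by rw [hper]) (fun t ht => by rw [RCLike.norm_conj]; exact hin t ht) h1
    rw [RCLike.norm_conj] at h2
    exact h2.le.trans ((le_max_right _ _).trans (le_max_right _ _))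
  · have hreal : ∀ t ∈ Icc 0 ω, (z t).im = 0 := by
      intro t ht
      rcases lt_trichotomy (z t).im 0 with hneg | hzero | hpos
      · have h1 := hs.conj.im_pos_of_im_pos hB hPb (by rw [hper]) ht
          (by rw [Complex.conj_im]; linarith) a ha
        rw [Complex.conj_im] at h1
        linarith
      · exact hzero
      · have := hs.im_pos_of_im_pos hB hPb hper ht hpos a ha
        linarith
    obtain ⟨P', z', hz', h0, h1, hval, hPval⟩ := hs.exists_rotate hper ha
    refine le_trans (le_of_lt ?_) ((le_max_left R₁ R₂).trans (le_max_right _ _))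
    rw [← h0]
    refine hR₁ P' z' hz' ?_ ?_ ?_ (h0.trans h1.symm)
    · intro t ht
      obtain ⟨t', ht', hEq⟩ := hPval t ht
      rw [hEq]; exact (hP t' ht').bound
    all_goals
      intro t ht
      obtain ⟨t', ht', hEq⟩ := hval t ht
      rw [hEq]
    exacts [hin t' ht', hreal t' ht']
  · have h1 := hs.im_pos_of_im_pos hB hPb hper ha hpos
    exact (hupper z h hper hin h1).le.trans ((le_max_right _ _).trans (le_max_right _ _))

/-- The divided difference of `polyField n p`. -/
def polyDivDiff (n : ℕ) (p : ℕ → ℝ) (z w : ℂ) : ℂ :=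
  ∑ j ∈ Finset.range n, z ^ j * w ^ (n - 1 - j) +
    ∑ i ∈ Finset.range n, (p i : ℂ) * ∑ j ∈ Finset.range i, z ^ j * w ^ (i - 1 - j)

lemma polyDivDiff_mul (n : ℕ) (p : ℕ → ℝ) (z w : ℂ) :
    polyDivDiff n p z w * (z - w) = polyField n p z - polyField n p w := by
  unfold polyDivDiff polyField
  rw [add_mul, geom_sum₂_mul, Finset.sum_mul]
  rw [add_sub_add_comm, ← Finset.sum_sub_distrib]
  congr 1
  refine Finset.sum_congr rfl fun i _ => ?_
  rw [mul_assoc, geom_sum₂_mul, mul_sub]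

lemma norm_geom_sum_le {N : ℝ} {z w : ℂ} (hz : ‖z‖ ≤ N) (hw : ‖w‖ ≤ N) (k : ℕ) :
    ‖∑ j ∈ Finset.range k, z ^ j * w ^ (k - 1 - j)‖ ≤ k * N ^ (k - 1) := by
  have hN : 0 ≤ N := (norm_nonneg z).trans hz
  refine (norm_sum_le _ _).trans ?_
  have : ∀ j ∈ Finset.range k, ‖z ^ j * w ^ (k - 1 - j)‖ ≤ N ^ (k - 1) := by
    intro j hj
    have hj' := Finset.mem_range.1 hj
    rw [norm_mul, norm_pow, norm_pow]
    calc ‖z‖ ^ j * ‖w‖ ^ (k - 1 - j) ≤ N ^ j * N ^ (k - 1 - j) := by gcongr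
      _ = _ := by rw [← pow_add]; congr 1; omega
  simpa using Finset.sum_le_sum this

lemma norm_polyDivDiff_le {n : ℕ} {B N : ℝ} {p : ℕ → ℝ} (hp : ∀ i < n, |p i| ≤ B) {z w : ℂ}
    (hz : ‖z‖ ≤ N) (hw : ‖w‖ ≤ N) : ‖polyDivDiff n p z w‖ ≤ lipConst n B N := by
  unfold polyDivDiff lipConst
  have hN : 0 ≤ N := (norm_nonneg z).trans hz
  refine (norm_add_le _ _).trans (add_le_add (norm_geom_sum_le hz hw n)
    ((norm_sum_le _ _).trans (Finset.sum_le_sum fun i hi => ?_)))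
  have h1 := hp i (Finset.mem_range.1 hi)
  have hB : 0 ≤ B := (abs_nonneg _).trans h1
  rw [norm_mul, Complex.norm_real, Real.norm_eq_abs]
  exact mul_le_mul h1 (norm_geom_sum_le hz hw i) (norm_nonneg _) hB

lemma norm_polyField_sub_le {n : ℕ} {ε N : ℝ} {p p' : ℕ → ℝ} (hp : ∀ i < n, |p i - p' i| ≤ ε)
    {z : ℂ} (hz : ‖z‖ ≤ N) :
    ‖polyField n p z - polyField n p' z‖ ≤ ε * ∑ i ∈ Finset.range n, N ^ i := by
  unfold polyField
  rw [add_sub_add_left_eq_sub, ← Finset.sum_sub_distrib, Finset.mul_sum]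
  refine (norm_sum_le _ _).trans (Finset.sum_le_sum fun i hi => ?_)
  have h1 := hp i (Finset.mem_range.1 hi)
  have hε : 0 ≤ ε := (abs_nonneg _).trans h1
  rw [← sub_mul, ← Complex.ofReal_sub, norm_mul, Complex.norm_real, Real.norm_eq_abs, norm_pow]
  gcongr

lemma norm_polyField_le {n : ℕ} {B N : ℝ} {p : ℕ → ℝ} (hp : ∀ i < n, |p i| ≤ B)
    {z : ℂ} (hz : ‖z‖ ≤ N) :
    ‖polyField n p z‖ ≤ N ^ n + B * ∑ i ∈ Finset.range n, N ^ i := by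
  have h1 := norm_polyField_sub_le (p' := 0) (by simpa using hp) hz
  have h2 : polyField n 0 z = z ^ n := by simp [polyField]
  rw [h2] at h1
  have h3 : ‖z ^ n‖ ≤ N ^ n := by rw [norm_pow]; gcongr
  have := norm_le_norm_add_norm_sub' (polyField n p z) (z ^ n)
  linarith

/-- The nearest point of the square `[-M, M] × [-M, M]`. -/
def clampBox (M : ℝ) (z : ℂ) : ℂ := ⟨max (-M) (min M z.re), max (-M) (min M z.im)⟩

lemma clampBox_of_norm_le {M : ℝ} {z : ℂ} (hz : ‖z‖ ≤ M) : clampBox M z = z := by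
  have h1 := abs_le.1 ((Complex.abs_re_le_norm z).trans hz)
  have h2 := abs_le.1 ((Complex.abs_im_le_norm z).trans hz)
  simp [clampBox, h1, h2]

lemma norm_clampBox_le {M : ℝ} (hM : 0 ≤ M) (z : ℂ) : ‖clampBox M z‖ ≤ 2 * M := by
  refine (Complex.norm_le_abs_re_add_abs_im _).trans ?_
  have h : ∀ x, |max (-M) (min M x)| ≤ M := fun x =>
    abs_le.2 ⟨le_max_left _ _, max_le (by linarith) (min_le_left _ _)⟩
  have := h z.re
  have := h z.im
  simp only [clampBox]
  linarith

lemma norm_clampBox_sub_le (M : ℝ) (z w : ℂ) : ‖clampBox M z - clampBox M w‖ ≤ 2 * ‖z - w‖ := by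
  refine (Complex.norm_le_abs_re_add_abs_im _).trans ?_
  have h : ∀ x y, |max (-M) (min M x) - max (-M) (min M y)| ≤ |x - y| := fun x y => by
    refine (abs_max_sub_max_le_max _ _ _ _).trans ?_
    rw [sub_self, abs_zero, max_eq_right (abs_nonneg _)]
    refine (abs_min_sub_min_le_max _ _ _ _).trans ?_
    rw [sub_self, abs_zero, max_eq_right (abs_nonneg _)]
  have h1 := h z.re w.re
  have h2 := h z.im w.im
  have h3 := Complex.abs_re_le_norm (z - w)
  have h4 := Complex.abs_im_le_norm (z - w)
  simp only [clampBox, Complex.sub_re, Complex.sub_im] at *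
  linarith

/-- A bounded, globally Lipschitz field has solutions on the whole interval. -/
lemma exists_solution_of_lipschitz {ω : ℝ} (hω : 0 < ω) {G : ℝ → ℂ → ℂ} {A L : ℝ}
    (hA : 0 ≤ A) (hL : 0 ≤ L)
    (hlip : ∀ t ∈ Icc 0 ω, ∀ z w, ‖G t z - G t w‖ ≤ L * ‖z - w‖)
    (hbd : ∀ t ∈ Icc 0 ω, ∀ z, ‖G t z‖ ≤ A)
    (hc : ∀ z, ContinuousOn (fun t => G t z) (Icc 0 ω)) (c : ℂ) :
    ∃ z : ℝ → ℂ, z 0 = c ∧ ∀ t ∈ Icc 0 ω, HasDerivWithinAt z (G t (z t)) (Icc 0 ω) t := by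
  have hpl : IsPicardLindelof G (⟨0, le_rfl, hω.le⟩ : Icc 0 ω) c (A * ω).toNNReal 0
      A.toNNReal L.toNNReal := by
    refine ⟨fun t ht => LipschitzOnWith.of_dist_le_mul fun z _ w _ => ?_, fun z _ => hc z,
      fun t ht z _ => ?_, ?_⟩
    · rw [dist_eq_norm, dist_eq_norm, Real.coe_toNNReal _ hL]; exact hlip t ht z w
    · rw [Real.coe_toNNReal _ hA]; exact hbd t ht z
    · rw [Real.coe_toNNReal _ hA, Real.coe_toNNReal _ (by positivity)]
      simp [max_eq_left hω.le]
  obtain ⟨z, h0, hz⟩ := hpl.exists_eq_forall_mem_Icc_hasDerivWithinAt₀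
  exact ⟨z, h0, hz⟩

lemma dist_le_of_lipschitz_field {ω : ℝ} {G : ℝ → ℂ → ℂ} {L ε δ : ℝ} (hL : 1 ≤ L) (hε : 0 ≤ ε)
    (hlip : ∀ t ∈ Ico 0 ω, ∀ z w, ‖G t z - G t w‖ ≤ L * ‖z - w‖) {z w z' w' : ℝ → ℂ}
    (hz : ContinuousOn z (Icc 0 ω)) (hz' : ∀ t ∈ Ico 0 ω, HasDerivWithinAt z (z' t) (Ici t) t)
    (hzG : ∀ t ∈ Ico 0 ω, ‖z' t - G t (z t)‖ ≤ ε)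
    (hw : ContinuousOn w (Icc 0 ω)) (hw' : ∀ t ∈ Ico 0 ω, HasDerivWithinAt w (w' t) (Ici t) t)
    (hwG : ∀ t ∈ Ico 0 ω, w' t = G t (w t)) (h0 : ‖z 0 - w 0‖ ≤ δ) :
    ∀ t ∈ Icc 0 ω, ‖z t - w t‖ ≤ exp (L * ω) * (ε + δ) := by
  intro t ht
  have h1 := dist_le_of_approx_trajectories_ODE_of_mem (v := G) (K := L.toNNReal) (δ := δ) (εf := ε)
    (s := fun _ => univ)
    (fun t ht => LipschitzOnWith.of_dist_le_mul fun z _ w _ => by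
      rw [dist_eq_norm, dist_eq_norm, Real.coe_toNNReal _ (by linarith)]
      exact hlip t ht z w) hz hz'
    (fun t ht => by rw [dist_eq_norm]; exact hzG t ht) (fun _ _ => trivial) hw hw' (εg := 0)
    (fun t ht => by rw [hwG t ht, dist_self]) (fun _ _ => trivial)
    (by rw [dist_eq_norm]; exact h0) t ht
  rw [dist_eq_norm, Real.coe_toNNReal _ (by linarith),
    gronwallBound_of_K_ne_0 (by linarith)] at h1
  refine h1.trans ?_
  simp only [add_zero, sub_zero]
  have hδ : 0 ≤ δ := (norm_nonneg _).trans h0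
  have h2 : exp (L * t) ≤ exp (L * ω) := exp_le_exp.2 (by gcongr; exact ht.2)
  have h3 : ε / L ≤ ε := div_le_self hε hL
  have h4 : 0 < exp (L * t) := exp_pos _
  have h5 : 0 ≤ ε / L := by positivity
  nlinarith

/-- `z` solves `z' = polyField n (p t) z` on `[0, ω]`. -/
def IsPolySol (n : ℕ) (ω : ℝ) (p : ℝ → ℕ → ℝ) (z : ℝ → ℂ) : Prop :=
  ∀ t ∈ Icc 0 ω, HasDerivWithinAt z (polyField n (p t) (z t)) (Icc 0 ω) t

lemma continuousOn_polyField {n : ℕ} {ω : ℝ} {p : ℝ → ℕ → ℝ}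
    (hp : ∀ i < n, ContinuousOn (fun t => p t i) (Icc 0 ω)) (z : ℂ) :
    ContinuousOn (fun t => polyField n (p t) z) (Icc 0 ω) := by
  unfold polyField
  refine continuousOn_const.add (continuousOn_finsetSum _ fun i hi => ?_)
  exact (Complex.continuous_ofReal.comp_continuousOn (hp i (Finset.mem_range.1 hi))).mul
    continuousOn_const

lemma continuousOn_polyDivDiff {n : ℕ} {ω : ℝ} {p : ℝ → ℕ → ℝ}
    (hp : ∀ i < n, ContinuousOn (fun t => p t i) (Icc 0 ω)) {z w : ℝ → ℂ}
    (hz : ContinuousOn z (Icc 0 ω)) (hw : ContinuousOn w (Icc 0 ω)) :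
    ContinuousOn (fun t => polyDivDiff n (p t) (z t) (w t)) (Icc 0 ω) := by
  have h : ∀ k, ContinuousOn (fun t => ∑ j ∈ Finset.range k, z t ^ j * w t ^ (k - 1 - j))
      (Icc 0 ω) := fun k =>
    continuousOn_finsetSum _ fun j _ => (hz.pow j).mul (hw.pow _)
  exact (h n).add (continuousOn_finsetSum _ fun i hi =>
    (Complex.continuous_ofReal.comp_continuousOn (hp i (Finset.mem_range.1 hi))).mul (h i))

lemma eq_mul_exp_of_linear {ω : ℝ} (hω : 0 < ω) {α y : ℝ → ℂ} (hα : ContinuousOn α (Icc 0 ω))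
    (hy : ContinuousOn y (Icc 0 ω))
    (hy' : ∀ t ∈ Ico 0 ω, HasDerivWithinAt y (α t * y t) (Ici t) t) :
    ∀ t ∈ Icc 0 ω, y t = y 0 * Complex.exp (∫ x in (0 : ℝ)..t, α x) := by
  intro t ht
  set β : ℝ → ℂ := IccExtend hω.le ((Icc 0 ω).domRestrict α) with hβ
  have hβc : Continuous β := (continuousOn_iff_continuous_domRestrict.1 hα).Icc_extend'
  have hβα : ∀ t ∈ Icc 0 ω, β t = α t := fun t ht => by rw [hβ, IccExtend_of_mem _ _ ht]; rfl
  have hI : ∀ t, HasDerivAt (fun u => ∫ x in (0 : ℝ)..u, β x) (β t) t := fun t =>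
    (hβc.integral_hasStrictDerivAt 0 t).hasDerivAt
  have hcont : Continuous fun u => ∫ x in (0 : ℝ)..u, β x :=
    continuous_iff_continuousAt.2 fun t => (hI t).continuousAt
  have key := constant_of_has_deriv_right_zero
    (f := fun t => y t * Complex.exp (-∫ x in (0 : ℝ)..t, β x)) (a := 0) (b := ω)
    (hy.mul (Complex.continuous_exp.comp hcont.neg).continuousOn) (fun t ht => by
      refine ((hy' t ht).mul (hI t).neg.cexp.hasDerivWithinAt).congr_deriv ?_
      rw [hβα t ⟨ht.1, ht.2.le⟩]
      ring) t ht
  simp only [intervalIntegral.integral_same, neg_zero, Complex.exp_zero, mul_one] at key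
  have hint : ∫ x in (0 : ℝ)..t, β x = ∫ x in (0 : ℝ)..t, α x :=
    intervalIntegral.integral_congr fun x hx => by
      rw [uIcc_of_le ht.1] at hx
      exact hβα x ⟨hx.1, hx.2.trans ht.2⟩
  rw [hint] at key
  rw [← key, mul_assoc, ← Complex.exp_add, neg_add_cancel, Complex.exp_zero, mul_one]

/-- The difference of two solutions solves a linear equation. -/
lemma IsPolySol.sub_eq {n : ℕ} {ω : ℝ} {p : ℝ → ℕ → ℝ} {z w : ℝ → ℂ} (hω : 0 < ω)
    (hp : ∀ i < n, ContinuousOn (fun t => p t i) (Icc 0 ω)) (hz : IsPolySol n ω p z)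
    (hw : IsPolySol n ω p w) : ∀ t ∈ Icc 0 ω, z t - w t =
      (z 0 - w 0) * Complex.exp (∫ x in (0 : ℝ)..t, polyDivDiff n (p x) (z x) (w x)) := by
  have hz' := isRightSol_of_hasDerivWithinAt hz
  have hw' := isRightSol_of_hasDerivWithinAt hw
  exact eq_mul_exp_of_linear (y := fun t => z t - w t) hω
    (continuousOn_polyDivDiff hp hz'.cont hw'.cont)
    (hz'.cont.sub hw'.cont) fun t ht =>
      ((hz'.deriv t ht).sub (hw'.deriv t ht)).congr_deriv (polyDivDiff_mul n (p t) _ _).symm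

lemma IsPolySol.eq_of_eq {n : ℕ} {ω : ℝ} {p : ℝ → ℕ → ℝ} {z w : ℝ → ℂ} (hω : 0 < ω)
    (hp : ∀ i < n, ContinuousOn (fun t => p t i) (Icc 0 ω)) (hz : IsPolySol n ω p z)
    (hw : IsPolySol n ω p w) (h0 : z 0 = w 0) : ∀ t ∈ Icc 0 ω, z t = w t := by
  intro t ht
  have := hz.sub_eq hω hp hw t ht
  rwa [h0, sub_self, zero_mul, sub_eq_zero] at this

lemma exists_norm_le_of_norm_lt {ω M : ℝ} (hω : 0 < ω) {z : ℝ → ℂ}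
    (hz : ContinuousOn z (Icc 0 ω)) (h : ∀ t ∈ Icc 0 ω, ‖z t‖ < M) :
    ∃ m < M, ∀ t ∈ Icc 0 ω, ‖z t‖ ≤ m := by
  obtain ⟨t, ht, hmax⟩ := isCompact_Icc.exists_isMaxOn ⟨0, le_rfl, hω.le⟩ hz.norm
  exact ⟨‖z t‖, h t ht, fun s hs => hmax hs⟩

/-- The flow of the clamped equation, depending on a parameter. -/
theorem exists_clamped_flow {n : ℕ} {ω B M : ℝ} (hω : 0 < ω) (hB : 0 ≤ B) (hM : 0 ≤ M)
    {P : ℝ → ℝ → ℕ → ℝ}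
    (hPc : ∀ s ∈ Icc (0 : ℝ) 1, ∀ i < n, ContinuousOn (fun t => P s t i) (Icc 0 ω))
    (hPb : ∀ s ∈ Icc (0 : ℝ) 1, ∀ t ∈ Icc 0 ω, ∀ i < n, |P s t i| ≤ B)
    (hPl : ∀ s ∈ Icc (0 : ℝ) 1, ∀ s' ∈ Icc (0 : ℝ) 1, ∀ t ∈ Icc 0 ω, ∀ i < n,
      |P s t i - P s' t i| ≤ 2 * B * |s - s'|) :
    ∃ (Φ : ℝ → ℂ → ℝ → ℂ) (A : ℝ), 0 ≤ A ∧
      (∀ s ∈ Icc (0 : ℝ) 1, ∀ c, Φ s c 0 = c ∧ ContinuousOn (Φ s c) (Icc 0 ω) ∧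
        ((∀ t ∈ Icc 0 ω, ‖Φ s c t‖ ≤ M) → IsPolySol n ω (P s) (Φ s c))) ∧
      (∀ s ∈ Icc (0 : ℝ) 1, ∀ s' ∈ Icc (0 : ℝ) 1, ∀ c c', ∀ t ∈ Icc 0 ω,
        ‖Φ s c t - Φ s' c' t‖ ≤ A * (|s - s'| + ‖c - c'‖)) ∧
      (∀ s ∈ Icc (0 : ℝ) 1, ∀ z, IsPolySol n ω (P s) z → (∀ t ∈ Icc 0 ω, ‖z t‖ ≤ M) →
        ∀ t ∈ Icc 0 ω, Φ s (z 0) t = z t) := by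
  set L := 1 + 2 * lipConst n B (2 * M) with hL
  have hLip := lipConst_nonneg (n := n) hB (show 0 ≤ 2 * M by positivity)
  have hL1 : 1 ≤ L := by rw [hL]; linarith
  set G : ℝ → ℝ → ℂ → ℂ := fun s t z => polyField n (P s t) (clampBox M z) with hG
  have hGlip : ∀ s ∈ Icc (0 : ℝ) 1, ∀ t ∈ Icc 0 ω, ∀ z w, ‖G s t z - G s t w‖ ≤ L * ‖z - w‖ := by
    intro s hs t ht z w
    rw [hG]
    dsimp only
    rw [← polyDivDiff_mul, norm_mul]
    calc _ ≤ lipConst n B (2 * M) * (2 * ‖z - w‖) :=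
          mul_le_mul (norm_polyDivDiff_le (hPb s hs t ht) (norm_clampBox_le hM z)
            (norm_clampBox_le hM w)) (norm_clampBox_sub_le M z w) (norm_nonneg _) hLip
      _ ≤ _ := by rw [hL]; nlinarith [norm_nonneg (z - w)]
  have hsol : ∀ s c, ∃ z : ℝ → ℂ, s ∈ Icc (0 : ℝ) 1 → z 0 = c ∧ ∀ t ∈ Icc 0 ω,
      HasDerivWithinAt z (G s t (z t)) (Icc 0 ω) t := by
    intro s c
    by_cases hs : s ∈ Icc (0 : ℝ) 1
    · obtain ⟨z, hz⟩ := exists_solution_of_lipschitz hω (G := G s)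
        (A := (2 * M) ^ n + B * ∑ i ∈ Finset.range n, (2 * M) ^ i) (L := L)
        (by have : 0 ≤ ∑ i ∈ Finset.range n, (2 * M) ^ i :=
              Finset.sum_nonneg fun i _ => by positivity
            positivity) (by linarith) (hGlip s hs)
        (fun t ht z => norm_polyField_le (hPb s hs t ht) (norm_clampBox_le hM z))
        (fun z => continuousOn_polyField (hPc s hs) _) c
      exact ⟨z, fun _ => hz⟩
    · exact ⟨0, fun h => absurd h hs⟩
  choose Φ hΦ using hsol
  have hcont : ∀ s ∈ Icc (0 : ℝ) 1, ∀ c, ContinuousOn (Φ s c) (Icc 0 ω) := fun s hs c t ht =>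
    ((hΦ s c hs).2 t ht).continuousWithinAt
  have hright : ∀ s ∈ Icc (0 : ℝ) 1, ∀ c, ∀ t ∈ Ico 0 ω,
      HasDerivWithinAt (Φ s c) (G s t (Φ s c t)) (Ici t) t := fun s hs c t ht =>
    (((hΦ s c hs).2 t ⟨ht.1, ht.2.le⟩).mono
      (Icc_subset_Icc_left ht.1)).mono_of_mem_nhdsWithin (Icc_mem_nhdsGE ht.2)
  set S := ∑ i ∈ Finset.range n, (2 * M) ^ i with hS
  have hS0 : 0 ≤ S := Finset.sum_nonneg fun i _ => by positivity
  refine ⟨Φ, exp (L * ω) * (2 * B * S + 1), by positivity, fun s hs c => ⟨(hΦ s c hs).1,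
    hcont s hs c, fun hb t ht => ?_⟩, fun s hs s' hs' c c' t ht => ?_, fun s hs z hz hb t ht => ?_⟩
  · have := (hΦ s c hs).2 t ht
    rw [hG] at this
    dsimp only at this
    rwa [clampBox_of_norm_le (hb t ht)] at this
  · have h1 := dist_le_of_lipschitz_field (G := G s') (ε := 2 * B * |s - s'| * S) (δ := ‖c - c'‖) hL1
      (by positivity) (fun t ht => hGlip s' hs' t ⟨ht.1, ht.2.le⟩) (hcont s hs c) (hright s hs c)
      (fun t ht => norm_polyField_sub_le (hPl s hs s' hs' t ⟨ht.1, ht.2.le⟩)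
        (norm_clampBox_le hM _)) (hcont s' hs' c') (hright s' hs' c') (fun t _ => rfl)
      (by rw [(hΦ s c hs).1, (hΦ s' c' hs').1]) t ht
    refine h1.trans ?_
    rw [mul_assoc (exp (L * ω))]
    refine mul_le_mul_of_nonneg_left ?_ (exp_pos _).le
    have h2 := abs_nonneg (s - s')
    have h3 : 0 ≤ 2 * B * S * ‖c - c'‖ := by positivity
    nlinarith
  · have hz' := isRightSol_of_hasDerivWithinAt hz
    have h1 := dist_le_of_lipschitz_field (G := G s) (ε := 0) (δ := 0) hL1 le_rfl
      (fun t ht => hGlip s hs t ⟨ht.1, ht.2.le⟩) (hcont s hs (z 0)) (hright s hs (z 0))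
      (fun t ht => by simp) hz'.cont hz'.deriv
      (fun t ht => by rw [hG]; dsimp only; rw [clampBox_of_norm_le (hb t ⟨ht.1, ht.2.le⟩)])
      (by rw [(hΦ s (z 0) hs).1]; simp) t ht
    rw [add_zero, mul_zero] at h1
    exact sub_eq_zero.1 (norm_le_zero_iff.1 h1)

lemma hasDerivAt_displacement {n : ℕ} {ω B A M : ℝ} (hω : 0 < ω) {p : ℝ → ℕ → ℝ}
    (hpc : ∀ i < n, ContinuousOn (fun t => p t i) (Icc 0 ω))
    (hpb : ∀ t ∈ Icc 0 ω, ∀ i < n, |p t i| ≤ B) {Φ : ℂ → ℝ → ℂ} (h0 : ∀ c, Φ c 0 = c)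
    (hcont : ∀ c, ContinuousOn (Φ c) (Icc 0 ω))
    (hlip : ∀ c c', ∀ t ∈ Icc 0 ω, ‖Φ c t - Φ c' t‖ ≤ A * ‖c - c'‖)
    (hsol : ∀ c, (∀ t ∈ Icc 0 ω, ‖Φ c t‖ ≤ M) → IsPolySol n ω p (Φ c)) {c : ℂ}
    (hc : ∀ t ∈ Icc 0 ω, ‖Φ c t‖ < M) :
    HasDerivAt (fun c => Φ c ω - c)
      (Complex.exp (∫ t in (0 : ℝ)..ω, polyDivDiff n (p t) (Φ c t) (Φ c t)) - 1) c := by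
  have hA : ∀ c', 0 ≤ A * ‖c' - c‖ := fun c' =>
    (norm_nonneg _).trans (hlip c' c 0 ⟨le_rfl, hω.le⟩)
  have hAt : Tendsto (fun c' => A * ‖c' - c‖) (nhds c) (nhds 0) := by
    have : Continuous fun c' => A * ‖c' - c‖ := by fun_prop
    simpa using this.tendsto c
  have hpt : ∀ t ∈ Icc 0 ω, Tendsto (fun c' => Φ c' t) (nhds c) (nhds (Φ c t)) := by
    intro t ht
    rw [tendsto_iff_norm_sub_tendsto_zero]
    exact squeeze_zero (fun _ => norm_nonneg _) (fun c' => hlip c' c t ht) hAt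
  obtain ⟨m, hm, hcm⟩ := exists_norm_le_of_norm_lt hω (hcont c) hc
  have hnear : ∀ᶠ c' in nhds c, ∀ t ∈ Icc 0 ω, ‖Φ c' t‖ ≤ M := by
    filter_upwards [hAt.eventually (Iio_mem_nhds (sub_pos.2 hm))] with c' hc' t ht
    have h1 := hlip c' c t ht
    have h2 := hcm t ht
    have h3 := norm_le_norm_add_norm_sub' (Φ c' t) (Φ c t)
    have h4 : A * ‖c' - c‖ < M - m := hc'
    linarith
  have hlim : Tendsto (fun c' => ∫ t in (0 : ℝ)..ω, polyDivDiff n (p t) (Φ c' t) (Φ c t)) (nhds c)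
      (nhds (∫ t in (0 : ℝ)..ω, polyDivDiff n (p t) (Φ c t) (Φ c t))) := by
    have hsub : Set.uIoc 0 ω ⊆ Icc 0 ω := by rw [uIoc_of_le hω.le]; exact Ioc_subset_Icc_self
    refine intervalIntegral.tendsto_integral_filter_of_dominated_convergence
      (fun _ => lipConst n B M) (Eventually.of_forall fun c' => ?_) ?_ (by simp) ?_
    · exact ((continuousOn_polyDivDiff hpc (hcont c') (hcont c)).mono hsub).aestronglyMeasurable
        measurableSet_uIoc
    · filter_upwards [hnear] with c' hc'
      refine MeasureTheory.ae_of_all _ fun t ht => ?_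
      exact norm_polyDivDiff_le (hpb t (hsub ht)) (hc' t (hsub ht)) (hc t (hsub ht)).le
    · refine MeasureTheory.ae_of_all _ fun t ht => ?_
      have : Continuous fun z => polyDivDiff n (p t) z (Φ c t) := by
        unfold polyDivDiff
        fun_prop
      exact (this.tendsto _).comp (hpt t (hsub ht))
  rw [hasDerivAt_iff_tendsto_slope]
  have h1 : Tendsto (fun c' => Complex.exp (∫ t in (0 : ℝ)..ω, polyDivDiff n (p t) (Φ c' t) (Φ c t))
      - 1) (nhdsWithin c {c}ᶜ) (nhds (Complex.exp
        (∫ t in (0 : ℝ)..ω, polyDivDiff n (p t) (Φ c t) (Φ c t)) - 1)) :=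
    (((Complex.continuous_exp.tendsto _).comp hlim).sub_const 1).mono_left nhdsWithin_le_nhds
  refine h1.congr' ?_
  filter_upwards [nhdsWithin_le_nhds hnear, self_mem_nhdsWithin] with c' hc' hne
  have h2 := (hsol c' hc').sub_eq hω hpc (hsol c fun t ht => (hc t ht).le) ω ⟨hω.le, le_rfl⟩
  rw [h0, h0] at h2
  have hne' : c' - c ≠ 0 := sub_ne_zero.2 hne
  rw [slope_def_field, eq_div_iff hne']
  linear_combination -h2

/-- The initial values whose trajectories stay in the open disc of radius `M`. -/
def boundedData (ω M : ℝ) (Φ : ℂ → ℝ → ℂ) : Set ℂ := {c | ∀ t ∈ Icc 0 ω, ‖Φ c t‖ < M}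

/-- `Φ` is a flow of `z' = polyField n (p t) z` as long as trajectories stay in the disc of
radius `M`, and all periodic solutions stay in that disc. -/
structure IsLocalFlow (n : ℕ) (ω M : ℝ) (p : ℝ → ℕ → ℝ) (Φ : ℂ → ℝ → ℂ) : Prop where
  start : ∀ c, Φ c 0 = c
  isOpen : IsOpen (boundedData ω M Φ)
  sol : ∀ c ∈ boundedData ω M Φ, IsPolySol n ω p (Φ c)
  deriv : ∀ c ∈ boundedData ω M Φ, HasDerivAt (fun c => Φ c ω - c)
    (Complex.exp (∫ t in (0 : ℝ)..ω, polyDivDiff n (p t) (Φ c t) (Φ c t)) - 1) c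
  periodic : ∀ z, IsPolySol n ω p z → z 0 = z ω → z 0 ∈ boundedData ω M Φ
  finite : {c | c ∈ boundedData ω M Φ ∧ Φ c ω - c = 0}.Finite
  order : ∀ c ∈ boundedData ω M Φ, Φ c ω - c = 0 →
    analyticOrderAt (fun c => Φ c ω - c) c ≠ ⊤

theorem exists_localFlow_homotopy {n : ℕ} (hn : 5 ≤ n) {r B ω e : ℝ} (hr : 0 < r) (hB : 0 ≤ B)
    (hω : 0 < ω) (he : e = 1 ∨ e = -1) {P : ℝ → ℝ → ℕ → ℝ}
    (hPc : ∀ s ∈ Icc (0 : ℝ) 1, ∀ i < n, ContinuousOn (fun t => P s t i) (Icc 0 ω))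
    (hPl : ∀ s ∈ Icc (0 : ℝ) 1, ∀ s' ∈ Icc (0 : ℝ) 1, ∀ t ∈ Icc 0 ω, ∀ i < n,
      |P s t i - P s' t i| ≤ 2 * B * |s - s'|)
    (hadm : ∀ s ∈ Icc (0 : ℝ) 1, ∀ t ∈ Icc 0 ω, Admissible n r B e (P s t)) :
    ∃ (M : ℝ) (Φ : ℝ → ℂ → ℝ → ℂ), (∀ s ∈ Icc (0 : ℝ) 1, IsLocalFlow n ω M (P s) (Φ s)) ∧
      ∑ᶠ a ∈ {c | c ∈ boundedData ω M (Φ 0) ∧ Φ 0 c ω - c = 0},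
        analyticOrderNatAt (fun c => Φ 0 c ω - c) a =
      ∑ᶠ a ∈ {c | c ∈ boundedData ω M (Φ 1) ∧ Φ 1 c ω - c = 0},
        analyticOrderNatAt (fun c => Φ 1 c ω - c) a := by
  obtain ⟨R, hrR, hR⟩ := exists_apriori_bound hn hr hB hω
  have hM : 0 ≤ R + 1 := by linarith
  have hPb : ∀ s ∈ Icc (0 : ℝ) 1, ∀ t ∈ Icc 0 ω, ∀ i < n, |P s t i| ≤ B :=
    fun s hs t ht => (hadm s hs t ht).bound
  obtain ⟨Φ, A, hA, hΦ, hlip, huniq⟩ := exists_clamped_flow hω hB hM hPc hPb hPl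
  have h0 : (0 : ℝ) ∈ Icc 0 ω := ⟨le_rfl, hω.le⟩
  have h1 : ω ∈ Icc 0 ω := ⟨hω.le, le_rfl⟩
  have hsol : ∀ s ∈ Icc (0 : ℝ) 1, ∀ c ∈ boundedData ω (R + 1) (Φ s),
      IsPolySol n ω (P s) (Φ s c) := fun s hs c hc => (hΦ s hs c).2.2 fun t ht => (hc t ht).le
  have hbound : ∀ s ∈ Icc (0 : ℝ) 1, ∀ c ∈ boundedData ω (R + 1) (Φ s), Φ s c ω - c = 0 →
      ∀ t ∈ Icc 0 ω, ‖Φ s c t‖ ≤ R := by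
    intro s hs c hc h
    refine hR e (P s) _ he (hadm s hs) (hsol s hs c hc) ?_
    rw [(hΦ s hs c).1, sub_eq_zero.1 h]
  have hV : ∀ s₀ ∈ Icc (0 : ℝ) 1, ∀ c₀ ∈ boundedData ω (R + 1) (Φ s₀), ∃ δ > 0,
      ∀ s ∈ Icc (0 : ℝ) 1, |s - s₀| < δ → ∀ c, dist c c₀ ≤ δ →
        c ∈ boundedData ω (R + 1) (Φ s) := by
    intro s₀ hs₀ c₀ hc₀
    obtain ⟨m, hm, hmb⟩ := exists_norm_le_of_norm_lt hω (hΦ s₀ hs₀ c₀).2.1 hc₀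
    have hm' : 0 < R + 1 - m := by linarith
    have hd : 0 < 2 * A + 1 := by linarith
    refine ⟨(R + 1 - m) / (2 * A + 1), div_pos hm' hd, fun s hs hss c hc t ht => ?_⟩
    have k1 := hlip s hs s₀ hs₀ c c₀ t ht
    have k2 := hmb t ht
    have k3 := norm_le_norm_add_norm_sub' (Φ s c t) (Φ s₀ c₀ t)
    rw [dist_eq_norm] at hc
    have k4 : A * (|s - s₀| + ‖c - c₀‖) ≤ A * (2 * ((R + 1 - m) / (2 * A + 1))) :=
      mul_le_mul_of_nonneg_left (by linarith) hA
    have k5 : A * (2 * ((R + 1 - m) / (2 * A + 1))) < R + 1 - m := by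
      rw [mul_div_assoc', mul_div_assoc', div_lt_iff₀ hd]
      nlinarith
    linarith
  have hopen : ∀ s ∈ Icc (0 : ℝ) 1, IsOpen (boundedData ω (R + 1) (Φ s)) := by
    intro s hs
    refine Metric.isOpen_iff.2 fun c₀ hc₀ => ?_
    obtain ⟨δ, hδ, h⟩ := hV s hs c₀ hc₀
    exact ⟨δ, hδ, fun c hc => h s hs (by simpa using hδ) c (Metric.mem_ball.1 hc).le⟩
  have hder : ∀ s ∈ Icc (0 : ℝ) 1, ∀ c ∈ boundedData ω (R + 1) (Φ s),
      HasDerivAt (fun c => Φ s c ω - c) (Complex.exp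
        (∫ t in (0 : ℝ)..ω, polyDivDiff n (P s t) (Φ s c t) (Φ s c t)) - 1) c := by
    intro s hs c hc
    refine hasDerivAt_displacement hω (hPc s hs) (hPb s hs) (A := A) (fun c => (hΦ s hs c).1)
      (fun c => (hΦ s hs c).2.1) (fun c c' t ht => ?_) (fun c => (hΦ s hs c).2.2) hc
    simpa using hlip s hs s hs c c' t ht
  have han : ∀ s ∈ Icc (0 : ℝ) 1,
      AnalyticOnNhd ℂ (fun c => Φ s c ω - c) (boundedData ω (R + 1) (Φ s)) := fun s hs =>
    DifferentiableOn.analyticOnNhd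
      (fun c hc => (hder s hs c hc).differentiableAt.differentiableWithinAt) (hopen s hs)
  have hjoint : ∀ t ∈ Icc 0 ω, ContinuousOn (fun x : ℝ × ℂ => Φ x.1 x.2 t)
      (Icc (0 : ℝ) 1 ×ˢ univ) := by
    intro t ht x hx
    refine tendsto_iff_norm_sub_tendsto_zero.2 ?_
    have hlim : Tendsto (fun y : ℝ × ℂ => A * (|y.1 - x.1| + ‖y.2 - x.2‖))
        (nhdsWithin x (Icc (0 : ℝ) 1 ×ˢ univ)) (nhds 0) := by
      have : Continuous fun y : ℝ × ℂ => A * (|y.1 - x.1| + ‖y.2 - x.2‖) := by fun_prop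
      simpa using (this.tendsto x).mono_left nhdsWithin_le_nhds
    refine squeeze_zero' (Eventually.of_forall fun _ => norm_nonneg _) ?_ hlim
    filter_upwards [self_mem_nhdsWithin] with y hy
    exact hlip y.1 hy.1 x.1 hx.1 y.2 x.2 t ht
  have hclosed : IsClosed (Icc (0 : ℝ) 1 ×ˢ (univ : Set ℂ)) := isClosed_Icc.prod isClosed_univ
  have hZ : IsCompact {x : ℝ × ℂ | x.1 ∈ Icc (0 : ℝ) 1 ∧
      x.2 ∈ boundedData ω (R + 1) (Φ x.1) ∧ Φ x.1 x.2 ω - x.2 = 0} := by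
    have heq : {x : ℝ × ℂ | x.1 ∈ Icc (0 : ℝ) 1 ∧
        x.2 ∈ boundedData ω (R + 1) (Φ x.1) ∧ Φ x.1 x.2 ω - x.2 = 0} =
        ((Icc (0 : ℝ) 1 ×ˢ univ) ∩ (fun x : ℝ × ℂ => Φ x.1 x.2 ω - x.2) ⁻¹' {0}) ∩
        ⋂ t ∈ Icc 0 ω, ((Icc (0 : ℝ) 1 ×ˢ univ) ∩
          (fun x : ℝ × ℂ => Φ x.1 x.2 t) ⁻¹' Metric.closedBall 0 R) := by
      ext x
      simp only [mem_inter_iff, mem_preimage, mem_iInter₂, mem_prod, mem_univ, and_true,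
        mem_singleton_iff, mem_closedBall_zero_iff]
      refine ⟨fun hx => ⟨⟨hx.1, hx.2.2⟩, fun t ht =>
        ⟨hx.1, hbound _ hx.1 _ hx.2.1 hx.2.2 t ht⟩⟩, fun hx => ⟨hx.1.1, fun t ht => ?_, hx.1.2⟩⟩
      linarith [(hx.2 t ht).2]
    refine Metric.isCompact_of_isClosed_isBounded ?_ ?_
    · rw [heq]
      refine IsClosed.inter (((hjoint ω h1).sub continuousOn_snd).preimage_isClosed_of_isClosed
        hclosed isClosed_singleton) (isClosed_biInter fun t ht =>
          (hjoint t ht).preimage_isClosed_of_isClosed hclosed Metric.isClosed_closedBall)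
    · refine ((Metric.isBounded_Icc (0 : ℝ) 1).prod
        (Metric.isBounded_closedBall (x := (0 : ℂ)) (r := R))).subset ?_
      rintro x ⟨hx, hxV, hx0⟩
      refine ⟨hx, ?_⟩
      have := hbound _ hx _ hxV hx0 0 h0
      rw [(hΦ _ hx _).1] at this
      simpa using this
  obtain ⟨hfin, hsum⟩ := finsum_zeros_eq_of_homotopy
    (V := fun s => boundedData ω (R + 1) (Φ s)) (q := fun s c => Φ s c ω - c) (A := A) hV han
    (fun s hs s' hs' c => by simpa using hlip s hs s' hs' c c ω h1) hZ
  refine ⟨R + 1, Φ, fun s hs => ?_, hsum⟩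
  refine ⟨fun c => (hΦ s hs c).1, hopen s hs, hsol s hs, hder s hs, fun z hz hz0 t ht => ?_,
    (hfin s hs).1, (hfin s hs).2⟩
  have hzR := hR e (P s) z he (hadm s hs) hz hz0
  rw [huniq s hs z hz (fun t ht => by linarith [hzR t ht]) t ht]
  linarith [hzR t ht]

lemma exists_finset_pow_eq {N : ℕ} (hN : 0 < N) {b : ℂ} (hb : b ≠ 0) :
    ∃ S : Finset ℂ, S.card = N ∧ ∀ z, z ∈ S ↔ z ^ N = b := by
  have hζ := Complex.isPrimitiveRoot_exp N hN.ne'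
  refine ⟨⟨Polynomial.nthRoots N b, hζ.nthRoots_nodup hb⟩, ?_, fun z => ?_⟩
  · rw [Finset.card_mk, hζ.card_nthRoots, if_pos (IsAlgClosed.exists_pow_nat_eq b hN)]
  · rw [Finset.mem_mk, Polynomial.mem_nthRoots hN]

lemma exp_ofReal_ne_one {x : ℝ} (hx : x ≠ 0) : Complex.exp x ≠ 1 := by
  rw [← Complex.ofReal_exp, Ne, Complex.ofReal_eq_one, Real.exp_eq_one_iff]
  exact hx

/-- Coefficients of the autonomous polynomial `z ^ n + a z`. -/
def binomialCoeffs (a : ℝ) (i : ℕ) : ℝ := if i = 1 then a else 0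

lemma polyField_binomialCoeffs {N : ℕ} (hN : 1 ≤ N) (a : ℝ) (z : ℂ) :
    polyField (N + 1) (binomialCoeffs a) z = z * (z ^ N + a) := by
  unfold polyField
  rw [Finset.sum_eq_single 1 (fun i _ hi => by simp [binomialCoeffs, hi])
    (fun h => absurd (Finset.mem_range.2 (by omega)) h)]
  simp only [binomialCoeffs, if_true]
  ring

lemma polyDivDiff_binomialCoeffs {N : ℕ} (hN : 1 ≤ N) (a : ℝ) (z : ℂ) :
    polyDivDiff (N + 1) (binomialCoeffs a) z z = (N + 1) * z ^ N + a := by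
  unfold polyDivDiff
  congr 1
  · rw [Finset.sum_congr rfl (g := fun _ => z ^ N) (fun j hj => by
      rw [← pow_add]; congr 1; have := Finset.mem_range.1 hj; omega)]
    simp
  · rw [Finset.sum_eq_single 1 (fun i _ hi => by simp [binomialCoeffs, hi])
      (fun h => absurd (Finset.mem_range.2 (by omega)) h)]
    simp [binomialCoeffs]

/-- A periodic solution of `z' = z ^ n + a z` is an equilibrium. -/
lemma eq_zero_of_periodic_binomial {N : ℕ} (hN : 1 ≤ N) {a ω : ℝ} (hω : 0 < ω) (ha : a ≠ 0)
    {z : ℝ → ℂ} (hz : IsPolySol (N + 1) ω (fun _ => binomialCoeffs a) z) (hper : z 0 = z ω) :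
    z 0 * (z 0 ^ N + a) = 0 := by
  have hz' := isRightSol_of_hasDerivWithinAt hz
  have hcont : ContinuousOn z (Icc 0 ω) := hz'.cont
  obtain ⟨k, rfl⟩ : ∃ k, N = k + 1 := ⟨N - 1, by omega⟩
  have hexp : ∀ t : ℝ, HasDerivAt (fun t : ℝ => Complex.exp (((k + 1 : ℕ) : ℂ) * a * t))
      (Complex.exp (((k + 1 : ℕ) : ℂ) * a * t) * (((k + 1 : ℕ) : ℂ) * a)) t := fun t => by
    have h := ((hasDerivAt_id' t).ofReal_comp.const_mul (((k + 1 : ℕ) : ℂ) * a)).cexp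
    exact h.congr_deriv (by simp)
  have key := eq_mul_exp_of_linear hω
    (y := fun t => Complex.exp (((k + 1 : ℕ) : ℂ) * a * t) * (z t ^ (k + 1) + a) * z 0 ^ (k + 1) -
      (z 0 ^ (k + 1) + a) * z t ^ (k + 1))
    (α := fun t => ((k + 1 : ℕ) : ℂ) * (z t ^ (k + 1) + a))
    (by fun_prop) (by fun_prop) (fun t ht => by
      have hd := hz'.deriv t ht
      rw [polyField_binomialCoeffs hN] at hd
      have hp := hd.pow (k + 1)
      refine ((((hexp t).hasDerivWithinAt.mul (hp.add_const (a : ℂ))).mul_const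
        (z 0 ^ (k + 1))).sub (hp.const_mul (z 0 ^ (k + 1) + a))).congr_deriv ?_
      simp only [Nat.add_sub_cancel, Pi.pow_apply, pow_succ]
      ring) ω ⟨hω.le, le_rfl⟩
  simp only [Complex.ofReal_zero, mul_zero, Complex.exp_zero, ← hper] at key
  have h0 : (Complex.exp (((k + 1 : ℕ) : ℂ) * a * ω) - 1) *
      (z 0 ^ (k + 1) * (z 0 ^ (k + 1) + a)) = 0 := by
    rw [show ((1 : ℂ) * (z 0 ^ (k + 1) + a) * z 0 ^ (k + 1) -
      (z 0 ^ (k + 1) + a) * z 0 ^ (k + 1)) = 0 by ring, zero_mul] at key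
    linear_combination key
  have hne : Complex.exp (((k + 1 : ℕ) : ℂ) * a * ω) - 1 ≠ 0 := by
    have := exp_ofReal_ne_one (x := ((k + 1 : ℕ) : ℝ) * a * ω) (by positivity)
    push_cast at this ⊢
    exact sub_ne_zero.2 this
  rcases mul_eq_zero.1 ((mul_eq_zero.1 h0).resolve_left hne) with h | h
  · rw [pow_eq_zero_iff (by omega)] at h
    rw [h, zero_mul]
  · rw [h, mul_zero]

lemma isPolySol_const {N : ℕ} (hN : 1 ≤ N) {a ω : ℝ} {c : ℂ} (hc : c * (c ^ N + a) = 0) :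
    IsPolySol (N + 1) ω (fun _ => binomialCoeffs a) (fun _ => c) := fun t _ => by
  rw [polyField_binomialCoeffs hN, hc]
  exact hasDerivWithinAt_const _ _ _

theorem IsLocalFlow.finsum_binomial {N : ℕ} (hN : 1 ≤ N) {a ω M : ℝ} (hω : 0 < ω) (ha : a ≠ 0)
    {Φ : ℂ → ℝ → ℂ} (hΦ : IsLocalFlow (N + 1) ω M (fun _ => binomialCoeffs a) Φ) :
    ∑ᶠ c ∈ {c | c ∈ boundedData ω M Φ ∧ Φ c ω - c = 0},
      analyticOrderNatAt (fun c => Φ c ω - c) c = N + 1 := by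
  have hmem : ∀ c : ℂ, c * (c ^ N + a) = 0 → c ∈ boundedData ω M Φ := fun c hc =>
    hΦ.periodic (fun _ => c) (isPolySol_const hN hc) rfl
  have hconst : ∀ c : ℂ, c * (c ^ N + a) = 0 → ∀ t ∈ Icc 0 ω, Φ c t = c := by
    intro c hc t ht
    have h1 := hΦ.sol c (hmem c hc)
    have h2 := isPolySol_const (ω := ω) hN hc
    have h3 : ∀ i < N + 1, ContinuousOn (fun t : ℝ => (fun _ : ℝ => binomialCoeffs a) t i)
        (Icc 0 ω) :=
      fun i _ => continuousOn_const
    exact IsPolySol.eq_of_eq hω h3 h1 h2 (hΦ.start c) t ht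
  obtain ⟨S, hcard, hS⟩ := exists_finset_pow_eq (N := N) hN
    (b := -(a : ℂ)) (by simpa using ha)
  have h0 : (0 : ℂ) ∉ S := fun h => by
    have := (hS 0).1 h
    rw [zero_pow (by omega)] at this
    exact ha (by simpa using this.symm)
  have hset : {c | c ∈ boundedData ω M Φ ∧ Φ c ω - c = 0} = ((insert 0 S : Finset ℂ) : Set ℂ) := by
    ext c
    have hiff : c * (c ^ N + a) = 0 ↔ c ∈ insert 0 S := by
      rw [mul_eq_zero, Finset.mem_insert, hS, eq_neg_iff_add_eq_zero]
    rw [Finset.mem_coe, ← hiff]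
    constructor
    · rintro ⟨hc, hq⟩
      have := eq_zero_of_periodic_binomial hN hω ha (hΦ.sol c hc)
        (by rw [hΦ.start, sub_eq_zero.1 hq])
      rwa [hΦ.start] at this
    · intro hc
      exact ⟨hmem c hc, sub_eq_zero.2 (hconst c hc ω ⟨hω.le, le_rfl⟩)⟩
  have hone : ∀ c ∈ insert 0 S, analyticOrderNatAt (fun c => Φ c ω - c) c = 1 := by
    intro c hcS
    have hc : c ∈ {c | c ∈ boundedData ω M Φ ∧ Φ c ω - c = 0} := by
      rw [hset]; exact hcS
    have hc0 : c * (c ^ N + a) = 0 := by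
      rw [mul_eq_zero]
      exact (Finset.mem_insert.1 hcS).imp id fun h => by rw [(hS c).1 h, neg_add_cancel]
    have han : AnalyticAt ℂ (fun c => Φ c ω - c) c :=
      DifferentiableOn.analyticAt
        (fun c hc => (hΦ.deriv c hc).differentiableAt.differentiableWithinAt)
        (hΦ.isOpen.mem_nhds hc.1)
    have hint : ∫ t in (0 : ℝ)..ω, polyDivDiff (N + 1) (binomialCoeffs a) (Φ c t) (Φ c t) =
        ω * ((N + 1) * c ^ N + a) := by
      rw [intervalIntegral.integral_congr (g := fun _ => ((N + 1) * c ^ N + a : ℂ)) fun t ht => ?_]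
      · rw [intervalIntegral.integral_const, sub_zero, Complex.real_smul]
      · rw [uIcc_of_le hω.le] at ht
        dsimp only
        rw [hconst c hc0 t ht, polyDivDiff_binomialCoeffs hN]
    have hne : _root_.deriv (fun c => Φ c ω - c) c ≠ 0 := by
      rw [(hΦ.deriv c hc.1).deriv, hint, sub_ne_zero]
      rcases Finset.mem_insert.1 hcS with h | h
      · have := exp_ofReal_ne_one (x := ω * a) (mul_ne_zero hω.ne' ha)
        rw [h, zero_pow (by omega)]
        simpa using this
      · have := exp_ofReal_ne_one (x := ω * (-(N * a)))
          (mul_ne_zero hω.ne' (neg_ne_zero.2 (mul_ne_zero (Nat.cast_ne_zero.2 (by omega)) ha)))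
        rw [(hS c).1 h]
        convert this using 2
        push_cast
        ring
    have := han.analyticOrderAt_eq_one_of_zero_deriv_ne_zero hc.2 hne
    rw [analyticOrderNatAt, this, ENat.toNat_one]
  rw [hset, finsum_mem_coe_finset, Finset.sum_congr rfl hone, Finset.sum_const,
    Finset.card_insert_of_notMem h0, hcard]
  simp

lemma sum_le_card_mul_div {S : Finset ℕ} {f : ℕ → ℝ} {m W : ℝ} (hm : 0 < m)
    (h : ∀ i ∈ S, f i * m ≤ W) : ∑ i ∈ S, f i ≤ S.card * (W / m) := by
  rw [← nsmul_eq_mul]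
  exact Finset.sum_le_card_nsmul _ _ _ fun i hi => (le_div_iff₀ hm).2 (h i hi)

lemma admissible_of_coefficient_bounds {n : ℕ} (hn : 5 ≤ n) {r B e W : ℝ} {p : ℕ → ℝ}
    (he : e * p 1 = |p 1|) (hB : ∀ i < n, |p i| ≤ B) (h0 : |p 0| < r ^ n)
    (hneg : p (n - 2) ≤ 0)
    (hW : W = (r ^ n - p (n - 2) * r ^ (n - 2) - |p 0|) * sin (π / ((n : ℝ) - 2)))
    (ha : ∀ i < n, i ≠ 0 → i ≠ 1 → i ≠ n - 2 → |p i| * r ^ i * ((n : ℝ) - 4) ≤ W)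
    (hb : r ^ n + |p 0| - p (n - 2) * r ^ (n - 2) + ((n : ℝ) - 3) * (W / ((n : ℝ) - 4)) ≤
      |p 1| * r) : Admissible n r B e p := by
  have hn' : (5 : ℝ) ≤ n := by exact_mod_cast hn
  have hm : 0 < (n : ℝ) - 4 := by linarith
  refine ⟨hB, h0, hneg, ?_, ?_⟩
  · rw [← hW]
    have := sum_le_card_mul_div (S := Finset.Ico 2 (n - 2)) (f := fun i => |p i| * r ^ i)
      (W := W) hm fun i hi => by
        have := Finset.mem_Ico.1 hi
        exact ha i (by omega) (by omega) (by omega) (by omega)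
    rw [Nat.card_Ico, show n - 2 - 2 = n - 4 by omega, Nat.cast_sub (by omega)] at this
    push_cast at this
    rwa [mul_div_cancel₀ _ hm.ne'] at this
  · have m0 : 0 ∈ (Finset.range n).erase 1 := by simp; omega
    have m2 : n - 2 ∈ ((Finset.range n).erase 1).erase 0 := by simp; omega
    rw [← Finset.add_sum_erase _ _ m0, ← Finset.add_sum_erase _ _ m2, he]
    have := sum_le_card_mul_div (S := (((Finset.range n).erase 1).erase 0).erase (n - 2))
      (f := fun i => |p i| * r ^ i) (W := W) hm fun i hi => by
        simp only [Finset.mem_erase, Finset.mem_range] at hi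
        exact ha i hi.2.2.2 hi.2.1 hi.2.2.1 hi.1
    rw [Finset.card_erase_of_mem m2, Finset.card_erase_of_mem m0,
      Finset.card_erase_of_mem (Finset.mem_range.2 (by omega)), Finset.card_range,
      show n - 1 - 1 - 1 = n - 3 by omega, Nat.cast_sub (by omega)] at this
    push_cast at this
    rw [abs_of_nonpos hneg, pow_zero]
    linarith

lemma Admissible.homotopy {n : ℕ} (hn : 5 ≤ n) {r B e : ℝ} (hr : 0 < r) (he : e = 1 ∨ e = -1)
    (hrB : r ^ (n - 1) ≤ B) {p : ℕ → ℝ} (hp : Admissible n r B e p) {s : ℝ}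
    (hs : s ∈ Icc (0 : ℝ) 1) : Admissible n r B e
      (fun i => s * p i + (1 - s) * binomialCoeffs (e * r ^ (n - 1)) i) := by
  have hs1 : 0 ≤ 1 - s := by linarith [hs.2]
  have hn' : (5 : ℝ) ≤ n := by exact_mod_cast hn
  have hsin : 0 ≤ sin (π / ((n : ℝ) - 2)) :=
    sin_nonneg_of_nonneg_of_le_pi (by have := pi_pos; have : 0 < (n : ℝ) - 2 := by linarith
                                      positivity)
      (div_le_self pi_pos.le (by linarith))
  have hne : ∀ i, i ≠ 1 → s * p i + (1 - s) * binomialCoeffs (e * r ^ (n - 1)) i = s * p i :=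
    fun i hi => by simp [binomialCoeffs, hi]
  have habs : ∀ i, i ≠ 1 → |s * p i + (1 - s) * binomialCoeffs (e * r ^ (n - 1)) i| = s * |p i| :=
    fun i hi => by rw [hne i hi, abs_mul, abs_of_nonneg hs.1]
  have hrn : 0 < r ^ n := by positivity
  have hsum : ∀ S : Finset ℕ, 1 ∉ S →
      ∑ i ∈ S, |s * p i + (1 - s) * binomialCoeffs (e * r ^ (n - 1)) i| * r ^ i =
        s * ∑ i ∈ S, |p i| * r ^ i := fun S hS => by
    rw [Finset.mul_sum]
    refine Finset.sum_congr rfl fun i hi => ?_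
    rw [habs i fun h => hS (h ▸ hi), mul_assoc]
  refine ⟨fun i hi => ?_, ?_, ?_, ?_, ?_⟩
  · have h1 : |binomialCoeffs (e * r ^ (n - 1)) i| ≤ B := by
      refine le_trans ?_ hrB
      unfold binomialCoeffs
      split_ifs
      · rcases he with rfl | rfl <;> simp [abs_of_pos hr]
      · simpa using by positivity
    refine (abs_add_le _ _).trans ?_
    rw [abs_mul, abs_mul, abs_of_nonneg hs.1, abs_of_nonneg hs1]
    nlinarith [hp.bound i hi, hs.1]
  · rw [habs 0 (by omega)]
    nlinarith [hp.zero_lt, hs.2, abs_nonneg (p 0)]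
  · rw [hne _ (by omega)]
    exact mul_nonpos_of_nonneg_of_nonpos hs.1 hp.nonpos
  · rw [hsum _ (by simp), habs 0 (by omega), hne _ (by omega)]
    have h1 := mul_le_mul_of_nonneg_left hp.middle hs.1
    have h2 : 0 ≤ (1 - s) * r ^ n * sin (π / ((n : ℝ) - 2)) := by positivity
    linarith
  · rw [hsum _ (by simp)]
    have h1 := mul_le_mul_of_nonneg_left hp.linear hs.1
    have h2 : e * e = 1 := by rcases he with rfl | rfl <;> norm_num
    have h3 : r ^ n = r ^ (n - 1) * r := by rw [← pow_succ]; congr 1; omega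
    simp only [binomialCoeffs, if_true]
    have h4 : e * (s * p 1 + (1 - s) * (e * r ^ (n - 1))) * r =
        s * (e * p 1 * r) + (1 - s) * r ^ n := by
      rw [h3]
      linear_combination (1 - s) * r ^ (n - 1) * r * h2
    rw [h4]
    linarith

lemma exists_sign_of_continuousOn {ω : ℝ} (hω : 0 < ω) {f : ℝ → ℝ} (hf : ContinuousOn f (Icc 0 ω))
    (h : ∀ t ∈ Icc 0 ω, f t ≠ 0) :
    ∃ e : ℝ, (e = 1 ∨ e = -1) ∧ ∀ t ∈ Icc 0 ω, e * f t = |f t| := by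
  have key : ∀ a ∈ Icc 0 ω, ∀ b ∈ Icc 0 ω, 0 ≤ f a → 0 ≤ f b := by
    intro a ha b hb hfa
    by_contra hfb
    obtain ⟨t, ht, h0⟩ := isPreconnected_Icc.intermediate_value hb ha hf ⟨(not_le.1 hfb).le, hfa⟩
    exact h t ht h0
  have h0 : (0 : ℝ) ∈ Icc 0 ω := ⟨le_rfl, hω.le⟩
  by_cases hpos : 0 ≤ f 0
  · exact ⟨1, Or.inl rfl, fun t ht => by rw [one_mul, abs_of_nonneg (key 0 h0 t ht hpos)]⟩
  · refine ⟨-1, Or.inr rfl, fun t ht => ?_⟩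
    have : f t < 0 := not_le.1 fun h => hpos (key t ht 0 h0 h)
    rw [abs_of_neg this, neg_one_mul]

/-- The coefficients indexed by natural numbers. -/
def natCoeffs {n : ℕ} (P : Fin n → ℝ → ℝ) (t : ℝ) (i : ℕ) : ℝ :=
  if h : i < n then P ⟨i, h⟩ t else 0

lemma natCoeffs_of_lt {n : ℕ} (P : Fin n → ℝ → ℝ) (t : ℝ) {i : ℕ} (h : i < n) :
    natCoeffs P t i = P ⟨i, h⟩ t := dif_pos h

lemma isSolC_iff_isPolySol {n : ℕ} {ω : ℝ} {P : Fin n → ℝ → ℝ} {z : ℝ → ℂ} :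
    IsSolC n ω P z ↔ IsPolySol n ω (natCoeffs P) z := by
  have h : ∀ t w, rhsC n P t w = polyField n (natCoeffs P t) w := fun t w => by
    unfold rhsC polyField
    rw [Finset.sum_range]
    simp only [natCoeffs_of_lt P t (Fin.is_lt _)]
  simp only [IsSolC, IsPolySol, h]

lemma hasZeroOfOrder_analyticOrderNatAt {f g : ℂ → ℂ} {c : ℂ} (hf : AnalyticAt ℂ f c)
    (htop : analyticOrderAt f c ≠ ⊤) (hg : g =ᶠ[nhds c] f) :
    HasZeroOfOrder g c (analyticOrderNatAt f c) := by
  obtain ⟨u, hu, hu0, h⟩ := hf.analyticOrderAt_ne_top.1 htop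
  refine ⟨u, hu, hu0, ?_⟩
  filter_upwards [h, hg] with w hw hgw
  rw [hgw, hw, smul_eq_mul]

theorem exists_zeros_of_admissible {n : ℕ} (hn : 5 ≤ n) {ω : ℝ} (hω : 0 < ω)
    (P : Fin n → ℝ → ℝ) (hP : ∀ i, ContinuousOn (P i) (Icc 0 ω)) {r B e : ℝ} (hr : 0 < r)
    (hB : 0 ≤ B) (hrB : r ^ (n - 1) ≤ B) (he : e = 1 ∨ e = -1)
    (hadm : ∀ t ∈ Icc 0 ω, Admissible n r B e (natCoeffs P t))
    (Q : Set ℂ) (hQ : ∀ c, c ∈ Q ↔ ∃ z : ℝ → ℂ, IsSolC n ω P z ∧ z 0 = c) (q : ℂ → ℂ)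
    (hq : ∀ (c : ℂ) (z : ℝ → ℂ), IsSolC n ω P z → z 0 = c → q c = z ω - c) :
    ∃ (S : Finset ℂ) (mult : ℂ → ℕ), (↑S : Set ℂ) ⊆ Q ∧ (∀ c ∈ Q, (q c = 0 ↔ c ∈ S)) ∧
      (∀ c ∈ S, 1 ≤ mult c ∧ HasZeroOfOrder q c (mult c)) ∧ ∑ c ∈ S, mult c = n := by
  set p : ℝ → ℝ → ℕ → ℝ := fun s t i =>
    s * natCoeffs P t i + (1 - s) * binomialCoeffs (e * r ^ (n - 1)) i with hp
  have hp0 : p 0 = fun _ => binomialCoeffs (e * r ^ (n - 1)) := by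
    ext t i
    simp [hp]
  have hp1 : p 1 = natCoeffs P := by
    ext t i
    simp [hp]
  have hpc : ∀ i < n, ContinuousOn (fun t => natCoeffs P t i) (Icc 0 ω) := fun i hi => by
    simp only [natCoeffs_of_lt P _ hi]
    exact hP _
  have hpa : ∀ s ∈ Icc (0 : ℝ) 1, ∀ t ∈ Icc 0 ω, Admissible n r B e (p s t) := fun s hs t ht =>
    (hadm t ht).homotopy hn hr he hrB hs
  have h01 : (0 : ℝ) ∈ Icc (0 : ℝ) 1 := ⟨le_rfl, zero_le_one⟩
  have h11 : (1 : ℝ) ∈ Icc (0 : ℝ) 1 := ⟨zero_le_one, le_rfl⟩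
  obtain ⟨M, Φ, hΦ, hsum⟩ := exists_localFlow_homotopy hn hr hB hω he (P := p)
    (fun s hs i hi => ((hpc i hi).const_mul s).add continuousOn_const)
    (fun s hs s' hs' t ht i hi => by
      have h1 := (hpa 1 h11 t ht).bound i hi
      have h2 := (hpa 0 h01 t ht).bound i hi
      rw [hp1] at h1
      rw [hp0] at h2
      rw [show p s t i - p s' t i =
        (natCoeffs P t i - binomialCoeffs (e * r ^ (n - 1)) i) * (s - s') by simp only [hp]; ring,
        abs_mul]
      refine mul_le_mul_of_nonneg_right ?_ (abs_nonneg _)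
      linarith [abs_sub (natCoeffs P t i) (binomialCoeffs (e * r ^ (n - 1)) i)])
    hpa
  have hΦ0 := hΦ 0 h01
  have hΦ1 := hΦ 1 h11
  rw [hp0] at hΦ0
  rw [hp1] at hΦ1
  obtain ⟨N, rfl⟩ : ∃ N, n = N + 1 := ⟨n - 1, by omega⟩
  have he0 : e ≠ 0 := by rcases he with rfl | rfl <;> norm_num
  have hcount := hΦ0.finsum_binomial (by omega) hω (mul_ne_zero he0 (pow_pos hr _).ne')
  rw [hsum, finsum_mem_eq_finite_toFinset_sum _ hΦ1.finite] at hcount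
  have hqΦ : ∀ c ∈ boundedData ω M (Φ 1), q c = Φ 1 c ω - c := fun c hc =>
    hq c _ (isSolC_iff_isPolySol.2 (hΦ1.sol c hc)) (hΦ1.start c)
  refine ⟨hΦ1.finite.toFinset, _, fun c hc => ?_, fun c hc => ?_, fun c hc => ?_, hcount⟩
  · rw [Finset.mem_coe, Finite.mem_toFinset] at hc
    exact (hQ c).2 ⟨_, isSolC_iff_isPolySol.2 (hΦ1.sol c hc.1), hΦ1.start c⟩
  · rw [Finite.mem_toFinset]
    refine ⟨fun h0 => ?_, fun h => (hqΦ c h.1).trans h.2⟩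
    obtain ⟨z, hz, rfl⟩ := (hQ c).1 hc
    have h1 := hq _ z hz rfl
    have hmem := hΦ1.periodic z (isSolC_iff_isPolySol.1 hz) (by
      rw [h0, eq_comm, sub_eq_zero] at h1
      exact h1.symm)
    exact ⟨hmem, (hqΦ _ hmem).symm.trans h0⟩
  · rw [Finite.mem_toFinset] at hc
    have han : AnalyticAt ℂ (fun c => Φ 1 c ω - c) c := DifferentiableOn.analyticAt
      (fun c hc => (hΦ1.deriv c hc).differentiableAt.differentiableWithinAt)
      (hΦ1.isOpen.mem_nhds hc.1)
    have htop := hΦ1.order c hc.1 hc.2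
    refine ⟨Nat.one_le_iff_ne_zero.2 fun h => ?_, hasZeroOfOrder_analyticOrderNatAt han htop ?_⟩
    · refine han.analyticOrderAt_ne_zero.2 hc.2 ?_
      rw [← Nat.cast_analyticOrderNatAt htop, h, Nat.cast_zero]
    · filter_upwards [hΦ1.isOpen.mem_nhds hc.1] with w hw
      exact hqΦ w hw

/-- Theorem 1.2: under the stated bounds on the coefficients (with `P_{n-2} ≤ 0`),
equation (1.1) has exactly `n` complex periodic solutions counted with multiplicity. -/
theorem theorem_1_2_complex_count
    {n : ℕ} (hn : 5 ≤ n) {ω : ℝ} (hω : 0 < ω)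
    (P : Fin n → ℝ → ℝ) (hP : ∀ i, ContinuousOn (P i) (Icc 0 ω))
    (K : ℝ) (hK : ∀ t ∈ Icc (0:ℝ) ω, |P ⟨0, by omega⟩ t| < K)
    (hneg : ∀ t ∈ Icc (0:ℝ) ω, P ⟨n-2, by omega⟩ t ≤ 0)
    (ha : ∀ t ∈ Icc (0:ℝ) ω, ∀ i : Fin n, (i:ℕ) ≠ 0 → (i:ℕ) ≠ 1 → (i:ℕ) ≠ n - 2 →
      |P i t| ≤ (K - K ^ (((n:ℝ) - 2) / (n:ℝ)) * P ⟨n-2, by omega⟩ t - |P ⟨0, by omega⟩ t|) *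
          sin (π / ((n:ℝ) - 2)) / (((n:ℝ) - 4) * K ^ (((i:ℕ):ℝ) / (n:ℝ))))
    (hb : ∀ t ∈ Icc (0:ℝ) ω,
      (K + |P ⟨0, by omega⟩ t| - K ^ (((n:ℝ) - 2) / (n:ℝ)) * P ⟨n-2, by omega⟩ t +
          (((n:ℝ) - 3) / ((n:ℝ) - 4)) *
            (K - K ^ (((n:ℝ) - 2) / (n:ℝ)) * P ⟨n-2, by omega⟩ t - |P ⟨0, by omega⟩ t|) *
            sin (π / ((n:ℝ) - 2)))
        / K ^ ((1:ℝ) / (n:ℝ)) ≤ |P ⟨1, by omega⟩ t|)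
    -- `Q` is the set of initial values whose solution exists on all of `[0, ω]`
    (Q : Set ℂ) (hQ : ∀ c, c ∈ Q ↔ ∃ z : ℝ → ℂ, IsSolC n ω P z ∧ z 0 = c)
    -- `q` is the displacement function
    (q : ℂ → ℂ)
    (hq : ∀ (c : ℂ) (z : ℝ → ℂ), IsSolC n ω P z → z 0 = c → q c = z ω - c) :
    ∃ (S : Finset ℂ) (mult : ℂ → ℕ),
      (↑S : Set ℂ) ⊆ Q ∧
      (∀ c ∈ Q, (q c = 0 ↔ c ∈ S)) ∧
      (∀ c ∈ S, 1 ≤ mult c ∧ HasZeroOfOrder q c (mult c)) ∧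
      ∑ c ∈ S, mult c = n := by
  have hn' : (5 : ℝ) ≤ n := by exact_mod_cast hn
  have hn0 : (n : ℝ) ≠ 0 := by positivity
  have hm : 0 < (n : ℝ) - 4 := by linarith
  have h0ω : (0 : ℝ) ∈ Icc 0 ω := ⟨le_rfl, hω.le⟩
  have hK0 : 0 < K := (abs_nonneg _).trans_lt (hK 0 h0ω)
  set r := K ^ ((1 : ℝ) / (n : ℝ)) with hr
  have hr0 : 0 < r := rpow_pos_of_pos hK0 _
  have hpow : ∀ i : ℕ, K ^ ((i : ℝ) / (n : ℝ)) = r ^ i := fun i => by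
    rw [hr, ← rpow_natCast, ← rpow_mul hK0.le]
    congr 1
    ring
  have hKn : K = r ^ n := by rw [← hpow, div_self hn0, rpow_one]
  have hpow2 : K ^ (((n : ℝ) - 2) / (n : ℝ)) = r ^ (n - 2) := by
    rw [← hpow, Nat.cast_sub (by omega)]
    norm_num
  have hsin : 0 < sin (π / ((n : ℝ) - 2)) := by
    have h3 : (0 : ℝ) < n - 2 := by linarith
    refine sin_pos_of_pos_of_lt_pi (div_pos pi_pos h3) ?_
    exact div_lt_self pi_pos (by linarith)
  set W : ℝ → ℝ := fun t => (r ^ n - P ⟨n - 2, by omega⟩ t * r ^ (n - 2) -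
    |P ⟨0, by omega⟩ t|) * sin (π / ((n : ℝ) - 2)) with hW
  have hW0 : ∀ t ∈ Icc 0 ω, 0 ≤ W t := fun t ht => by
    have h1 := hK t ht
    have h2 := mul_nonneg (neg_nonneg.2 (hneg t ht)) (pow_pos hr0 (n - 2)).le
    refine mul_nonneg ?_ hsin.le
    rw [hKn] at h1
    linarith
  have hb' : ∀ t ∈ Icc 0 ω, r ^ n + |P ⟨0, by omega⟩ t| - P ⟨n - 2, by omega⟩ t * r ^ (n - 2) +
      ((n : ℝ) - 3) * (W t / ((n : ℝ) - 4)) ≤ |P ⟨1, by omega⟩ t| * r := fun t ht => by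
    have := (div_le_iff₀ hr0).1 (hb t ht)
    rw [hpow2] at this
    refine le_trans (le_of_eq ?_) this
    rw [hW, ← hKn]
    ring
  obtain ⟨e, he, hes⟩ := exists_sign_of_continuousOn hω (hP ⟨1, by omega⟩) fun t ht h => by
    have h1 := hb' t ht
    have h2 := mul_nonneg (neg_nonneg.2 (hneg t ht)) (pow_pos hr0 (n - 2)).le
    have h3 : 0 ≤ ((n : ℝ) - 3) * (W t / ((n : ℝ) - 4)) :=
      mul_nonneg (by linarith) (div_nonneg (hW0 t ht) hm.le)
    rw [h, abs_zero, zero_mul] at h1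
    linarith [pow_pos hr0 n, abs_nonneg (P ⟨0, by omega⟩ t)]
  choose C hC using fun i => isCompact_Icc.exists_bound_of_continuousOn (hP i)
  have hC0 : ∀ i, 0 ≤ C i := fun i => (norm_nonneg _).trans (hC i 0 h0ω)
  have hCs : 0 ≤ ∑ i, C i := Finset.sum_nonneg fun i _ => hC0 i
  have hrn := pow_pos hr0 (n - 1)
  refine exists_zeros_of_admissible hn hω P hP (r := r) (B := ∑ i, C i + r ^ (n - 1)) (e := e) hr0
    (by linarith) (by linarith) he (fun t ht => ?_) Q hQ q hq
  refine admissible_of_coefficient_bounds hn (W := W t) ?_ (fun i hi => ?_) ?_ ?_ ?_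
    (fun i hi h0 h1 h2 => ?_) ?_
  · rw [natCoeffs_of_lt P t (by omega : 1 < n)]
    exact hes t ht
  · rw [natCoeffs_of_lt P t hi]
    have h1 := hC ⟨i, hi⟩ t ht
    have h2 := Finset.single_le_sum (f := C) (fun i _ => hC0 i) (Finset.mem_univ ⟨i, hi⟩)
    rw [norm_eq_abs] at h1
    linarith
  · rw [natCoeffs_of_lt P t (by omega : 0 < n), ← hKn]
    exact hK t ht
  · rw [natCoeffs_of_lt P t (by omega : n - 2 < n)]
    exact hneg t ht
  · rw [natCoeffs_of_lt P t (by omega : 0 < n), natCoeffs_of_lt P t (by omega : n - 2 < n)]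
  · rw [natCoeffs_of_lt P t hi]
    have := ha t ht ⟨i, hi⟩ h0 h1 h2
    rw [hpow, hpow2, le_div_iff₀ (by positivity)] at this
    refine (le_of_eq ?_).trans (this.trans (le_of_eq ?_))
    · ring
    · rw [hW, ← hKn]
      ring
  · rw [natCoeffs_of_lt P t (by omega : 0 < n), natCoeffs_of_lt P t (by omega : n - 2 < n),
      natCoeffs_of_lt P t (by omega : 1 < n)]
    exact hb' t ht
end
end

section
/- Let n ≥ 2. Suppose that for all t ∈ [0,ω]: |P_i(t)| < n/(n−1)^2 for all 1 ≤ i ≤ n−1, and |P_0(t)| > (2n−1)/(n−1). Then equation (1.1) has at most one positive real periodic solution and at most one negative real periodic solution. -/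
open Set Real Filter

noncomputable section

/-- Right-hand side of the real equation (2.1):
`x^n + P_{n-1}(t) x^{n-1} + ⋯ + P_1(t) x + P_0(t)`. -/
def fR (n : ℕ) (P : Fin n → ℝ → ℝ) (x t : ℝ) : ℝ :=
  x ^ n + ∑ i : Fin n, P i t * x ^ (i : ℕ)

/-- `x` is a real periodic solution of (1.1): it solves the equation on all of
`[0, ω]` and satisfies `x 0 = x ω`. -/
def IsPeriodicSolR (n : ℕ) (ω : ℝ) (P : Fin n → ℝ → ℝ) (x : ℝ → ℝ) : Prop :=
  (∀ t ∈ Icc (0:ℝ) ω, HasDerivWithinAt x (fR n P (x t) t) (Icc (0:ℝ) ω) t) ∧ x 0 = x ω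

/-- A periodic differentiable function attains its maximum at two (possibly equal) points where the
one-sided derivatives do not have the same strict sign. -/
lemma exists_max_mul_deriv_nonpos {ω : ℝ} (hω : 0 < ω) {d d' : ℝ → ℝ}
    (hd : ∀ t ∈ Icc (0 : ℝ) ω, HasDerivWithinAt d (d' t) (Icc (0 : ℝ) ω) t) (hper : d 0 = d ω) :
    ∃ s ∈ Icc (0 : ℝ) ω, ∃ r ∈ Icc (0 : ℝ) ω, (∀ t ∈ Icc (0 : ℝ) ω, d t ≤ d s) ∧ d r = d s ∧
      d' s * d' r ≤ 0 := by
  have h0 : (0 : ℝ) ∈ Icc (0 : ℝ) ω := left_mem_Icc.2 hω.le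
  have h1 : ω ∈ Icc (0 : ℝ) ω := right_mem_Icc.2 hω.le
  obtain ⟨s, hs, hmax⟩ := isCompact_Icc.exists_isMaxOn ⟨0, h0⟩
    (fun t ht => (hd t ht).continuousWithinAt)
  by_cases hint : s ∈ Ioo 0 ω
  · have hnhds := Icc_mem_nhds hint.1 hint.2
    have hzero := (hmax.isLocalMax hnhds).hasDerivAt_eq_zero ((hd s hs).hasDerivAt hnhds)
    exact ⟨s, hs, s, hs, hmax, rfl, by simp [hzero]⟩
  · have hs0 : d s = d 0 := by
      rcases hs.1.eq_or_lt with h | h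
      · rw [← h]
      · rcases hs.2.eq_or_lt with h' | h'
        · rw [h', hper]
        · exact absurd ⟨h, h'⟩ hint
    have hm : ∀ t ∈ Icc (0 : ℝ) ω, d t ≤ d 0 := fun t ht => hs0 ▸ hmax ht
    have hleft : d' 0 ≤ 0 := by
      have h := hasDerivWithinAt_iff_tendsto_slope.1 (hd 0 h0)
      have : (nhdsWithin (0 : ℝ) (Icc 0 ω \ {0})).NeBot := by
        rw [Icc_sdiff_left]
        exact left_nhdsWithin_Ioc_neBot hω
      refine le_of_tendsto h ?_
      filter_upwards [self_mem_nhdsWithin] with t ht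
      rw [slope_def_field]
      exact div_nonpos_of_nonpos_of_nonneg (sub_nonpos.2 (hm t ht.1)) (sub_nonneg.2 ht.1.1)
    have hright : 0 ≤ d' ω := by
      have h := hasDerivWithinAt_iff_tendsto_slope.1 (hd ω h1)
      have : (nhdsWithin ω (Icc 0 ω \ {ω})).NeBot := by
        rw [Icc_sdiff_right]
        exact right_nhdsWithin_Ico_neBot hω
      refine ge_of_tendsto h ?_
      filter_upwards [self_mem_nhdsWithin] with t ht
      rw [slope_def_field]
      exact div_nonneg_of_nonpos (sub_nonpos.2 (hper ▸ hm t ht.1)) (sub_nonpos.2 ht.1.2)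
    exact ⟨0, h0, ω, h1, hm, hper.symm, mul_nonpos_of_nonpos_of_nonneg hleft hright⟩

/-- A monic real polynomial of degree `n` whose non-constant lower coefficients are at most
`n / (n - 1) ^ 2` in absolute value is strictly increasing on `[1, ∞)`. -/
lemma strictMonoOn_monic {n : ℕ} (hn : 2 ≤ n) (a : Fin n → ℝ)
    (ha : ∀ i : Fin n, 1 ≤ (i : ℕ) → |a i| ≤ (n : ℝ) / ((n : ℝ) - 1) ^ 2) :
    StrictMonoOn (fun x : ℝ => x ^ n + ∑ i : Fin n, a i * x ^ (i : ℕ)) (Ici 1) := by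
  have hderiv (x : ℝ) : HasDerivAt (fun x : ℝ => x ^ n + ∑ i : Fin n, a i * x ^ (i : ℕ))
      ((n : ℝ) * x ^ (n - 1) + ∑ i : Fin n, a i * ((i : ℕ) * x ^ ((i : ℕ) - 1))) x :=
    (hasDerivAt_pow n x).add
      (HasDerivAt.fun_sum fun i _ => (hasDerivAt_pow (i : ℕ) x).const_mul (a i))
  refine strictMonoOn_of_deriv_pos (convex_Ici 1) (by fun_prop) fun x hx => ?_
  rw [interior_Ici, mem_Ioi] at hx
  rw [(hderiv x).deriv]
  have hn' : (2 : ℝ) ≤ n := by exact_mod_cast hn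
  set c : ℝ := (n : ℝ) / ((n : ℝ) - 1) ^ 2 with hc
  have hterm (i : Fin n) :
      |a i * ((i : ℕ) * x ^ ((i : ℕ) - 1))| ≤ (i : ℕ) * (c * x ^ (n - 2)) := by
    rcases Nat.eq_zero_or_pos (i : ℕ) with h | h
    · simp [h]
    · rw [abs_mul, abs_of_nonneg (a := ((i : ℕ) : ℝ) * x ^ ((i : ℕ) - 1)) (by positivity)]
      calc |a i| * ((i : ℕ) * x ^ ((i : ℕ) - 1))
          ≤ c * ((i : ℕ) * x ^ (n - 2)) := by
            have hpow := pow_le_pow_right₀ hx.le (by omega : (i : ℕ) - 1 ≤ n - 2)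
            have hc0 := (abs_nonneg (a i)).trans (ha i h)
            gcongr
            exact ha i h
        _ = (i : ℕ) * (c * x ^ (n - 2)) := by ring
  have hgauss : ∑ i : Fin n, ((i : ℕ) : ℝ) = n * (n - 1) / 2 := by
    have h := Finset.sum_range_id_mul_two n
    have h' : ((∑ i ∈ Finset.range n, i : ℕ) : ℝ) * 2 = n * ((n : ℝ) - 1) := by
      rw [← Nat.cast_pred (by omega : 0 < n)]
      exact_mod_cast h
    rw [Fin.sum_univ_eq_sum_range (fun i => (i : ℝ)) n, ← Nat.cast_sum]
    linarith
  have hsum := (Finset.abs_sum_le_sum_abs _ _).trans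
    (Finset.sum_le_sum fun i (_ : i ∈ Finset.univ) => hterm i)
  rw [← Finset.sum_mul, hgauss] at hsum
  have hc_le : (n : ℝ) * (n - 1) / 2 * c ≤ n := by
    have hpos : (0 : ℝ) < n - 1 := by linarith
    have : (n : ℝ) * (n - 1) / 2 * c = n * (n / (2 * (n - 1))) := by
      rw [hc]
      field_simp
    rw [this]
    refine mul_le_of_le_one_right (by linarith) ?_
    rw [div_le_one (by linarith)]
    linarith
  have hpow : x ^ (n - 2) < x ^ (n - 1) := pow_lt_pow_right₀ hx (by omega)
  have hpow0 : 0 < x ^ (n - 2) := by positivity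
  have hlt : (n : ℝ) * x ^ (n - 2) < n * x ^ (n - 1) := by gcongr
  have hle := mul_le_mul_of_nonneg_right hc_le hpow0.le
  have habs := neg_le_of_abs_le hsum
  nlinarith

/-- On `[-1, 1]` the constant coefficient dominates the other terms. -/
lemma abs_sub_const_lt {n : ℕ} (hn : 2 ≤ n) (h0 : 0 < n) (a : Fin n → ℝ)
    (ha : ∀ i : Fin n, 1 ≤ (i : ℕ) → |a i| ≤ (n : ℝ) / ((n : ℝ) - 1) ^ 2)
    (hb : (2 * (n : ℝ) - 1) / ((n : ℝ) - 1) < |a ⟨0, h0⟩|) {x : ℝ} (hx : |x| ≤ 1) :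
    |x ^ n + ∑ i : Fin n, a i * x ^ (i : ℕ) - a ⟨0, h0⟩| < |a ⟨0, h0⟩| := by
  obtain ⟨m, rfl⟩ : ∃ m, n = m + 1 := ⟨n - 1, by omega⟩
  refine lt_of_le_of_lt ?_ hb
  have hm : (0 : ℝ) < m := by
    have : 0 < m := by omega
    exact_mod_cast this
  have hpow (k : ℕ) : |x ^ k| ≤ 1 := by
    rw [abs_pow]
    exact pow_le_one₀ (abs_nonneg x) hx
  have hterm (i : Fin m) :
      |a i.succ * x ^ (i.succ : ℕ)| ≤ ((m + 1 : ℕ) : ℝ) / (((m + 1 : ℕ) : ℝ) - 1) ^ 2 := by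
    rw [abs_mul]
    exact (mul_le_of_le_one_right (abs_nonneg _) (hpow _)).trans (ha _ (by simp))
  have hsum := (Finset.abs_sum_le_sum_abs _ _).trans
    (Finset.sum_le_sum fun i (_ : i ∈ Finset.univ) => hterm i)
  rw [Finset.sum_const, Finset.card_univ, Fintype.card_fin, nsmul_eq_mul] at hsum
  have hsplit : x ^ (m + 1) + ∑ i : Fin (m + 1), a i * x ^ (i : ℕ) - a ⟨0, h0⟩ =
      x ^ (m + 1) + ∑ i : Fin m, a i.succ * x ^ (i.succ : ℕ) := by
    rw [Fin.sum_univ_succ]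
    simp only [Fin.zero_eta, Fin.val_zero, pow_zero, mul_one]
    ring
  rw [hsplit]
  refine (abs_add_le _ _).trans ((add_le_add (hpow _) hsum).trans_eq ?_)
  rw [Nat.cast_add_one, add_sub_cancel_right]
  field_simp
  ring

lemma mul_pos_of_abs_sub_lt {a b p q : ℝ} (ha : |a - p| < |p|) (hb : |b - q| < |q|)
    (hpq : 0 < p * q) : 0 < a * b := by
  rcases pos_and_pos_or_neg_and_neg_of_mul_pos hpq with ⟨hp, hq⟩ | ⟨hp, hq⟩
  · rw [abs_of_pos hp, abs_lt] at ha
    rw [abs_of_pos hq, abs_lt] at hb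
    exact mul_pos (by linarith) (by linarith)
  · rw [abs_of_neg hp, abs_lt] at ha
    rw [abs_of_neg hq, abs_lt] at hb
    exact mul_pos_of_neg_of_neg (by linarith) (by linarith)

lemma mul_pos_of_continuousOn_ne_zero {s : Set ℝ} (hs : s.OrdConnected) {p : ℝ → ℝ}
    (hp : ContinuousOn p s) (h0 : ∀ t ∈ s, p t ≠ 0) {u v : ℝ} (hu : u ∈ s) (hv : v ∈ s) :
    0 < p u * p v := by
  by_contra! h
  have hmem : (0 : ℝ) ∈ uIcc (p u) (p v) := by
    rw [mem_uIcc]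
    rcases mul_nonpos_iff.1 h with h | h
    · exact Or.inr ⟨h.2, h.1⟩
    · exact Or.inl h
  obtain ⟨t, ht, h⟩ := intermediate_value_uIcc (hp.mono (hs.uIcc_subset hu hv)) hmem
  exact h0 t (hs.uIcc_subset hu hv ht) h

section Uniqueness

variable {n : ℕ} {ω ε : ℝ} {P : Fin n → ℝ → ℝ}

/-- A positive periodic solution of `x' = ε f(x, t)` stays above `1`. -/
lemma one_lt_of_pos_periodic (hn : 2 ≤ n) (h0 : 0 < n) (hω : 0 < ω) (hε : ε ≠ 0)
    (hP : ContinuousOn (P ⟨0, h0⟩) (Icc 0 ω))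
    (ha : ∀ t ∈ Icc (0 : ℝ) ω, ∀ i : Fin n, 1 ≤ (i : ℕ) →
      |P i t| < (n : ℝ) / ((n : ℝ) - 1) ^ 2)
    (hb : ∀ t ∈ Icc (0 : ℝ) ω, (2 * (n : ℝ) - 1) / ((n : ℝ) - 1) < |P ⟨0, h0⟩ t|)
    {x : ℝ → ℝ}
    (hx : ∀ t ∈ Icc (0 : ℝ) ω, HasDerivWithinAt x (ε * fR n P (x t) t) (Icc (0 : ℝ) ω) t)
    (hper : x 0 = x ω) (hpos : ∀ t ∈ Icc (0 : ℝ) ω, 0 < x t) :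
    ∀ t ∈ Icc (0 : ℝ) ω, 1 < x t := by
  obtain ⟨s, hs, r, hr, hmin, heq, hmul⟩ :=
    exists_max_mul_deriv_nonpos hω (fun t ht => (hx t ht).fun_neg) (by simp [hper])
  simp only [neg_le_neg_iff, neg_inj] at hmin heq
  intro t ht
  refine lt_of_lt_of_le ?_ (hmin t ht)
  by_contra! hle
  have hdom {u : ℝ} (hu : u ∈ Icc (0 : ℝ) ω) (hu1 : x u ≤ 1) :
      |fR n P (x u) u - P ⟨0, h0⟩ u| < |P ⟨0, h0⟩ u| :=
    abs_sub_const_lt hn h0 (fun i => P i u) (fun i hi => (ha u hu i hi).le) (hb u hu)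
      (by rwa [abs_of_pos (hpos u hu)])
  have hne : ∀ u ∈ Icc (0 : ℝ) ω, P ⟨0, h0⟩ u ≠ 0 := fun u hu h => by
    have hn' : (2 : ℝ) ≤ n := by exact_mod_cast hn
    have := hb u hu
    rw [h, abs_zero] at this
    exact this.not_ge (div_nonneg (by linarith) (by linarith))
  have hprod := mul_pos_of_abs_sub_lt (hdom hs hle) (hdom hr (heq.trans_le hle))
    (mul_pos_of_continuousOn_ne_zero ordConnected_Icc hP hne hs hr)
  have := mul_pos (sq_pos_of_ne_zero hε) hprod
  linarith

lemma le_of_one_lt_periodic (hn : 2 ≤ n) (hω : 0 < ω) (hε : ε ≠ 0)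
    (ha : ∀ t ∈ Icc (0 : ℝ) ω, ∀ i : Fin n, 1 ≤ (i : ℕ) →
      |P i t| < (n : ℝ) / ((n : ℝ) - 1) ^ 2)
    {x y : ℝ → ℝ}
    (hx : ∀ t ∈ Icc (0 : ℝ) ω, HasDerivWithinAt x (ε * fR n P (x t) t) (Icc (0 : ℝ) ω) t)
    (hxper : x 0 = x ω) (hx1 : ∀ t ∈ Icc (0 : ℝ) ω, 1 < x t)
    (hy : ∀ t ∈ Icc (0 : ℝ) ω, HasDerivWithinAt y (ε * fR n P (y t) t) (Icc (0 : ℝ) ω) t)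
    (hyper : y 0 = y ω) (hy1 : ∀ t ∈ Icc (0 : ℝ) ω, 1 < y t) :
    ∀ t ∈ Icc (0 : ℝ) ω, y t ≤ x t := by
  obtain ⟨s, hs, r, hr, hmax, heq, hmul⟩ :=
    exists_max_mul_deriv_nonpos hω (fun t ht => (hy t ht).fun_sub (hx t ht))
      (by simp [hxper, hyper])
  intro t ht
  refine sub_nonpos.1 ((hmax t ht).trans ?_)
  by_contra! hpos
  have hlt {u : ℝ} (hu : u ∈ Icc (0 : ℝ) ω) (hxy : 0 < y u - x u) :
      0 < fR n P (y u) u - fR n P (x u) u :=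
    sub_pos.2 (strictMonoOn_monic hn (fun i => P i u) (fun i hi => (ha u hu i hi).le)
      (hx1 u hu).le (hy1 u hu).le (sub_pos.1 hxy))
  have := mul_pos (sq_pos_of_ne_zero hε) (mul_pos (hlt hs hpos) (hlt hr (heq ▸ hpos)))
  linarith

/-- The equation `x' = ε f(x, t)` has at most one positive periodic solution. -/
lemma pos_periodic_unique (hn : 2 ≤ n) (h0 : 0 < n) (hω : 0 < ω) (hε : ε ≠ 0)
    (hP : ContinuousOn (P ⟨0, h0⟩) (Icc 0 ω))
    (ha : ∀ t ∈ Icc (0 : ℝ) ω, ∀ i : Fin n, 1 ≤ (i : ℕ) →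
      |P i t| < (n : ℝ) / ((n : ℝ) - 1) ^ 2)
    (hb : ∀ t ∈ Icc (0 : ℝ) ω, (2 * (n : ℝ) - 1) / ((n : ℝ) - 1) < |P ⟨0, h0⟩ t|)
    {x y : ℝ → ℝ}
    (hx : ∀ t ∈ Icc (0 : ℝ) ω, HasDerivWithinAt x (ε * fR n P (x t) t) (Icc (0 : ℝ) ω) t)
    (hxper : x 0 = x ω) (hx0 : ∀ t ∈ Icc (0 : ℝ) ω, 0 < x t)
    (hy : ∀ t ∈ Icc (0 : ℝ) ω, HasDerivWithinAt y (ε * fR n P (y t) t) (Icc (0 : ℝ) ω) t)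
    (hyper : y 0 = y ω) (hy0 : ∀ t ∈ Icc (0 : ℝ) ω, 0 < y t) :
    x 0 = y 0 := by
  have hx1 := one_lt_of_pos_periodic hn h0 hω hε hP ha hb hx hxper hx0
  have hy1 := one_lt_of_pos_periodic hn h0 hω hε hP ha hb hy hyper hy0
  have hmem : (0 : ℝ) ∈ Icc (0 : ℝ) ω := left_mem_Icc.2 hω.le
  exact le_antisymm (le_of_one_lt_periodic hn hω hε ha hy hyper hy1 hx hxper hx1 0 hmem)
    (le_of_one_lt_periodic hn hω hε ha hx hxper hx1 hy hyper hy1 0 hmem)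

end Uniqueness

/-- The substitution `x ↦ -x` turns the polynomial into another one of the same shape. -/
lemma fR_neg (n : ℕ) (P : Fin n → ℝ → ℝ) (x t : ℝ) :
    fR n P (-x) t = (-1) ^ n * fR n (fun i t => (-1) ^ (n + (i : ℕ)) * P i t) x t := by
  simp only [fR, mul_add, Finset.mul_sum]
  congr 1
  · exact neg_pow x n
  · refine Finset.sum_congr rfl fun i _ => ?_
    have h : ((-1 : ℝ) ^ n) * (-1) ^ n = 1 := by rw [← mul_pow]; simp
    rw [neg_pow x, pow_add]
    linear_combination (-(-1) ^ (i : ℕ) * P i t * x ^ (i : ℕ)) * h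

lemma exists_finset_card_le_one {α β : Type*} {p : α → Prop} (f : α → β)
    (h : ∀ x y, p x → p y → f x = f y) :
    ∃ S : Finset β, S.card ≤ 1 ∧ ∀ x, p x → f x ∈ S := by
  by_cases hex : ∃ x, p x
  · obtain ⟨x, hx⟩ := hex
    exact ⟨{f x}, by simp, fun y hy => by simp [h y x hy hx]⟩
  · push Not at hex
    exact ⟨∅, by simp, fun x hx => absurd hx (hex x)⟩

/-- Theorem 1.3(i): if `|P_i(t)| < n/(n-1)²` for `1 ≤ i ≤ n-1` and
`|P_0(t)| > (2n-1)/(n-1)`, then equation (1.1) has at most one positive and at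
most one negative real periodic solution. -/
theorem theorem_1_3_i
    {n : ℕ} (hn : 2 ≤ n) {ω : ℝ} (hω : 0 < ω)
    (P : Fin n → ℝ → ℝ) (hP : ∀ i, ContinuousOn (P i) (Icc 0 ω))
    (ha : ∀ t ∈ Icc (0:ℝ) ω, ∀ i : Fin n, 1 ≤ (i:ℕ) →
      |P i t| < (n:ℝ) / ((n:ℝ) - 1) ^ 2)
    (hb : ∀ t ∈ Icc (0:ℝ) ω, (2 * (n:ℝ) - 1) / ((n:ℝ) - 1) < |P ⟨0, by omega⟩ t|) :
    (∃ S : Finset ℝ, S.card ≤ 1 ∧ ∀ x : ℝ → ℝ, IsPeriodicSolR n ω P x →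
      (∀ t ∈ Icc (0:ℝ) ω, 0 < x t) → x 0 ∈ S) ∧
    (∃ S : Finset ℝ, S.card ≤ 1 ∧ ∀ x : ℝ → ℝ, IsPeriodicSolR n ω P x →
      (∀ t ∈ Icc (0:ℝ) ω, x t < 0) → x 0 ∈ S) := by
  constructor
  · obtain ⟨S, hS, h⟩ := exists_finset_card_le_one
      (p := fun x : ℝ → ℝ => IsPeriodicSolR n ω P x ∧ ∀ t ∈ Icc (0 : ℝ) ω, 0 < x t)
      (fun x => x 0) fun x y hx hy =>
        pos_periodic_unique hn (by omega) hω one_ne_zero (hP _) ha hb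
          (by simpa only [one_mul] using hx.1.1) hx.1.2 hx.2
          (by simpa only [one_mul] using hy.1.1) hy.1.2 hy.2
    exact ⟨S, hS, fun x hx hpos => h x ⟨hx, hpos⟩⟩
  · have hneg {x : ℝ → ℝ} (hx : IsPeriodicSolR n ω P x) : ∀ t ∈ Icc (0 : ℝ) ω,
        HasDerivWithinAt (fun t => -x t)
          (-(-1) ^ n * fR n (fun i t => (-1) ^ (n + (i : ℕ)) * P i t) (-x t) t)
          (Icc (0 : ℝ) ω) t := fun t ht => by
      have h := (hx.1 t ht).fun_neg
      rwa [← neg_neg (x t), fR_neg, ← neg_mul] at h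
    obtain ⟨S, hS, h⟩ := exists_finset_card_le_one
      (p := fun x : ℝ → ℝ => IsPeriodicSolR n ω P x ∧ ∀ t ∈ Icc (0 : ℝ) ω, x t < 0)
      (fun x => x 0) fun x y hx hy => neg_injective <|
        pos_periodic_unique (ε := -(-1) ^ n)
          (P := fun i t => (-1) ^ (n + (i : ℕ)) * P i t) hn (by omega) hω (by simp)
          (continuousOn_const.mul (hP _))
          (by simpa [abs_mul] using ha) (by simpa [abs_mul] using hb)
          (hneg hx.1) (congrArg Neg.neg hx.1.2) (fun t ht => neg_pos.2 (hx.2 t ht))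
          (hneg hy.1) (congrArg Neg.neg hy.1.2) (fun t ht => neg_pos.2 (hy.2 t ht))
    exact ⟨S, hS, fun x hx hlt => h x ⟨hx, hlt⟩⟩
end
end

section
/- Let n ≥ 2 and ω > 0. For the equation dz/dt = z^n (all coefficients P_i identically zero), the displacement function q(c) = z(ω,c) − c has c = 0 as a zero of multiplicity exactly n and no other zeros; that is, the equation has exactly n periodic solutions counted with multiplicity. -/
open Set Real Filter

noncomputable section

/-- The function `s ↦ (1 - m s) ^ (-1 / m)`, the solution of `u' = u ^ (m + 1)` with `u 0 = 1`. -/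
def unitPowerSolution (m : ℕ) (s : ℂ) : ℂ :=
  Complex.exp (-(1 / (m : ℂ)) * Complex.log (1 - m * s))

theorem unitPowerSolution_zero (m : ℕ) : unitPowerSolution m 0 = 1 := by
  simp [unitPowerSolution]

theorem hasDerivAt_unitPowerSolution {m : ℕ} (hm : m ≠ 0) {s : ℂ}
    (hs : 1 - m * s ∈ Complex.slitPlane) :
    HasDerivAt (unitPowerSolution m) (unitPowerSolution m s ^ (m + 1)) s := by
  have hm' : (m : ℂ) ≠ 0 := by exact_mod_cast hm
  have hne : 1 - m * s ≠ 0 := Complex.slitPlane_ne_zero hs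
  have hpow : unitPowerSolution m s ^ m = (1 - m * s)⁻¹ := by
    rw [unitPowerSolution, ← Complex.exp_nat_mul,
      show (m : ℂ) * (-(1 / (m : ℂ)) * Complex.log (1 - m * s)) = -Complex.log (1 - m * s) by
        field_simp,
      Complex.exp_neg, Complex.exp_log hne]
  have h1 : HasDerivAt (fun x : ℂ => 1 - m * x) (-(m : ℂ)) s := by
    simpa using ((hasDerivAt_id s).const_mul (m : ℂ)).const_sub 1
  refine ((h1.clog hs).const_mul (-(1 / (m : ℂ)))).cexp.congr_deriv ?_
  rw [pow_succ, hpow, unitPowerSolution]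
  field_simp

theorem analyticAt_unitPowerSolution_zero (m : ℕ) : AnalyticAt ℂ (unitPowerSolution m) 0 := by
  unfold unitPowerSolution
  have h : AnalyticAt ℂ (fun s : ℂ => 1 - m * s) 0 := by fun_prop
  exact (analyticAt_const.mul (h.clog (by simp))).cexp

/-- The solution of `z' = z ^ (m + 1)` with initial value `c`, valid as long as
`1 - m t c ^ m` stays in the slit plane. -/
theorem hasDerivAt_mul_unitPowerSolution {m : ℕ} (hm : m ≠ 0) {c : ℂ} {t : ℝ}
    (ht : 1 - m * (t * c ^ m) ∈ Complex.slitPlane) :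
    HasDerivAt (fun t : ℝ => c * unitPowerSolution m (t * c ^ m))
      ((c * unitPowerSolution m (t * c ^ m)) ^ (m + 1)) t := by
  have h1 : HasDerivAt (fun t : ℝ => (t : ℂ) * c ^ m) (c ^ m) t := by
    simpa using (Complex.ofRealCLM.hasDerivAt (x := t)).mul_const (c ^ m)
  refine (((hasDerivAt_unitPowerSolution hm ht).comp t h1).const_mul c).congr_deriv ?_
  ring

/-- A solution of a homogeneous linear equation that vanishes initially vanishes identically. -/
theorem eq_zero_of_hasDerivWithinAt_mul_self {ω : ℝ} {f a : ℝ → ℂ}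
    (ha : ContinuousOn a (Icc 0 ω))
    (hf : ∀ t ∈ Icc (0 : ℝ) ω, HasDerivWithinAt f (a t * f t) (Icc 0 ω) t) (h0 : f 0 = 0) :
    ∀ t ∈ Icc (0 : ℝ) ω, f t = 0 := by
  obtain ⟨K, hK⟩ := isCompact_Icc.exists_bound_of_continuousOn ha
  intro t ht
  have h := norm_le_gronwallBound_of_norm_deriv_right_le (f := f) (f' := fun t => a t * f t)
    (δ := 0) (K := K) (ε := 0) (a := 0) (b := ω)
    (fun t ht => (hf t ht).continuousWithinAt)
    (fun t ht => (hf t (Ico_subset_Icc_self ht)).mono_of_mem_nhdsWithin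
      (Icc_mem_nhdsGE_of_mem ht))
    (by simp [h0])
    (fun t ht => by
      rw [norm_mul, add_zero]
      exact mul_le_mul_of_nonneg_right (hK t (Ico_subset_Icc_self ht)) (norm_nonneg _)) t ht
  simpa [gronwallBound_ε0] using h

/-- A solution of `z' = z ^ (m + 1)` on `[0, ω]` with equal end values starts at `0`. -/
theorem eq_zero_of_periodic_of_hasDerivWithinAt_pow {m : ℕ} (hm : m ≠ 0) {ω : ℝ} (hω : 0 < ω)
    {z : ℝ → ℂ} (hz : ∀ t ∈ Icc (0 : ℝ) ω, HasDerivWithinAt z (z t ^ (m + 1)) (Icc 0 ω) t)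
    (hper : z ω = z 0) : z 0 = 0 := by
  have hw : ∀ t ∈ Icc (0 : ℝ) ω,
      HasDerivWithinAt (fun t => z t ^ m) (m * (z t ^ m) ^ 2) (Icc 0 ω) t := fun t ht => by
    refine ((hz t ht).fun_pow m).congr_deriv ?_
    obtain ⟨k, rfl⟩ := Nat.exists_eq_succ_of_ne_zero hm
    simp only [Nat.succ_eq_add_one, Nat.add_sub_cancel]
    ring
  have key := eq_zero_of_hasDerivWithinAt_mul_self (ω := ω)
    (f := fun t => z t ^ m - z 0 ^ m - m * z 0 ^ m * (t * z t ^ m))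
    (a := fun t => m * z t ^ m)
    (fun t ht => continuousWithinAt_const.mul (hw t ht).continuousWithinAt)
    (fun t ht => by
      have h1 : HasDerivWithinAt (fun t : ℝ => (t : ℂ)) 1 (Icc 0 ω) t := 
        (Complex.ofRealCLM.hasDerivAt (x := t)).hasDerivWithinAt.congr_deriv (by simp)
      refine (((hw t ht).sub_const _).sub
        ((h1.mul (hw t ht)).const_mul ((m : ℂ) * z 0 ^ m))).congr_deriv ?_
      ring)
    (by simp) ω ⟨hω.le, le_rfl⟩
  simpa [hper, hm, hω.ne'] using key

/-- If `u` has nonzero derivative at `0`, then `c ↦ c (u (a c ^ m) - u 0)` has a zero of order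
`m + 1` at `0`. -/
theorem hasZeroOfOrder_mul_sub {u : ℂ → ℂ} (hu : AnalyticAt ℂ u 0) (hu' : deriv u 0 ≠ 0)
    {m : ℕ} (hm : m ≠ 0) {a : ℂ} (ha : a ≠ 0) :
    HasZeroOfOrder (fun c => c * (u (a * c ^ m) - u 0)) 0 (m + 1) := by
  have hd : AnalyticAt ℂ (dslope u 0) 0 := by
    obtain ⟨p, hp⟩ := hu
    exact hp.has_fpower_series_dslope_fslope.analyticAt
  refine ⟨fun c => a * dslope u 0 (a * c ^ m), ?_, ?_, .of_forall fun c => ?_⟩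
  · refine analyticAt_const.mul (AnalyticAt.comp (g := dslope u 0) ?_ (by fun_prop))
    simpa [hm] using hd
  · simp [hm, ha, hu']
  · have h := sub_smul_dslope u 0 (a * c ^ m)
    simp only [sub_zero, smul_eq_mul] at h
    simp only [← h, sub_zero]
    ring

/-- For `dz/dt = z^n`, the displacement function `q(c) = z(ω,c) - c` has `c = 0`
as a zero of multiplicity exactly `n` and no other zeros: the equation has exactly
`n` periodic solutions counted with multiplicity. -/
theorem pure_power_has_n_periodic_solutions
    {n : ℕ} (hn : 2 ≤ n) {ω : ℝ} (hω : 0 < ω)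
    -- `Q` is the set of initial values whose solution exists on all of `[0, ω]`
    (Q : Set ℂ)
    (hQ : ∀ c, c ∈ Q ↔ ∃ z : ℝ → ℂ,
      (∀ t ∈ Icc (0:ℝ) ω, HasDerivWithinAt z ((z t) ^ n) (Icc (0:ℝ) ω) t) ∧ z 0 = c)
    -- `q` is the displacement function
    (q : ℂ → ℂ)
    (hq : ∀ (c : ℂ) (z : ℝ → ℂ),
      (∀ t ∈ Icc (0:ℝ) ω, HasDerivWithinAt z ((z t) ^ n) (Icc (0:ℝ) ω) t) → z 0 = c →
      q c = z ω - c) :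
    (0:ℂ) ∈ Q ∧ HasZeroOfOrder q 0 n ∧ ∀ c ∈ Q, c ≠ 0 → q c ≠ 0 := by
  obtain ⟨m, rfl⟩ : ∃ m, n = m + 1 := ⟨n - 1, by omega⟩
  have hm : m ≠ 0 := by omega
  refine ⟨(hQ 0).2 ⟨0, fun t _ => ?_, rfl⟩, ?_, fun c hc hc0 hqc => ?_⟩
  · exact (hasDerivWithinAt_const t (Icc 0 ω) (0 : ℂ)).congr_deriv (by simp)
  · have hev : ∀ᶠ c in nhds (0 : ℂ),
        q c = c * (unitPowerSolution m (ω * c ^ m) - unitPowerSolution m 0) := by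
      have hlim : Tendsto (fun c : ℂ => m * (ω * ‖c‖ ^ m)) (nhds 0) (nhds 0) := by
        have : Continuous fun c : ℂ => m * (ω * ‖c‖ ^ m) := by fun_prop
        simpa [hm] using this.tendsto 0
      filter_upwards [hlim.eventually_lt_const one_pos] with c hc
      have hslit : ∀ t ∈ Icc (0 : ℝ) ω, 1 - m * (t * c ^ m) ∈ Complex.slitPlane := fun t ht => by
        rw [sub_eq_add_neg]
        refine Complex.mem_slitPlane_of_norm_lt_one (lt_of_le_of_lt ?_ hc)
        simp only [norm_neg, norm_mul, norm_pow, Complex.norm_natCast, Complex.norm_real,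
          Real.norm_of_nonneg ht.1]
        gcongr
        exact ht.2
      rw [hq c (fun t => c * unitPowerSolution m (t * c ^ m))
        (fun t ht => (hasDerivAt_mul_unitPowerSolution hm (hslit t ht)).hasDerivWithinAt)
        (by simp [unitPowerSolution_zero]), unitPowerSolution_zero]
      ring
    have hderiv : deriv (unitPowerSolution m) 0 ≠ 0 := by
      rw [(hasDerivAt_unitPowerSolution hm (by simp)).deriv, unitPowerSolution_zero]
      simp
    obtain ⟨g, hg, hg0, hge⟩ := hasZeroOfOrder_mul_sub (analyticAt_unitPowerSolution_zero m)
      hderiv hm (Complex.ofReal_ne_zero.2 hω.ne')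
    exact ⟨g, hg, hg0, hev.mp (hge.mono fun c h1 h2 => h2.trans h1)⟩
  · obtain ⟨z, hz, rfl⟩ := (hQ c).1 hc
    refine hc0 (eq_zero_of_periodic_of_hasDerivWithinAt_pow hm hω hz ?_)
    rwa [hq _ z hz rfl, sub_eq_zero] at hqc
end
end
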